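/- ∫₀^∞ I₀(t)[K₀(t)]⁵·t·(1 − 8t²) dt = (81√3·π³/2200)·₇F₆(−1/3,1/3,2/3,4/3,3/2,3/2,7/4; 3/4,1,7/6,11/6,13/6,17/6 | 1). -/

import Mathlib

open Real MeasureTheory Set

/-- Modified Bessel function `I₀(t) = (1/π)∫₀^π exp(t cos θ) dθ`. -/
noncomputable def I0 (t : ℝ) : ℝ := (1 / π) * ∫ θ in (0:ℝ)..π, exp (t * cos θ)

/-- Modified Bessel function `K₀(t) = ∫₀^∞ exp(−t cosh u) du`. -/
noncomputable def K0 (t : ℝ) : ℝ := ∫ u in Ioi (0:ℝ), exp (-(t * Real.cosh u))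

/-- Rising factorial `(a)ₙ = a(a+1)⋯(a+n−1)`. -/
noncomputable def ris (a : ℝ) (n : ℕ) : ℝ := ∏ k ∈ Finset.range n, (a + k)

/-- Generalized hypergeometric series `ₚF_q(a; b | x)`. -/
noncomputable def pFq (a b : List ℝ) (x : ℝ) : ℝ :=
  ∑' n : ℕ, ((a.map fun p => ris p n).prod / (b.map fun q => ris q n).prod) * x ^ n
    / (n.factorial : ℝ)

noncomputable section
open Filter Topology
lemma ftc0 {G g:ℝ → ℝ} {a b:ℝ} (h : ∀ t,0 < t → HasDerivAt G (g t) t)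
    (hi : IntegrableOn g (Ioi 0)) (h0 : Tendsto G (𝓝[>] 0) (𝓝 a))
    (h1 : Tendsto G atTop (𝓝 b)) : ∫ t in Ioi (0:ℝ), g t = b-a := by
  have hc : ContinuousWithinAt (Function.update G 0 a) (Ici 0) 0 := by
    rw [continuousWithinAt_update_same]
    refine h0.mono_left (nhdsWithin_mono _ ?_)
    intro x hx; exact lt_of_le_of_ne hx.1 (Ne.symm hx.2)
  have hd : ∀ x ∈ Ioi (0:ℝ), HasDerivAt (Function.update G 0 a) (g x) x := by
    intro x hx
    refine (h x hx).congr_of_eventuallyEq ?_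
    filter_upwards [lt_mem_nhds (mem_Ioi.1 hx)] with y hy
    simp [Function.update_of_ne hy.ne']
  have := integral_Ioi_of_hasDerivAt_of_tendsto (m := b) hc hd hi (h1.congr' ?_)
  · simpa using this
  · filter_upwards [eventually_gt_atTop 0] with y hy
    simp [Function.update_of_ne hy.ne']
lemma ftc0_nonneg {G g E:ℝ → ℝ} {a b:ℝ} (h : ∀ t,0 < t → HasDerivAt G (g t-E t) t)
    (hg : ∀ t,0 < t → 0 ≤ g t) (hgc : ContinuousOn g (Ioi 0))
    (hE : IntegrableOn E (Ioi 0)) (hEc : ContinuousOn E (Ioi 0))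
    (h0 : Tendsto G (𝓝[>] 0) (𝓝 a))
    (h1 : Tendsto G atTop (𝓝 b)) : IntegrableOn g (Ioi 0) ∧
      ∫ t in Ioi (0:ℝ), g t = b-a + ∫ t in Ioi (0:ℝ), E t := by
  have key : ∀ x y,0 < x → x ≤ y → ∫ t in x..y, g t = G y-G x + ∫ t in x..y, E t := by
    intro x y hx hxy
    have hsub : uIcc x y ⊆ Ioi 0 := by
      rw [uIcc_of_le hxy]; intro z hz; exact lt_of_lt_of_le hx hz.1
    have h2 : ∫ t in x..y, (g t-E t) = G y-G x :=
      intervalIntegral.integral_eq_sub_of_hasDerivAt (fun t ht => h t (hsub ht))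
        (((hgc.sub hEc).mono hsub).intervalIntegrable)
    rw [intervalIntegral.integral_sub ((hgc.mono hsub).intervalIntegrable)
      ((hEc.mono hsub).intervalIntegrable)] at h2
    linarith
  have hInt : IntegrableOn g (Ioi 0) := by
    have hconv : AECover (volume.restrict (Ioi (0:ℝ))) atTop
        (fun n:ℕ => Ioc (1/((n:ℝ)+1)) ((n:ℝ)+1)) := by
      constructor
      · refine (ae_restrict_iff' measurableSet_Ioi).2 (Eventually.of_forall fun x hx => ?_)
        have e1 : ∀ᶠ n:ℕ in atTop,1/((n:ℝ)+1) < x :=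
          tendsto_one_div_add_atTop_nhds_zero_nat.eventually (gt_mem_nhds (mem_Ioi.1 hx))
        have e2 : ∀ᶠ n:ℕ in atTop, x < (n:ℝ) := by
          exact tendsto_natCast_atTop_atTop.eventually (eventually_gt_atTop x)
        filter_upwards [e1, e2] with n h1 h2
        exact ⟨h1, by linarith⟩
      · intro n; exact measurableSet_Ioc
    have hle : ∀ n:ℕ,1/((n:ℝ)+1) ≤ (n:ℝ)+1 := by
      intro n
      have : (1:ℝ) ≤ (n:ℝ)+1 := by linarith [(Nat.cast_nonneg n : (0:ℝ) ≤ n)]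
      exact le_trans (by rw [div_le_one (by linarith)]; exact this) this
    have hpos : ∀ n:ℕ,0<1/((n:ℝ)+1) := fun n => by positivity
    have t1 : Tendsto (fun n:ℕ => G ((n:ℝ)+1)) atTop (𝓝 b) :=
      h1.comp (tendsto_atTop_add_const_right _ _ tendsto_natCast_atTop_atTop)
    have t0 : Tendsto (fun n:ℕ => G (1/((n:ℝ)+1))) atTop (𝓝 a) := by
      refine h0.comp (tendsto_nhdsWithin_iff.2 ⟨tendsto_one_div_add_atTop_nhds_zero_nat, ?_⟩)
      exact Eventually.of_forall fun n => hpos n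
    have hb : ∃ I, ∀ n:ℕ, G ((n:ℝ)+1)-G (1/((n:ℝ)+1)) ≤ I := by
      obtain ⟨I, hI⟩ := (t1.sub t0).bddAbove_range
      exact ⟨I, fun n => hI ⟨n, rfl⟩⟩
    obtain ⟨I, hI⟩ := hb
    refine hconv.integrable_of_integral_norm_bounded (I + ∫ t in Ioi (0:ℝ), |E t|) ?_ ?_
    · intro n
      have hsub : Icc (1/((n:ℝ)+1)) ((n:ℝ)+1) ⊆ Ioi 0 := fun z hz => lt_of_lt_of_le (hpos n) hz.1
      have := (hgc.mono hsub).integrableOn_Icc (μ := volume)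
      exact (this.mono_set Ioc_subset_Icc_self).mono_measure (Measure.restrict_le_self)
    · refine Eventually.of_forall fun n => ?_
      have hsub : Ioc (1/((n:ℝ)+1)) ((n:ℝ)+1) ⊆ Ioi 0 := fun z hz => (hpos n).trans hz.1
      rw [Measure.restrict_restrict measurableSet_Ioc, inter_eq_left.2 hsub]
      have e1 : ∫ x in Ioc (1/((n:ℝ)+1)) ((n:ℝ)+1), ‖g x‖
          = ∫ x in (1/((n:ℝ)+1))..((n:ℝ)+1), g x := by
        rw [intervalIntegral.integral_of_le (hle n)]
        refine setIntegral_congr_fun measurableSet_Ioc fun x hx => ?_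
        simp only [norm_eq_abs]
        exact abs_of_nonneg (hg x (hsub hx))
      rw [e1, key _ _ (hpos n) (hle n), intervalIntegral.integral_of_le (hle n)]
      refine add_le_add (hI n) ?_
      calc _ ≤ ∫ x in Ioc (1/((n:ℝ)+1)) ((n:ℝ)+1), |E x| :=
            integral_mono (hE.mono_set hsub) (hE.mono_set hsub).abs (fun x => le_abs_self _)
        _ ≤ _ := setIntegral_mono_set hE.abs (Eventually.of_forall fun x => abs_nonneg _)
            (LE.le.eventuallyLE hsub)
  refine ⟨hInt, ?_⟩
  have := ftc0 h (hInt.sub hE) h0 h1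
  rw [integral_sub hInt hE] at this
  linarith
def ps (c:ℕ → ℝ) (x:ℝ) : ℝ := ∑' n, c n*x^n
def dc (c:ℕ → ℝ) (n:ℕ) : ℝ := ((n:ℝ)+1)*c (n+1)
def cb (c:ℕ → ℝ) (R:ℝ) : Prop := ∃ C, ∀ n, |c n| * R^n ≤ C
lemma cb.summable {c:ℕ → ℝ} {R:ℝ} (h : cb c R) {x:ℝ} (hx : |x| < R) :
    Summable fun n => c n*x^n := by
  obtain ⟨C, hC⟩ := h
  have hR :0 < R := (abs_nonneg x).trans_lt hx
  have hq : |x| / R<1 := (div_lt_one hR).2 hx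
  refine Summable.of_norm_bounded (g := fun n => C*(|x|/R)^n)
    ((summable_geometric_of_lt_one (by positivity) hq).mul_left C) fun n => ?_
  have : |c n*x^n| = (|c n| * R^n)*(|x|/R)^n := by
    rw [abs_mul, abs_pow, div_pow]; field_simp
  rw [norm_eq_abs, this]
  exact mul_le_mul_of_nonneg_right (hC n) (by positivity)
lemma cb.dc {c:ℕ → ℝ} {R:ℝ} (h : cb c R) {r:ℝ} (hr :0 ≤ r) (hx : r < R) :
    cb (dc c) r := by
  obtain ⟨C, hC⟩ := h
  have hR :0 < R := hr.trans_lt hx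
  have hq : r/R<1 := (div_lt_one hR).2 hx
  have hq0 :0 ≤ r/R := by positivity
  have hs : Summable fun n:ℕ => ((n:ℝ)+1)*(r/R)^n := by
    have h1 := summable_pow_mul_geometric_of_norm_lt_one 1 (r := r/R)
      (by rwa [norm_eq_abs, abs_of_nonneg hq0])
    have h2 := summable_geometric_of_lt_one hq0 hq
    refine (h1.add h2).congr fun n => by simp; ring
  obtain ⟨D, hD⟩ := hs.tendsto_atTop_zero.bddAbove_range
  refine ⟨C/R*D, fun n => ?_⟩
  have : |_root_.dc c n| * r^n = (|c (n+1)| * R^(n+1))/R*(((n:ℝ)+1)*(r/R)^n) := by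
    unfold _root_.dc
    rw [abs_mul, abs_of_nonneg (by positivity : (0:ℝ) ≤ (n:ℝ)+1), div_pow]; field_simp; ring
  rw [this]
  have hC0 :0 ≤ C := (by positivity :0 ≤ |c 0| * R^0).trans (hC 0)
  refine mul_le_mul ?_ (hD ⟨n, rfl⟩) (by positivity) (by positivity)
  exact div_le_div_of_nonneg_right (hC _) hR.le
lemma ps_hasDerivAt {c:ℕ → ℝ} {R:ℝ} (h : cb c R) {x:ℝ} (hx : |x| < R) :
    HasDerivAt (ps c) (ps (dc c) x) x := by
  obtain ⟨r, hr1, hr2⟩ := exists_between hx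
  obtain ⟨r', hr3, hr4⟩ := exists_between hr2
  have hr :0 < r := (abs_nonneg x).trans_lt hr1
  have hs : Summable fun n => |dc c n| * r^n := by
    have := ((h.dc (hr.trans hr3).le hr4).summable (x := r) (by rwa [abs_of_pos hr])).abs
    exact this.congr fun n => by rw [abs_mul, abs_of_nonneg (by positivity :0 ≤ r^n)]
  have hu : Summable fun n:ℕ => |c n| * (n*r^(n-1)) := by
    refine (summable_nat_add_iff 1).1 (hs.congr fun n => ?_)
    unfold dc
    rw [abs_mul, abs_of_nonneg (by positivity : (0:ℝ) ≤ (n:ℝ)+1)]; push_cast; ring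
  have main := hasDerivAt_tsum_of_isPreconnected (𝕜 := ℝ) (g := fun n y => c n*y^n)
    (g' := fun n y => c n*(n*y^(n-1))) (t := Metric.ball (0:ℝ) r) hu Metric.isOpen_ball
    (convex_ball 0 r).isPreconnected (fun n y _ => (hasDerivAt_pow n y).const_mul _) ?_
    (y₀ := x) (by simpa using hr1) (h.summable hx) (y := x) (by simpa using hr1)
  · suffices e : ps (dc c) x = ∑' n:ℕ, c n*(n*x^(n-1)) by rw [e]; exact main
    have hs' : Summable fun n:ℕ => c n*(n*x^(n-1)) := by
      refine Summable.of_norm_bounded hu fun n => ?_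
      rw [norm_mul, norm_eq_abs, norm_mul, norm_pow, norm_eq_abs, norm_eq_abs,
        abs_of_nonneg (Nat.cast_nonneg n : (0:ℝ) ≤ n)]
      gcongr
    rw [hs'.tsum_eq_zero_add]
    simp only [CharP.cast_eq_zero, zero_mul, mul_zero, zero_add]
    refine tsum_congr fun n => ?_
    unfold dc; push_cast; ring
  · intro n y hy
    rw [norm_mul, norm_eq_abs, norm_mul, norm_pow, norm_eq_abs, norm_eq_abs,
      abs_of_nonneg (Nat.cast_nonneg n : (0:ℝ) ≤ n)]
    have : |y| ≤ r := by simpa using (Metric.mem_ball.1 hy).le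
    gcongr
lemma ris_succ (a:ℝ) (n:ℕ) : ris a (n+1) = ris a n*(a+n) := Finset.prod_range_succ _ _
lemma ris_zero (a:ℝ) : ris a 0=1 := by simp [ris]
lemma ris_pos {a:ℝ} (ha :0 < a) (n:ℕ) :0 < ris a n :=
  Finset.prod_pos fun k _ => by positivity
lemma ris_lim {a:ℝ} (h0 :0 < a) (h1 : a<1) :
    Tendsto (fun n:ℕ => n*(ris a n*ris (1-a) n/(n.factorial:ℝ)^2)) atTop
      (𝓝 (sin (π*a)/π)) := by
  have hG := (Real.GammaSeq_tendsto_Gamma a).mul (Real.GammaSeq_tendsto_Gamma (1-a))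
  rw [Real.Gamma_mul_Gamma_one_sub] at hG
  have hs :0 < sin (π*a) := sin_pos_of_pos_of_lt_pi (by positivity) (by nlinarith [pi_pos])
  have hG2 := hG.inv₀ (by positivity)
  have l1 : ∀ b:ℝ, Tendsto (fun n:ℕ => (n:ℝ)/(b+n)) atTop (𝓝 1) := by
    intro b
    have := tendsto_natCast_div_add_atTop (𝕜 := ℝ) b
    exact this.congr fun n => by rw [add_comm]
  have := ((l1 a).mul (l1 (1-a))).mul hG2
  rw [inv_div, one_mul, one_mul] at this
  refine this.congr' ?_
  filter_upwards [eventually_gt_atTop 0] with n hn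
  have hn' : (0:ℝ) < n := by exact_mod_cast hn
  have e : (n:ℝ)^a*(n:ℝ)^(1-a) = n := by
    rw [← rpow_add hn']; simp
  unfold Real.GammaSeq
  have p1 := ris_succ a n
  have p2 := ris_succ (1-a) n
  rw [ris] at p1 p2
  rw [p1, p2]
  have q1 := (ris_pos h0 n).ne'
  have q2 := (ris_pos (sub_pos.2 h1) n).ne'
  have q3 : a+n≠0 := by positivity
  have q4 :1-a+n≠0 := by linarith
  have q5 : ((n.factorial:ℕ):ℝ)≠0 := by positivity
  have e2 : (n:ℝ)^a≠0 := (rpow_pos_of_pos hn' _).ne'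
  have e3 : (n:ℝ)^(1-a) = n/(n:ℝ)^a := by rw [eq_div_iff e2, mul_comm]; exact e
  rw [e3]
  field_simp
def cI (n:ℕ) : ℝ :=1/(n.factorial:ℝ)^2
lemma cI_succ (n:ℕ) : ((n:ℝ)+1)^2*cI (n+1) = cI n := by
  unfold cI; rw [Nat.factorial_succ]; push_cast
  have : ((n.factorial:ℕ):ℝ)≠0 := by positivity
  field_simp
lemma cI_pos (n:ℕ) :0 < cI n := by unfold cI; positivity
lemma cI_cb (R:ℝ) (hR :0 ≤ R) : cb cI R := by
  refine ⟨exp R, fun n => ?_⟩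
  have h := Real.pow_div_factorial_le_exp R hR n
  have h1 : (1:ℝ) ≤ n.factorial := by exact_mod_cast Nat.one_le_iff_ne_zero.2 (Nat.factorial_ne_zero n)
  refine le_trans ?_ h
  rw [abs_of_pos (cI_pos n), cI, div_mul_eq_mul_div, one_mul]
  refine div_le_div_of_nonneg_left (by positivity) (by positivity) ?_
  nlinarith
lemma int_cos_even (n:ℕ) : ∫ θ in (0:ℝ)..π, cos θ^(2*n) = π*((2*n).factorial*cI n/4^n) := by
  induction n with
  | zero => simp [cI]
  | succ n ih =>
    rw [show 2*(n+1)=2*n+2 by ring, integral_cos_pow, ih, Nat.factorial_succ, Nat.factorial_succ,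
      ← cI_succ n]
    simp; field_simp; ring
lemma int_cos_odd (n:ℕ) : ∫ θ in (0:ℝ)..π, cos θ^(2*n+1)=0 := by
  induction n with
  | zero => simp
  | succ n ih =>
    rw [show 2*(n+1)+1 = (2*n+1)+2 by ring, integral_cos_pow, ih]; simp
lemma I0_eq (t:ℝ) : I0 t = ps cI (t^2/4) := by
  have H : HasSum (fun n:ℕ => ∫ θ in (0:ℝ)..π, (t*cos θ)^n/n.factorial)
      (∫ θ in (0:ℝ)..π, exp (t*cos θ)) := by
    refine intervalIntegral.hasSum_integral_of_dominated_convergence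
      (fun n _ => |t|^n/n.factorial) (fun n => ?_) (fun n => ?_) ?_ ?_ ?_
    · exact (Continuous.aestronglyMeasurable (by fun_prop))
    · refine Eventually.of_forall fun θ _ => ?_
      rw [norm_div, norm_pow, norm_mul, norm_eq_abs, norm_eq_abs, Real.norm_natCast]
      gcongr
      exact mul_le_of_le_one_right (abs_nonneg _) (abs_cos_le_one θ)
    · exact Eventually.of_forall fun θ _ => Real.summable_pow_div_factorial |t|
    · exact intervalIntegrable_const
    · refine Eventually.of_forall fun θ _ => ?_
      rw [Real.exp_eq_exp_ℝ]; exact NormedSpace.expSeries_div_hasSum_exp _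
  have H2 : HasSum (fun n:ℕ => ∫ θ in (0:ℝ)..π, (t*cos θ)^(2*n)/(2*n).factorial)
      (∫ θ in (0:ℝ)..π, exp (t*cos θ)) := by
    have inj : Function.Injective (fun n:ℕ => 2*n) := fun a b h => by simpa using h
    refine (inj.hasSum_iff ?_).2 H
    intro m hm
    obtain ⟨k, rfl | rfl⟩ := Nat.even_or_odd' m
    · exact absurd ⟨k, rfl⟩ hm
    · simp_rw [mul_pow, div_eq_mul_inv]
      rw [intervalIntegral.integral_mul_const, intervalIntegral.integral_const_mul, int_cos_odd]; simp
  rw [I0, ← H2.tsum_eq, ← tsum_mul_left, ps]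
  refine tsum_congr fun n => ?_
  simp_rw [mul_pow, div_eq_mul_inv]
  rw [intervalIntegral.integral_mul_const, intervalIntegral.integral_const_mul, int_cos_even]
  have : (((2*n).factorial:ℕ):ℝ)≠0 := by positivity
  rw [← div_eq_mul_inv (t^2), div_pow]
  field_simp
  rw [pow_mul, mul_comm]
def gI (x:ℝ) : ℝ := ps (fun n => n*cI n) x
lemma gI_cb (R:ℝ) (hR :0 ≤ R) : cb (fun n => n*cI n) R := by
  obtain ⟨C, hC⟩ := cI_cb (2*R) (by positivity)
  refine ⟨C, fun n => le_trans ?_ (hC n)⟩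
  rw [abs_mul, mul_pow, abs_of_nonneg (Nat.cast_nonneg n : (0:ℝ) ≤ n)]
  have : (n:ℝ)≤2^n := by exact_mod_cast Nat.lt_two_pow_self.le
  have h2 :0 ≤ |cI n| * R^n := by positivity
  nlinarith
lemma gI_eq (x:ℝ) : gI x = x*ps (dc cI) x := by
  have hs := (gI_cb (|x|+1) (by positivity)).summable (x := x) (by linarith)
  rw [gI, ps, hs.tsum_eq_zero_add, ps, ← tsum_mul_left]
  simp only [CharP.cast_eq_zero, zero_mul, zero_add]
  refine tsum_congr fun n => ?_
  unfold dc; push_cast; ring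
def Ii (t:ℝ) : ℝ :=2*gI (t^2/4)
lemma I0_deriv {t:ℝ} (ht :0 < t) : HasDerivAt I0 (Ii t/t) t := by
  have h1 := ps_hasDerivAt (cI_cb (|t^2/4|+1) (by positivity)) (x := t^2/4) (by linarith)
  have h2 : HasDerivAt (fun t:ℝ => t^2/4) (t/2) t :=
    ((hasDerivAt_pow 2 t).div_const 4).congr_deriv (by simp; ring)
  have h3 := h1.comp t h2
  have e : I0 = ps cI ∘ fun t => t^2/4 := funext I0_eq
  rw [e]
  refine h3.congr_deriv ?_
  rw [Ii, gI_eq]; field_simp; ring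
lemma Ii_deriv (t:ℝ) : HasDerivAt Ii (t*I0 t) t := by
  have h1 := ps_hasDerivAt (gI_cb (|t^2/4|+1) (by positivity)) (x := t^2/4) (by linarith)
  have h2 : HasDerivAt (fun t:ℝ => t^2/4) (t/2) t :=
    ((hasDerivAt_pow 2 t).div_const 4).congr_deriv (by simp; ring)
  have h3 := (h1.comp t h2).const_mul 2
  refine h3.congr_deriv ?_
  rw [I0_eq, show dc (fun n => n*cI n) = cI from ?_]; · ring
  funext n; unfold dc; rw [← cI_succ n]; push_cast; ring
lemma ps_nonneg {c:ℕ → ℝ} (hc : ∀ n,0 ≤ c n) {x:ℝ} (hx :0 ≤ x) :0 ≤ ps c x :=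
  tsum_nonneg fun n => mul_nonneg (hc n) (pow_nonneg hx n)
lemma I0_ge_one (t:ℝ) :1 ≤ I0 t := by
  rw [I0_eq]
  have hs := (cI_cb (|t^2/4|+1) (by positivity)).summable (x := t^2/4) (by linarith)
  have := hs.le_tsum 0 (fun n _ => mul_nonneg (cI_pos n).le (by positivity))
  simpa [cI, ps] using this
lemma Ii_nonneg (t:ℝ) :0 ≤ Ii t :=
  mul_nonneg (by norm_num) (ps_nonneg (fun n => mul_nonneg (Nat.cast_nonneg n) (cI_pos n).le) (by positivity))
lemma Ii_zero : Ii 0=0 := by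
  simp [Ii, gI_eq]
lemma I0_zero : I0 0=1 := by
  rw [I0_eq]; unfold ps
  rw [tsum_eq_single 0]
  · simp [cI]
  · intro n hn; simp [hn]
lemma I0_cont : Continuous I0 := by
  have e : I0 = ps cI ∘ fun t => t^2/4 := funext I0_eq
  rw [e]
  refine Continuous.comp ?_ (by fun_prop)
  exact continuous_iff_continuousAt.2 fun x =>
    (ps_hasDerivAt (cI_cb (|x|+1) (by positivity)) (x := x) (by linarith)).continuousAt
lemma Ii_cont : Continuous Ii := continuous_iff_continuousAt.2 fun t => (Ii_deriv t).continuousAt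
lemma Ii_le {t:ℝ} (ht :0 ≤ t) : Ii t ≤ t*I0 t := by
  have hm : MonotoneOn (fun t => t^2*I0 t^2-Ii t^2) (Ici 0) := by
    refine monotoneOn_of_deriv_nonneg (convex_Ici 0)
      ((((continuous_pow 2).mul (I0_cont.pow 2)).sub (Ii_cont.pow 2)).continuousOn) ?_ ?_
    all_goals
      rw [interior_Ici]
      intro x hx
      have hx' :0 < x := hx
      have := ((hasDerivAt_pow 2 x).mul ((I0_deriv hx').pow 2)).sub ((Ii_deriv x).pow 2)
    · exact this.differentiableAt.differentiableWithinAt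
    · have e : deriv (fun t => t^2*I0 t^2-Ii t^2) x = _ := this.deriv
      rw [e]
      have :0≤2*x*I0 x^2 := by positivity
      convert this using 1
      simp; field_simp; ring
  have := hm (mem_Ici.2 le_rfl) (mem_Ici.2 ht) ht
  simp [Ii_zero] at this
  have h0 :0 ≤ t*I0 t := mul_nonneg ht (by linarith [I0_ge_one t])
  rw [← mul_pow] at this
  exact abs_le_of_sq_le_sq' this h0 |>.2
def GK (n:ℕ) (t:ℝ) : ℝ := ∫ u in Ioi (0:ℝ), cosh u^n*exp (-(t*cosh u))
lemma GK_bound (n:ℕ) {t:ℝ} (ht :0 < t) {u:ℝ} (hu :0 ≤ u) :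
    ‖cosh u^n*exp (-(t*cosh u))‖ ≤ n.factorial*(2/t)^n*exp (-(t/2)*u) := by
  have hc : u ≤ cosh u := by
    rw [cosh_eq]; have := add_one_le_exp u; have h2 := add_one_le_exp (-u)
    have h3 := Real.quadratic_le_exp_of_nonneg hu
    have := exp_pos (-u); nlinarith [sq_nonneg (u-1)]
  have h0 :0 < cosh u := cosh_pos u
  have h1 := Real.pow_div_factorial_le_exp (t/2*cosh u) (by positivity) n
  have h2 : cosh u^n ≤ n.factorial*(2/t)^n*exp (t/2*cosh u) := by
    rw [mul_pow, div_le_iff₀ (by positivity)] at h1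
    have : cosh u^n = (2/t)^n*((t/2)^n*cosh u^n) := by
      rw [← mul_assoc, ← mul_pow, div_mul_div_cancel₀ ht.ne']; simp
    rw [this]
    calc _ ≤ (2/t)^n*(exp (t/2*cosh u)*n.factorial) := by gcongr
      _ = _ := by ring
  rw [norm_of_nonneg (by positivity)]
  calc _ ≤ n.factorial*(2/t)^n*exp (t/2*cosh u)*exp (-(t*cosh u)) := by gcongr
    _ = n.factorial*(2/t)^n*exp (-(t/2)*cosh u) := by
      rw [mul_assoc, ← exp_add]; ring_nf
    _ ≤ _ := by
      have : -(t/2)*cosh u ≤ -(t/2)*u := by nlinarith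
      gcongr
lemma GK_int (n:ℕ) {t:ℝ} (ht :0 < t) :
    IntegrableOn (fun u => cosh u^n*exp (-(t*cosh u))) (Ioi 0) := by
  refine Integrable.mono' ((exp_neg_integrableOn_Ioi 0 (half_pos ht)).const_mul
    (n.factorial*(2/t)^n)) (Continuous.aestronglyMeasurable (by fun_prop)) ?_
  exact (ae_restrict_iff' measurableSet_Ioi).2 (Eventually.of_forall fun u hu =>
    GK_bound n ht (le_of_lt hu))
lemma GK_deriv (n:ℕ) {t:ℝ} (ht :0 < t) : HasDerivAt (GK n) (-GK (n+1) t) t := by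
  have := (hasDerivAt_integral_of_dominated_loc_of_deriv_le (μ := volume.restrict (Ioi (0:ℝ)))
    (F := fun t u => cosh u^n*exp (-(t*cosh u)))
    (F' := fun t u => -(cosh u^(n+1)*exp (-(t*cosh u)))) (x₀ := t) (s := Ioi (t/2))
    (bound := fun u => cosh u^(n+1)*exp (-(t/2*cosh u)))
    (Ioi_mem_nhds (by linarith)) (Eventually.of_forall fun x =>
      (Continuous.aestronglyMeasurable (by fun_prop))) (GK_int n ht)
      (Continuous.aestronglyMeasurable (by fun_prop)) ?_ (GK_int (n+1) (half_pos ht)) ?_).2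
  · rw [integral_neg] at this; exact this
  · refine Eventually.of_forall fun u x hx => ?_
    have :0 < cosh u := cosh_pos u
    rw [norm_neg, norm_of_nonneg (by positivity)]
    have : x*cosh u ≥ t/2*cosh u := by nlinarith [mem_Ioi.1 hx]
    gcongr
  · refine Eventually.of_forall fun u x hx => ?_
    have h1 : HasDerivAt (fun x:ℝ => -(x*cosh u)) (-(1*cosh u)) x :=
      ((hasDerivAt_id x).mul_const _).neg
    exact (h1.exp.const_mul (cosh u^n)).congr_deriv (by ring)
lemma K0_eq_GK (t:ℝ) : K0 t = GK 0 t := by simp [K0, GK]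
def Kk (t:ℝ) : ℝ := t*GK 1 t
lemma K0_deriv {t:ℝ} (ht :0 < t) : HasDerivAt K0 (-(Kk t/t)) t := by
  have e : K0 = GK 0 := funext K0_eq_GK
  rw [e]
  refine (GK_deriv 0 ht).congr_deriv ?_
  rw [Kk]; field_simp
lemma sinh_lim {t:ℝ} (ht :0 < t) :
    Tendsto (fun u => sinh u*exp (-(t*cosh u))) atTop (𝓝 0) := by
  have h := Real.tendsto_pow_mul_exp_neg_atTop_nhds_zero 1
  have h2 : Tendsto (fun u:ℝ => 1/t*((t*cosh u)^1*exp (-(t*cosh u)))) atTop (𝓝 0) := by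
    have hc : Tendsto (fun u => t*cosh u) atTop atTop := by
      refine Tendsto.const_mul_atTop ht ?_
      have : Tendsto (fun u:ℝ => exp u/2) atTop atTop :=
        tendsto_exp_atTop.atTop_div_const (by norm_num)
      refine tendsto_atTop_mono (fun u => ?_) this
      rw [cosh_eq]; have := exp_pos (-u); linarith
    simpa using (h.comp hc).const_mul (1/t)
  refine squeeze_zero' ?_ ?_ h2
  · filter_upwards [eventually_gt_atTop 0] with u hu
    have := sinh_nonneg_iff.2 hu.le
    positivity
  · refine Eventually.of_forall fun u => ?_
    have : sinh u ≤ cosh u := (sinh_lt_cosh u).le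
    calc _ ≤ cosh u*exp (-(t*cosh u)) := by gcongr
      _ = _ := by field_simp
lemma GK_parts {t:ℝ} (ht :0 < t) : GK 1 t-t*GK 2 t = - (t*K0 t) := by
  have hd : ∀ u ∈ Ici (0:ℝ), HasDerivAt (fun u => sinh u*exp (-(t*cosh u)))
      (cosh u^1*exp (-(t*cosh u))-t*(cosh u^2*exp (-(t*cosh u)))
        + t*(cosh u^0*exp (-(t*cosh u)))) u := by
    intro u _
    have h1 : HasDerivAt (fun u => exp (-(t*cosh u))) _ u :=
      ((hasDerivAt_cosh u).const_mul t).neg.exp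
    refine ((hasDerivAt_sinh u).mul h1).congr_deriv ?_
    have := Real.cosh_sq u
    have e : cosh u^2 = sinh u^2+1 := this
    simp only [Pi.neg_apply]; rw [e]; ring
  have i1 := GK_int 1 ht
  have i2 := (GK_int 2 ht).const_mul t
  have i0 := (GK_int 0 ht).const_mul t
  have := integral_Ioi_of_hasDerivAt_of_tendsto' hd ((i1.sub i2).add i0) (sinh_lim ht)
  have h3 := integral_add (i1.sub i2) i0
  have h4 := integral_sub i1 i2
  simp only [Pi.sub_apply] at h3
  rw [h3, h4, integral_const_mul, integral_const_mul] at this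
  simp only [sinh_zero, zero_mul, sub_zero] at this
  rw [K0_eq_GK]
  change GK 1 t-t*GK 2 t+t*GK 0 t=0 at this
  linarith
lemma Kk_deriv {t:ℝ} (ht :0 < t) : HasDerivAt Kk (-(t*K0 t)) t := by
  refine ((hasDerivAt_id t).mul (GK_deriv 1 ht)).congr_deriv ?_
  rw [← GK_parts ht]; simp; ring
lemma K0_pos {t:ℝ} (ht :0 < t) :0 < K0 t := by
  rw [K0]
  refine (integral_pos_iff_support_of_nonneg (fun u => (exp_pos _).le) ?_).2 ?_
  · have := GK_int 0 ht
    simp only [pow_zero, one_mul] at this; exact this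
  · have : Function.support (fun u => exp (-(t*cosh u))) = univ := by
      ext u; simp [(exp_pos _).ne']
    rw [this]; simp
lemma Kk_nonneg {t:ℝ} (ht :0 < t) :0 ≤ Kk t :=
  mul_nonneg ht.le (integral_nonneg fun u => by have := cosh_pos u; positivity)
lemma cosh_subst {t:ℝ} (ht :0 < t) (φ:ℝ → ℝ) :
    ∫ u in Ioi (0:ℝ), φ (t*cosh u-t) =
      ∫ r in Ioi (0:ℝ), φ r*(r^(-(1/2):ℝ)*(r+2*t)^(-(1/2):ℝ)) := by
  have himg : (fun u => t*cosh u-t) '' Ioi 0 = Ioi 0 := by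
    ext r; constructor
    · rintro ⟨u, hu, rfl⟩
      have := Real.one_lt_cosh.2 (ne_of_gt hu)
      simp only [mem_Ioi]; nlinarith
    · intro hr
      have hr' :0 < r := hr
      refine ⟨arcosh (1+r/t), ?_, ?_⟩
      · exact arcosh_pos (by have :0 < r/t := by positivity
                             linarith)
      · simp only; rw [cosh_arcosh (by have :0 < r/t := by positivity
                                       linarith)]; field_simp; ring
  have hinj : InjOn (fun u => t*cosh u-t) (Ioi 0) := by
    intro a ha b hb hab
    have h1 : cosh a = cosh b := by
      have : t*cosh a = t*cosh b := by simpa using hab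
      exact mul_left_cancel₀ ht.ne' this
    rw [← arcosh_cosh (le_of_lt ha), ← arcosh_cosh (le_of_lt hb), h1]
  have := integral_image_eq_integral_abs_deriv_smul (s := Ioi (0:ℝ))
    (f := fun u => t*cosh u-t) (f' := fun u => t*sinh u) measurableSet_Ioi
    (fun u _ => (((hasDerivAt_cosh u).const_mul t).sub_const t).hasDerivWithinAt) hinj
    (fun r => φ r*(r^(-(1/2):ℝ)*(r+2*t)^(-(1/2):ℝ)))
  rw [himg] at this
  rw [this]
  refine setIntegral_congr_fun measurableSet_Ioi fun u hu => ?_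
  have hs :0 < sinh u := sinh_pos_iff.2 hu
  have hc := Real.one_lt_cosh.2 (ne_of_gt hu)
  have h1 :0 < t*cosh u-t := by nlinarith
  simp only [smul_eq_mul]
  rw [abs_of_pos (by positivity), ← mul_rpow h1.le (by positivity),
    show (t*cosh u-t)*(t*cosh u-t+2*t) = (t*sinh u)^2 by
      have : cosh u^2 = sinh u^2+1 := Real.cosh_sq u
      linear_combination t^2*this, ← rpow_natCast (t*sinh u), ← rpow_mul (by positivity)]
  norm_num
  rw [rpow_neg_one]; field_simp
def kR (s t:ℝ) : ℝ := ∫ r in Ioi (0:ℝ), exp (-r)*r^s*(r+2*t)^(-(1/2):ℝ)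
lemma gam_int {s:ℝ} (hs : -1 < s) : IntegrableOn (fun r => exp (-r)*r^s) (Ioi 0) := by
  simpa using Real.GammaIntegral_convergent (s := s+1) (by linarith)
lemma gam_eq {s:ℝ} (hs : -1 < s) : ∫ r in Ioi (0:ℝ), exp (-r)*r^s = Gamma (s+1) := by
  rw [Real.Gamma_eq_integral (by linarith)]; simp
lemma kR_int {s t:ℝ} (hs : -1 < s) (ht :0 < t) :
    IntegrableOn (fun r => exp (-r)*r^s*(r+2*t)^(-(1/2):ℝ)) (Ioi 0) := by
  refine Integrable.mono' ((gam_int hs).mul_const ((2*t)^(-(1/2):ℝ))) ?_ ?_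
  · refine ContinuousOn.aestronglyMeasurable ?_ measurableSet_Ioi
    intro r hr
    have hr' :0 < r := hr
    refine ContinuousAt.continuousWithinAt ?_
    refine ((by fun_prop : ContinuousAt (fun r:ℝ => exp (-r)) r).mul
      (continuousAt_rpow_const _ _ (Or.inl hr'.ne'))).mul ?_
    exact ContinuousAt.rpow_const (by fun_prop) (Or.inl (by positivity))
  · refine (ae_restrict_iff' measurableSet_Ioi).2 (Eventually.of_forall fun r hr => ?_)
    have hr' :0 < r := hr
    rw [norm_of_nonneg (by positivity)]
    have : (r+2*t)^(-(1/2):ℝ) ≤ (2*t)^(-(1/2):ℝ) :=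
      rpow_le_rpow_of_nonpos (by positivity) (by linarith) (by norm_num)
    gcongr
lemma K0_eq_kR {t:ℝ} (ht :0 < t) : K0 t = exp (-t)*kR (-(1/2)) t := by
  have := cosh_subst ht (fun r => exp (-r)*exp (-t))
  rw [K0, kR, ← integral_const_mul]
  rw [show (fun u => exp (-(t*cosh u))) = fun u => exp (-(t*cosh u-t))*exp (-t) by
    funext u; rw [← exp_add]; ring_nf, this]
  refine setIntegral_congr_fun measurableSet_Ioi fun r hr => ?_
  ring
lemma Kk_eq_kR {t:ℝ} (ht :0 < t) :
    Kk t = exp (-t)*(t*kR (-(1/2)) t+kR (1/2) t) := by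
  have := cosh_subst ht (fun r => (r+t)*(exp (-r)*exp (-t)))
  rw [Kk, GK, ← integral_const_mul]
  rw [show (fun u => t*(cosh u^1*exp (-(t*cosh u))))
      = fun u => (t*cosh u-t+t)*(exp (-(t*cosh u-t))*exp (-t)) by
    funext u; rw [← exp_add]; ring_nf, this, kR, kR, ← integral_const_mul,
    ← integral_add ((kR_int (by norm_num) ht).const_mul t) (kR_int (by norm_num) ht),
    ← integral_const_mul]
  refine setIntegral_congr_fun measurableSet_Ioi fun r hr => ?_
  have hr' :0 < r := hr
  have e : r^((1/2):ℝ) = r*r^(-(1/2):ℝ) := by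
    nth_rewrite 2 [← rpow_one r]; rw [← rpow_add hr']; norm_num
  rw [e]; ring
lemma kR_le {t δ:ℝ} (ht :0 < t) (h0 :0 < δ) (h1 : δ≤1/2) :
    kR (-(1/2)) t ≤ (2*t)^(-δ)*Gamma δ := by
  have := gam_eq (s := δ-1) (by linarith)
  rw [sub_add_cancel] at this
  rw [← this, ← integral_const_mul, kR]
  refine setIntegral_mono_on (kR_int (by norm_num) ht) ((gam_int (by linarith)).const_mul _)
    measurableSet_Ioi fun r hr => ?_
  have hr' :0 < r := hr
  have e1 : (r+2*t)^(-(1/2):ℝ) = (r+2*t)^(-δ)*(r+2*t)^(δ-1/2) := by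
    rw [← rpow_add (by positivity)]; ring_nf
  have e2 : (r+2*t)^(-δ) ≤ (2*t)^(-δ) :=
      rpow_le_rpow_of_nonpos (by positivity) (by linarith) (by linarith)
  have e3 : (r+2*t)^(δ-1/2) ≤ r^(δ-1/2) :=
      rpow_le_rpow_of_nonpos (by positivity) (by linarith) (by linarith)
  have e4 : r^(δ-1) = r^(-(1/2):ℝ)*r^(δ-1/2) := by
    rw [← rpow_add hr']; ring_nf
  rw [e1, e4]
  calc _ ≤ exp (-r)*r^(-(1/2):ℝ)*((2*t)^(-δ)*r^(δ-1/2)) := by gcongr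
    _ = _ := by ring
lemma kR_ge {t:ℝ} (ht :0 < t) :
    (2*t)^(-(1/2):ℝ)*√π*(1-1/(8*t)) ≤ kR (-(1/2)) t := by
  have i1 := gam_int (s := -(1/2)) (by norm_num)
  have i2 := gam_int (s :=1/2) (by norm_num)
  have g1 := gam_eq (s := -(1/2)) (by norm_num)
  have g2 := gam_eq (s :=1/2) (by norm_num)
  have G : Gamma (1/2+1)=1/2*√π := by
    rw [Real.Gamma_add_one (by norm_num), Real.Gamma_one_half_eq]
  rw [show -(1/2:ℝ)+1=1/2 by norm_num, Real.Gamma_one_half_eq] at g1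
  rw [G] at g2
  have : (2*t)^(-(1/2):ℝ)*√π*(1-1/(8*t)) = ∫ r in Ioi (0:ℝ),
      ((2*t)^(-(1/2):ℝ)*(exp (-r)*r^(-(1/2):ℝ)) -
        (2*t)^(-(1/2):ℝ)*(1/(4*t))*(exp (-r)*r^((1/2):ℝ))) := by
    rw [integral_sub (i1.const_mul _) (i2.const_mul _), integral_const_mul, integral_const_mul,
      g1, g2]
    field_simp; ring
  rw [this, kR]
  refine setIntegral_mono_on ((i1.const_mul _).sub (i2.const_mul _)) (kR_int (by norm_num) ht)
    measurableSet_Ioi fun r hr => ?_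
  have hr' :0 < r := hr
  have e : r^((1/2):ℝ) = r*r^(-(1/2):ℝ) := by
    nth_rewrite 2 [← rpow_one r]; rw [← rpow_add hr']; norm_num
  have e1 : (r+2*t)^(-(1/2):ℝ) = (2*t)^(-(1/2):ℝ)*(1+r/(2*t))^(-(1/2):ℝ) := by
    rw [← mul_rpow (by positivity) (by positivity)]; congr 1; field_simp; ring
  have hx :0 < r/(2*t) := by positivity
  have e2 :1+(-(1/2))*(r/(2*t)) ≤ (1+r/(2*t))^(-(1/2):ℝ) :=
    by
    rw [rpow_neg (by positivity)]
    have h1 := rpow_one_add_le_one_add_mul_self (s := r/(2*t)) (by linarith) (p :=1/2)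
      (by norm_num) (by norm_num)
    have h2 : (1+1/2*(r/(2*t)))⁻¹ ≤ ((1+r/(2*t))^((1/2):ℝ))⁻¹ :=
      inv_anti₀ (by positivity) h1
    refine le_trans ?_ h2
    rw [← one_div, le_div_iff₀ (by positivity)]; nlinarith
  rw [e, e1]
  calc _ = exp (-r)*r^(-(1/2):ℝ)*((2*t)^(-(1/2):ℝ)*(1+(-(1/2))*(r/(2*t)))) := by
        field_simp; ring
    _ ≤ _ := by gcongr
lemma kR_half_lim : Tendsto (kR (1/2)) (𝓝[>] 0) (𝓝 1) := by
  have h1 : ∫ r in Ioi (0:ℝ), exp (-r)=1 := by simpa using integral_exp_neg_Ioi 0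
  suffices key : Tendsto (kR (1/2)) (𝓝[>] 0) (𝓝 (∫ r in Ioi (0:ℝ), exp (-r))) by rwa [h1] at key
  refine tendsto_integral_filter_of_dominated_convergence (fun r => exp (-r)) ?_ ?_ ?_ ?_
  · filter_upwards [self_mem_nhdsWithin] with t ht
    exact (kR_int (by norm_num) ht).aestronglyMeasurable
  · filter_upwards [self_mem_nhdsWithin] with t ht
    refine (ae_restrict_iff' measurableSet_Ioi).2 (Eventually.of_forall fun r hr => ?_)
    have hr' :0 < r := hr
    have ht' :0 < t := ht
    rw [norm_of_nonneg (by positivity), mul_assoc]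
    refine mul_le_of_le_one_right (exp_pos _).le ?_
    rw [rpow_neg (by positivity), ← div_eq_mul_inv, div_le_one (by positivity)]
    exact rpow_le_rpow hr'.le (by linarith) (by norm_num)
  · have := integrableOn_exp_neg_Ioi 0
    exact this
  · refine (ae_restrict_iff' measurableSet_Ioi).2 (Eventually.of_forall fun r hr => ?_)
    have hr' :0 < r := hr
    have hc : ContinuousAt (fun t:ℝ => exp (-r)*r^((1/2):ℝ)*(r+2*t)^(-(1/2):ℝ)) 0 := by
      refine continuousAt_const.mul (ContinuousAt.rpow_const (by fun_prop) (Or.inl ?_))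
      simpa using hr'.ne'
    have := hc.tendsto.mono_left (nhdsWithin_le_nhds (s := Ioi (0:ℝ)))
    convert this using 2
    rw [mul_zero, add_zero, mul_assoc, ← rpow_add hr']; norm_num
lemma kR_nonneg (s:ℝ) {t:ℝ} (ht :0 < t) :0 ≤ kR s t :=
  setIntegral_nonneg measurableSet_Ioi fun r hr => by
    have hr' :0 < r := hr
    positivity
lemma K0_le {t δ:ℝ} (ht :0 < t) (h0 :0 < δ) (h1 : δ≤1/2) :
    K0 t ≤ Gamma δ*t^(-δ)*exp (-t) := by
  rw [K0_eq_kR ht]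
  have := kR_le ht h0 h1
  have e : (2*t)^(-δ) ≤ t^(-δ) := rpow_le_rpow_of_nonpos ht (by linarith) (by linarith)
  have hG :0 < Gamma δ := Gamma_pos_of_pos h0
  calc _ ≤ exp (-t)*((2*t)^(-δ)*Gamma δ) := by gcongr
    _ ≤ exp (-t)*(t^(-δ)*Gamma δ) := by gcongr
    _ = _ := by ring
lemma id_lim0 : Tendsto (fun t:ℝ => t) (𝓝[>] 0) (𝓝 0) := nhdsWithin_le_nhds
lemma pow_lim0 {a:ℝ} (ha :0 < a) : Tendsto (fun t:ℝ => t^a) (𝓝[>] 0) (𝓝 0) := by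
  have := (continuousAt_rpow_const 0 a (Or.inr ha.le)).tendsto.mono_left
    (nhdsWithin_le_nhds (s := Ioi (0:ℝ)))
  rwa [zero_rpow ha.ne'] at this
lemma tK_lim : Tendsto (fun t => t*K0 t^6) (𝓝[>] 0) (𝓝 0) := by
  have := (pow_lim0 (a :=1/4) (by norm_num)).const_mul (Gamma (1/8)^6)
  rw [mul_zero] at this
  refine squeeze_zero' ?_ ?_ this
  · filter_upwards [self_mem_nhdsWithin] with t ht
    have ht' :0 < t := ht
    have := K0_pos ht'
    positivity
  · filter_upwards [self_mem_nhdsWithin] with t ht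
    have ht' :0 < t := ht
    have h1 := K0_le ht' (δ :=1/8) (by norm_num) (by norm_num)
    have hp := K0_pos ht'
    have hG :0 < Gamma (1/8) := Gamma_pos_of_pos (by norm_num)
    have h2 : K0 t ≤ Gamma (1/8)*t^(-(1/8):ℝ) := by
      refine h1.trans (mul_le_of_le_one_right (by positivity) ?_)
      exact exp_le_one_iff.2 (by linarith)
    calc t*K0 t^6 ≤ t*(Gamma (1/8)*t^(-(1/8):ℝ))^6 := by gcongr
      _ = Gamma (1/8)^6*t^((1/4):ℝ) := by
        rw [mul_pow, ← rpow_natCast (t^(-(1/8):ℝ)) 6, ← rpow_mul ht'.le]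
        nth_rewrite 1 [← rpow_one t]
        rw [mul_left_comm, ← rpow_add ht']; norm_num
lemma tK_lim' (j:ℕ) (hj : j≤6) : Tendsto (fun t => t*K0 t^j) (𝓝[>] 0) (𝓝 0) := by
  have h := id_lim0.add tK_lim
  rw [add_zero] at h
  refine squeeze_zero' ?_ ?_ h
  · filter_upwards [self_mem_nhdsWithin] with t ht
    have ht' :0 < t := ht
    have := K0_pos ht'
    positivity
  · filter_upwards [self_mem_nhdsWithin] with t ht
    have ht' :0 < t := ht
    have hp := K0_pos ht'
    have : K0 t^j≤1+K0 t^6 := by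
      rcases le_total (K0 t) 1 with h | h
      · have := pow_le_one₀ hp.le h (n := j); have :0 < K0 t^6 := by positivity
        linarith
      · have := pow_le_pow_right₀ h hj; linarith
    nlinarith
lemma Kk_lim : Tendsto Kk (𝓝[>] 0) (𝓝 1) := by
  have h1 : Tendsto (fun t => t*K0 t+exp (-t)*kR (1/2) t) (𝓝[>] 0) (𝓝 (0+1*1)) := by
    refine Tendsto.add (by simpa using tK_lim' 1 (by norm_num)) (Tendsto.mul ?_ kR_half_lim)
    have : ContinuousAt (fun t:ℝ => exp (-t)) 0 := by fun_prop
    simpa using this.tendsto.mono_left (nhdsWithin_le_nhds (s := Ioi (0:ℝ)))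
  rw [zero_add, one_mul] at h1
  refine h1.congr' ?_
  filter_upwards [self_mem_nhdsWithin] with t ht
  rw [Kk_eq_kR ht, K0_eq_kR ht]; ring
lemma I0_lim : Tendsto I0 (𝓝[>] 0) (𝓝 1) := by
  have := I0_cont.continuousAt.tendsto (x :=0) |>.mono_left (nhdsWithin_le_nhds (s := Ioi (0:ℝ)))
  rwa [I0_zero] at this
lemma IiK_lim : Tendsto (fun t => Ii t*K0 t) (𝓝[>] 0) (𝓝 0) := by
  have h := I0_lim.mul (tK_lim' 1 (by norm_num))
  rw [mul_zero] at h
  refine squeeze_zero' ?_ ?_ h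
  · filter_upwards [self_mem_nhdsWithin] with t ht
    exact mul_nonneg (Ii_nonneg t) (K0_pos ht).le
  · filter_upwards [self_mem_nhdsWithin] with t ht
    have := Ii_le (le_of_lt (mem_Ioi.1 ht))
    have hp := K0_pos ht
    rw [pow_one]; nlinarith
lemma wron {t:ℝ} (ht :0 < t) : Ii t*K0 t+I0 t*Kk t=1 := by
  have hd : ∀ x,0 < x → HasDerivAt (fun t => Ii t*K0 t+I0 t*Kk t) 0 x := by
    intro x hx
    refine (((Ii_deriv x).mul (K0_deriv hx)).add ((I0_deriv hx).mul (Kk_deriv hx))).congr_deriv ?_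
    field_simp; ring
  have hconst : ∀ x ∈ Ioi (0:ℝ), (fun t => Ii t*K0 t+I0 t*Kk t) x
      = (fun t => Ii t*K0 t+I0 t*Kk t) t := by
    intro x hx
    exact isOpen_Ioi.is_const_of_deriv_eq_zero isPreconnected_Ioi
      (fun y hy => (hd y hy).differentiableAt.differentiableWithinAt)
      (fun y hy => (hd y hy).deriv) hx ht
  have hl : Tendsto (fun t => Ii t*K0 t+I0 t*Kk t) (𝓝[>] 0) (𝓝 (0+1*1)) :=
    IiK_lim.add (I0_lim.mul Kk_lim)
  have hl2 : Tendsto (fun t => Ii t*K0 t+I0 t*Kk t) (𝓝[>] 0)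
      (𝓝 (Ii t*K0 t+I0 t*Kk t)) := by
    refine tendsto_const_nhds.congr' ?_
    filter_upwards [self_mem_nhdsWithin] with x hx
    exact (hconst x hx).symm
  have := tendsto_nhds_unique hl2 hl
  linarith
lemma Kk_le_one {t:ℝ} (ht :0 < t) : Kk t≤1 := by
  have h := wron ht
  have := I0_ge_one t
  have h2 := mul_nonneg (Ii_nonneg t) (K0_pos ht).le
  nlinarith [Kk_nonneg ht]
lemma kR_half_le {t:ℝ} (ht :0 < t) : kR (1/2) t≤1 := by
  have h1 : ∫ r in Ioi (0:ℝ), exp (-r)=1 := by simpa using integral_exp_neg_Ioi 0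
  refine le_trans ?_ h1.le
  refine setIntegral_mono_on (kR_int (by norm_num) ht) (integrableOn_exp_neg_Ioi 0)
    measurableSet_Ioi fun r hr => ?_
  have hr' :0 < r := hr
  rw [mul_assoc]
  refine mul_le_of_le_one_right (exp_pos _).le ?_
  rw [rpow_neg (by positivity), ← div_eq_mul_inv, div_le_one (by positivity)]
  exact rpow_le_rpow hr'.le (by linarith) (by norm_num)
lemma K0_le_exp {t:ℝ} (ht :1 ≤ t) : K0 t≤2*exp (-t) := by
  have ht' :0 < t := by linarith
  refine (K0_le ht' (δ :=1/2) (by norm_num) le_rfl).trans ?_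
  rw [Real.Gamma_one_half_eq]
  have h1 : t^(-(1/2):ℝ)≤1 := rpow_le_one_of_one_le_of_nonpos ht (by norm_num)
  have h2 : √π≤2 := by rw [sqrt_le_left (by norm_num)]; linarith [pi_lt_four]
  have := exp_pos (-t)
  calc _≤2*1*exp (-t) := by gcongr
    _ = _ := by ring
lemma Kk_le_exp {t:ℝ} (ht :1 ≤ t) : Kk t≤3*t*exp (-t) := by
  have ht' :0 < t := by linarith
  have h1 : Kk t = t*K0 t+exp (-t)*kR (1/2) t := by rw [Kk_eq_kR ht', K0_eq_kR ht']; ring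
  have h2 := K0_le_exp ht
  have h3 := kR_half_le ht'
  rw [h1]
  have := exp_pos (-t)
  nlinarith [mul_nonneg (sub_nonneg.2 ht) this.le, mul_nonneg (sub_nonneg.2 h3) this.le,
    mul_nonneg ht'.le (sub_nonneg.2 h2)]
lemma K0_contOn : ContinuousOn K0 (Ioi 0) := fun _ hx => (K0_deriv hx).continuousAt.continuousWithinAt
lemma Kk_contOn : ContinuousOn Kk (Ioi 0) := fun _ hx => (Kk_deriv hx).continuousAt.continuousWithinAt
lemma int_of_bounds {f:ℝ → ℝ} {C:ℝ} (hc : ContinuousOn f (Ioi 0))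
    (h0 : ∀ t,0 < t → t≤1 → |f t| ≤ C*t^(-(3/4):ℝ)) (h1 : ∀ t,1 < t → |f t| ≤ C*t^(-2:ℝ)) :
    IntegrableOn f (Ioi 0) := by
  rw [← Ioc_union_Ioi_eq_Ioi (zero_le_one' ℝ)]
  refine IntegrableOn.union ?_ ?_
  · have hi : IntegrableOn (fun t:ℝ => C*t^(-(3/4):ℝ)) (Ioc 0 1) := by
      have := intervalIntegral.intervalIntegrable_rpow' (a :=0) (b :=1) (r := -(3/4)) (by norm_num)
      rw [intervalIntegrable_iff_integrableOn_Ioc_of_le zero_le_one] at this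
      exact this.const_mul C
    refine Integrable.mono' hi ((hc.mono fun x hx => hx.1).aestronglyMeasurable measurableSet_Ioc) ?_
    exact (ae_restrict_iff' measurableSet_Ioc).2 (Eventually.of_forall fun t ht => h0 t ht.1 ht.2)
  · have hi := (integrableOn_Ioi_rpow_of_lt (a := -2) (by norm_num) one_pos).const_mul C
    refine Integrable.mono' hi ((hc.mono fun x hx => ?_).aestronglyMeasurable measurableSet_Ioi) ?_
    · exact zero_lt_one.trans (mem_Ioi.1 hx)
    exact (ae_restrict_iff' measurableSet_Ioi).2 (Eventually.of_forall fun t ht => h1 t ht)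
lemma cos_subst {t:ℝ} (ht :0 < t) (φ:ℝ → ℝ) :
    ∫ u in Ioo (0:ℝ) π, φ (t-t*cos u) =
      ∫ r in Ioo (0:ℝ) (2*t), φ r*(r^(-(1/2):ℝ)*(2*t-r)^(-(1/2):ℝ)) := by
  have himg : (fun u => t-t*cos u) '' Ioo 0 π = Ioo 0 (2*t) := by
    ext r; constructor
    · rintro ⟨u, hu, rfl⟩
      have h1 : cos u<1 := by
        have := strictAntiOn_cos ⟨le_rfl, pi_pos.le⟩ ⟨hu.1.le, hu.2.le⟩ hu.1
        simpa using this
      have h2 : -1 < cos u := by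
        have := strictAntiOn_cos ⟨hu.1.le, hu.2.le⟩ ⟨pi_pos.le, le_rfl⟩ hu.2
        simpa using this
      constructor <;> nlinarith
    · rintro ⟨hr0, hr1⟩
      have a1 : -1<1-r/t := by
        have : r/t<2 := by rw [div_lt_iff₀ ht]; linarith
        linarith
      have a2 :1-r/t<1 := by
        have :0 < r/t := by positivity
        linarith
      refine ⟨arccos (1-r/t), ⟨?_, ?_⟩, ?_⟩
      · exact arccos_pos.2 a2
      · exact lt_of_le_of_ne (arccos_le_pi _) (fun h => by
          have := arccos_eq_pi.1 h; linarith)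
      · simp only; rw [cos_arccos a1.le a2.le]; field_simp; ring
  have hinj : InjOn (fun u => t-t*cos u) (Ioo 0 π) := by
    intro a ha b hb hab
    have h1 : cos a = cos b := by
      have : t*cos a = t*cos b := by simpa using hab
      exact mul_left_cancel₀ ht.ne' this
    exact injOn_cos ⟨ha.1.le, ha.2.le⟩ ⟨hb.1.le, hb.2.le⟩ h1
  have := integral_image_eq_integral_abs_deriv_smul (s := Ioo (0:ℝ) π)
    (f := fun u => t-t*cos u) (f' := fun u => t*sin u) measurableSet_Ioo
    (fun u _ => ((((hasDerivAt_cos u).const_mul t).const_sub t).congr_deriv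
      (by ring)).hasDerivWithinAt) hinj
    (fun r => φ r*(r^(-(1/2):ℝ)*(2*t-r)^(-(1/2):ℝ)))
  rw [himg] at this
  rw [this]
  refine setIntegral_congr_fun measurableSet_Ioo fun u hu => ?_
  have hs :0 < sin u := sin_pos_of_mem_Ioo hu
  have hmem : t-t*cos u ∈ Ioo 0 (2*t) := himg ▸ mem_image_of_mem _ hu
  simp only [smul_eq_mul]
  rw [abs_of_pos (by positivity), ← mul_rpow hmem.1.le (by linarith [hmem.2]),
    show (t-t*cos u)*(2*t-(t-t*cos u)) = (t*sin u)^2 by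
      have := Real.sin_sq_add_cos_sq u
      linear_combination (-t^2)*this, ← rpow_natCast (t*sin u), ← rpow_mul (by positivity)]
  norm_num
  rw [rpow_neg_one]; field_simp
lemma Ii_eq_int {t:ℝ} (ht :0 < t) :
    Ii t = t*((1/π) * ∫ θ in (0:ℝ)..π, cos θ*exp (t*cos θ)) := by
  have h := (intervalIntegral.hasDerivAt_integral_of_dominated_loc_of_deriv_le
    (μ := volume) (a :=0) (b := π) (F := fun t θ => exp (t*cos θ))
    (F' := fun t θ => cos θ*exp (t*cos θ)) (x₀ := t) (s := Ioo 0 (2*t))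
    (bound := fun _ => exp (2*t))
    (Ioo_mem_nhds ht (by linarith)) (Eventually.of_forall fun x =>
      (Continuous.aestronglyMeasurable (by fun_prop))) (Continuous.intervalIntegrable (by fun_prop) _ _)
      (Continuous.aestronglyMeasurable (by fun_prop)) ?_ intervalIntegrable_const ?_).2
  · have h2 := (h.const_mul (1/π)).unique (I0_deriv ht)
    rw [h2]; field_simp
  · refine Eventually.of_forall fun θ _ x hx => ?_
    rw [norm_mul, norm_eq_abs, norm_of_nonneg (exp_pos _).le]
    have h1 := abs_cos_le_one θ
    have h2 : x*cos θ≤2*t := by nlinarith [cos_le_one θ, hx.1, hx.2]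
    calc _≤1*exp (2*t) := by gcongr
      _ = _ := one_mul _
  · refine Eventually.of_forall fun θ _ x hx => ?_
    exact (((hasDerivAt_id x).mul_const (cos θ)).exp).congr_deriv (by simp; ring)
def cR (s t:ℝ) : ℝ := ∫ r in Ioo (0:ℝ) (2*t), exp (-r)*r^s*(2*t-r)^(-(1/2):ℝ)
def bR (s t:ℝ) : ℝ := ∫ r in Ioi (2*t), exp (-r)*r^s*(r-2*t)^(-(1/2):ℝ)
lemma cR_zero {t:ℝ} (ht :0 < t) : cR (-(1/2)) t = π*exp (-t)*I0 t := by
  have := cos_subst ht (fun r => exp (-r))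
  rw [cR, I0, intervalIntegral.integral_of_le pi_pos.le, integral_Ioc_eq_integral_Ioo]
  have e : π*exp (-t)*((1/π) * ∫ θ in Ioo 0 π, exp (t*cos θ))
    = exp (-t) * ∫ θ in Ioo 0 π, exp (t*cos θ) := by field_simp
  rw [e, ← integral_const_mul]
  simp_rw [← exp_add]
  simp_rw [show ∀ u, -(t-t*cos u) = -t+t*cos u from fun u => by ring] at this
  rw [this]
  simp_rw [mul_assoc]
lemma cR_one {t:ℝ} (ht :0 < t) : cR (1/2) t = π*exp (-t)*(t*I0 t-Ii t) := by
  have := cos_subst ht (fun r => r*exp (-r))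
  rw [cR, Ii_eq_int ht, I0]
  rw [show π*exp (-t)*(t*((1/π) * ∫ θ in (0:ℝ)..π, exp (t*cos θ))
      - t*((1/π) * ∫ θ in (0:ℝ)..π, cos θ*exp (t*cos θ)))
      = t*exp (-t)*((∫ θ in (0:ℝ)..π, exp (t*cos θ))
      - ∫ θ in (0:ℝ)..π, cos θ*exp (t*cos θ)) by field_simp]
  rw [← intervalIntegral.integral_sub (Continuous.intervalIntegrable (by fun_prop) _ _)
    (Continuous.intervalIntegrable (by fun_prop) _ _),
    intervalIntegral.integral_of_le pi_pos.le, integral_Ioc_eq_integral_Ioo, ← integral_const_mul]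
  rw [show (fun u => t*exp (-t)*(exp (t*cos u)-cos u*exp (t*cos u)))
    = fun u => (t-t*cos u)*exp (-(t-t*cos u)) by
      funext u; rw [show -(t-t*cos u) = -t+t*cos u by ring, exp_add]; ring, this]
  refine setIntegral_congr_fun measurableSet_Ioo fun r hr => ?_
  have e : r^((1/2):ℝ) = r*r^(-(1/2):ℝ) := by
    nth_rewrite 2 [← rpow_one r]; rw [← rpow_add hr.1]; norm_num
  rw [e]; ring
lemma bR_aux (s t:ℝ) : bR s t =
    ∫ x in Ioi (0:ℝ), exp (-(x+2*t))*(x+2*t)^s*x^(-(1/2):ℝ) := by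
  have := (measurePreserving_add_right volume (2*t)).setIntegral_preimage_emb
    (measurableEmbedding_addRight (2*t))
    (fun r => exp (-r)*r^s*(r-2*t)^(-(1/2):ℝ)) (Ioi (2*t))
  rw [bR, ← this]; simp
lemma bR_zero {t:ℝ} (ht :0 < t) : bR (-(1/2)) t = exp (-(2*t))*kR (-(1/2)) t := by
  rw [bR_aux, kR, ← integral_const_mul]
  refine integral_congr_ae (Eventually.of_forall fun x => ?_)
  simp only; rw [neg_add, exp_add]; ring
lemma bR_one {t:ℝ} (ht :0 < t) :
    bR (1/2) t = exp (-(2*t))*(kR (1/2) t+2*t*kR (-(1/2)) t) := by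
  rw [bR_aux, kR, kR, ← integral_const_mul (2*t),
    ← integral_add (kR_int (by norm_num) ht) ((kR_int (by norm_num) ht).const_mul _),
    ← integral_const_mul]
  refine setIntegral_congr_fun measurableSet_Ioi fun r hr => ?_
  have hr' :0 < r := hr
  have e : ∀ x:ℝ,0 < x → x^((1/2):ℝ) = x*x^(-(1/2):ℝ) := fun x hx => by
    nth_rewrite 2 [← rpow_one x]; rw [← rpow_add hx]; norm_num
  rw [e r hr', e (r+2*t) (by positivity), neg_add, exp_add]; ring
def kC (s:ℝ) (z:ℂ) : ℂ :=
  ∫ r in Ioi (0:ℝ), ((exp (-r)*r^s:ℝ) : ℂ)*((r:ℂ)+2*z)^((-(1/2) : ℝ) : ℂ)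
lemma wS_cont (s:ℝ) : ContinuousOn (fun r:ℝ => exp (-r)*r^s) (Ioi 0) := by
  intro r hr
  have hr' :0 < r := hr
  exact ((by fun_prop : ContinuousAt (fun r:ℝ => exp (-r)) r).mul
    (continuousAt_rpow_const r s (Or.inl hr'.ne'))).continuousWithinAt
lemma slit_im {z:ℂ} (hz : z.im≠0) (r:ℝ) : (r:ℂ)+2*z ∈ Complex.slitPlane := by
  right; simpa using hz
lemma kC_meas (s a:ℝ) {z:ℂ} (hz : z.im≠0) : AEStronglyMeasurable
    (fun r:ℝ => ((exp (-r)*r^s:ℝ) : ℂ)*((r:ℂ)+2*z)^((a:ℝ) : ℂ))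
    (volume.restrict (Ioi 0)) := by
  refine ContinuousOn.aestronglyMeasurable ?_ measurableSet_Ioi
  refine (Complex.continuous_ofReal.comp_continuousOn (wS_cont s)).mul ?_
  refine ContinuousOn.cpow_const (by fun_prop) fun r _ => slit_im hz r
lemma kC_norm (s a:ℝ) (z:ℂ) {r:ℝ} (hr :0 < r) :
    ‖((exp (-r)*r^s:ℝ) : ℂ)*((r:ℂ)+2*z)^((a:ℝ) : ℂ)‖
      = exp (-r)*r^s * ‖(r:ℂ)+2*z‖ ^ a := by
  rw [norm_mul, Complex.norm_real, Complex.norm_cpow_real, norm_of_nonneg (by positivity)]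
lemma im_le_norm (r:ℝ) (z:ℂ) :2 * |z.im| ≤ ‖(r:ℂ)+2*z‖ := by
  have := Complex.abs_im_le_norm ((r:ℂ)+2*z)
  simpa [abs_mul] using this
lemma kC_le_im {s:ℝ} (hs : -1 < s) {z:ℂ} (hz : z.im≠0) :
    ‖kC s z‖ ≤ Gamma (s+1)*(2 * |z.im|)^(-(1/2):ℝ) := by
  have hp :0 < |z.im| := abs_pos.2 hz
  rw [kC, ← gam_eq hs, ← integral_mul_const]
  refine norm_integral_le_of_norm_le ((gam_int hs).mul_const _) ?_
  refine (ae_restrict_iff' measurableSet_Ioi).2 (Eventually.of_forall fun r hr => ?_)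
  have hr' :0 < r := hr
  rw [kC_norm s _ z hr]
  gcongr ?_ * ?_
  exact rpow_le_rpow_of_nonpos (by positivity) (im_le_norm r z) (by norm_num)
lemma kC_diff {s:ℝ} (hs : -1 < s) {z:ℂ} (hz : z.im≠0) : DifferentiableAt ℂ (kC s) z := by
  have hp :0 < |z.im| := abs_pos.2 hz
  have him : ∀ w ∈ Metric.ball z (|z.im|/2), |z.im|/2 ≤ |w.im| := by
    intro w hw
    have h1 := Complex.abs_im_le_norm (w-z)
    rw [Metric.mem_ball, dist_eq_norm] at hw
    have h2 := abs_sub_abs_le_abs_sub z.im w.im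
    rw [abs_sub_comm, ← Complex.sub_im] at h2
    linarith
  have him0 : ∀ w ∈ Metric.ball z (|z.im|/2), w.im≠0 := fun w hw h0 => by
    have := him w hw; rw [h0, abs_zero] at this; linarith
  refine (hasDerivAt_integral_of_dominated_loc_of_deriv_le (𝕜 := ℂ)
    (F := fun z (r:ℝ) => ((exp (-r)*r^s:ℝ) : ℂ)*((r:ℂ)+2*z)^((-(1/2) : ℝ) : ℂ))
    (F' := fun z (r:ℝ) => -(((exp (-r)*r^s:ℝ) : ℂ)*((r:ℂ)+2*z)^((-(3/2) : ℝ) : ℂ)))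
    (bound := fun r => exp (-r)*r^s * |z.im| ^ (-(3/2):ℝ))
    (Metric.ball_mem_nhds z (half_pos hp)) ?_ ?_ (kC_meas s _ hz).neg ?_
    ((gam_int hs).mul_const _) ?_).2.differentiableAt
  · filter_upwards [Metric.ball_mem_nhds z (half_pos hp)] with w hw
    exact kC_meas s _ (him0 w hw)
  · refine Integrable.mono' ((gam_int hs).mul_const ((2 * |z.im|)^(-(1/2):ℝ))) (kC_meas s _ hz) ?_
    refine (ae_restrict_iff' measurableSet_Ioi).2 (Eventually.of_forall fun r hr => ?_)
    have hr' :0 < r := hr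
    rw [kC_norm s _ z hr]
    gcongr ?_ * ?_
    exact rpow_le_rpow_of_nonpos (by positivity) (im_le_norm r z) (by norm_num)
  · refine (ae_restrict_iff' measurableSet_Ioi).2 (Eventually.of_forall fun r hr w hw => ?_)
    have hr' :0 < r := hr
    rw [norm_neg, kC_norm s _ w hr]
    gcongr ?_ * ?_
    refine rpow_le_rpow_of_nonpos (by positivity) ?_ (by norm_num)
    have := him w hw
    linarith [im_le_norm r w]
  · refine Eventually.of_forall fun r w hw => ?_
    have h1 : HasDerivAt (fun w:ℂ => (r:ℂ)+2*w) 2 w := by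
      simpa using ((hasDerivAt_id w).const_mul (2:ℂ)).const_add (r:ℂ)
    have h2 := h1.cpow_const (c := ((-(1/2) : ℝ) : ℂ)) (slit_im (him0 w hw) r)
    refine (h2.const_mul ((exp (-r)*r^s:ℝ) : ℂ)).congr_deriv ?_
    have e : ((-(1/2) : ℝ) : ℂ)-1 = ((-(3/2) : ℝ) : ℂ) := by push_cast; norm_num
    rw [e]; push_cast; ring
lemma kC_conj (s:ℝ) {z:ℂ} (hz : z.im≠0) :
    kC s ((starRingEnd ℂ) z) = (starRingEnd ℂ) (kC s z) := by
  rw [kC, kC, ← integral_conj]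
  refine integral_congr_ae (Eventually.of_forall fun r => ?_)
  simp only
  rw [map_mul, Complex.conj_ofReal]
  congr 1
  have e : (r:ℂ)+2*(starRingEnd ℂ) z = (starRingEnd ℂ) ((r:ℂ)+2*z) := by
    rw [map_add, map_mul, Complex.conj_ofReal, Complex.conj_ofNat]
  rw [e, Complex.conj_cpow _ _ (Complex.mem_slitPlane_iff_arg.1 (slit_im hz r)).1,
    Complex.conj_ofReal]
def gB (s t:ℝ) : ℝ := ∫ r in Ioi (0:ℝ), exp (-r)*r^s * |r-2*t| ^ (-(1/2):ℝ)
lemma sq_int {t:ℝ} (ht :0 < t) :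
    IntegrableOn (fun r => |r-2*t| ^ (-(1/2):ℝ)) (Ioc t (3*t)) ∧
    ∫ r in Ioc t (3*t), |r-2*t| ^ (-(1/2):ℝ)=4*t^((1/2):ℝ) := by
  have hr : IntervalIntegrable (fun x:ℝ => x^(-(1/2):ℝ)) volume 0 t :=
    intervalIntegral.intervalIntegrable_rpow' (by norm_num)
  have h1 : IntervalIntegrable (fun r => |r-2*t| ^ (-(1/2):ℝ)) volume (2*t) (3*t) := by
    have h := hr.comp_sub_right (2*t)
    rw [zero_add, show t+2*t=3*t by ring] at h
    refine h.congr (fun r hr => ?_)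
    rw [uIoc_of_le (by linarith)] at hr
    rw [abs_of_pos (by linarith [hr.1])]
  have h2 : IntervalIntegrable (fun r => |r-2*t| ^ (-(1/2):ℝ)) volume t (2*t) := by
    have h := (hr.comp_sub_left (2*t)).symm
    rw [sub_zero, show 2*t-t = t by ring] at h
    refine h.congr (fun r hr => ?_)
    rw [uIoc_of_le (by linarith)] at hr
    rw [abs_of_nonpos (by linarith [hr.2])]; ring_nf
  have i0 : ∫ x in (0:ℝ)..t, x^(-(1/2):ℝ)=2*t^((1/2):ℝ) := by
    rw [integral_rpow (Or.inl (by norm_num)), show -(1/2:ℝ)+1=1/2 by norm_num,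
      zero_rpow (by norm_num)]; ring
  have i1 : ∫ r in (2*t)..(3*t), |r-2*t| ^ (-(1/2):ℝ)=2*t^((1/2):ℝ) := by
    rw [← i0]
    have h := intervalIntegral.integral_comp_sub_right (a :=2*t) (b :=3*t)
      (fun x:ℝ => x^(-(1/2):ℝ)) (2*t)
    rw [sub_self, show 3*t-2*t = t by ring] at h
    rw [← h]
    refine intervalIntegral.integral_congr fun r hr => ?_
    rw [uIcc_of_le (by linarith)] at hr
    rw [abs_of_nonneg (by linarith [hr.1])]
  have i2 : ∫ r in t..(2*t), |r-2*t| ^ (-(1/2):ℝ)=2*t^((1/2):ℝ) := by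
    rw [← i0]
    have h := intervalIntegral.integral_comp_sub_left (a := t) (b :=2*t)
      (fun x:ℝ => x^(-(1/2):ℝ)) (2*t)
    rw [sub_self, show 2*t-t = t by ring] at h
    rw [← h]
    refine intervalIntegral.integral_congr fun r hr => ?_
    rw [uIcc_of_le (by linarith)] at hr
    rw [abs_of_nonpos (by linarith [hr.2])]; ring_nf
  refine ⟨(intervalIntegrable_iff_integrableOn_Ioc_of_le (by linarith)).1 (h2.trans h1), ?_⟩
  rw [← intervalIntegral.integral_of_le (by linarith),
    ← intervalIntegral.integral_add_adjacent_intervals h2 h1, i1, i2]; ring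
lemma rpow_exp_le {r a:ℝ} (hr :0 < r) (h0 :0 ≤ a) (h1 : a≤2) : exp (-r)*r^a≤3 := by
  have h : r^a≤3*exp r := by
    have he := quadratic_le_exp_of_nonneg hr.le
    rcases le_total r 1 with h | h
    · have := rpow_le_one hr.le h h0; nlinarith
    · have := rpow_le_rpow_of_exponent_le h h1
      rw [show (2:ℝ) = ((2:ℕ):ℝ) by norm_num, rpow_natCast] at this
      nlinarith
  calc _ ≤ exp (-r)*(3*exp r) := by gcongr
    _=3*(exp (-r)*exp r) := by ring
    _=3 := by rw [← exp_add]; simp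
lemma gB_maj {s δ t r:ℝ} (hs0 : -(1/2) ≤ s) (hs1 : s≤1/2) (hδ :0 < δ) (hδ1 : δ≤1/2)
    (ht :0 < t) (hr :0 < r) :
    exp (-r)*r^s * |r-2*t| ^ (-(1/2):ℝ)≤3*t^(-δ)*(exp (-r)*r^(s+δ-1/2))
      + (Ioc t (3*t)).indicator (fun r => 3*t^(-(1/2)-δ) * |r-2*t| ^ (-(1/2):ℝ)) r := by
  by_cases hm : r ∈ Ioc t (3*t)
  · rw [indicator_of_mem hm]
    have key : exp (-r)*r^s≤3*t^(-(1/2)-δ) := by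
      have h1 := rpow_exp_le hr (a := s+1/2+δ) (by linarith) (by linarith)
      have h2 : r^(-(1/2)-δ) ≤ t^(-(1/2)-δ) :=
        rpow_le_rpow_of_nonpos ht hm.1.le (by linarith)
      calc exp (-r)*r^s = exp (-r)*r^(s+1/2+δ)*r^(-(1/2)-δ) := by
            rw [mul_assoc, ← rpow_add hr]; congr 2; ring
        _≤3*t^(-(1/2)-δ) := by gcongr
    have h0 :0 ≤ |r-2*t| ^ (-(1/2):ℝ) := by positivity
    have h3 :0≤3*t^(-δ)*(exp (-r)*r^(s+δ-1/2)) := by positivity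
    nlinarith
  · rw [indicator_of_notMem hm, add_zero]
    have hb : t ≤ |r-2*t| ∧ r/3 ≤ |r-2*t| := by
      rw [mem_Ioc, not_and_or, not_lt, not_le] at hm
      rcases hm with h | h
      · rw [abs_of_nonpos (by linarith)]; constructor <;> linarith
      · rw [abs_of_nonneg (by linarith)]; constructor <;> linarith
    have hpos :0 < |r-2*t| := lt_of_lt_of_le ht hb.1
    have e : |r-2*t| ^ (-(1/2):ℝ) ≤ t^(-δ)*(3*r^(δ-1/2)) := by
      calc |r-2*t| ^ (-(1/2):ℝ) = |r-2*t| ^ (-δ) * |r-2*t| ^ (δ-1/2) := by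
            rw [← rpow_add hpos]; congr 1; ring
        _ ≤ t^(-δ)*(r/3)^(δ-1/2) := by
          have a1 : |r-2*t| ^ (-δ) ≤ t^(-δ) := rpow_le_rpow_of_nonpos ht hb.1 (by linarith)
          have a2 : |r-2*t| ^ (δ-1/2) ≤ (r/3)^(δ-1/2) :=
            rpow_le_rpow_of_nonpos (by positivity) hb.2 (by linarith)
          gcongr
        _ ≤ _ := by
          gcongr
          rw [div_rpow hr.le (by norm_num), div_le_iff₀ (by positivity)]
          have :1≤3*(3:ℝ)^(δ-1/2) := by
            nth_rewrite 1 [← rpow_one 3]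
            rw [← rpow_add (by norm_num)]
            exact one_le_rpow (by norm_num) (by linarith)
          have hh :0 < r^(δ-1/2) := by positivity
          nlinarith
    calc _ ≤ exp (-r)*r^s*(t^(-δ)*(3*r^(δ-1/2))) := by gcongr
      _=3*t^(-δ)*(exp (-r)*(r^s*r^(δ-1/2))) := by ring
      _ = _ := by rw [← rpow_add hr]; congr 3; ring
lemma gB_int_le {s δ t:ℝ} (hs0 : -(1/2) ≤ s) (hs1 : s≤1/2) (hδ :0 < δ) (hδ1 : δ≤1/2)
    (ht :0 < t) : IntegrableOn (fun r => exp (-r)*r^s * |r-2*t| ^ (-(1/2):ℝ)) (Ioi 0) ∧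
    gB s t ≤ (3*Gamma (s+δ-1/2+1)+12)*t^(-δ) := by
  have hI1 := (gam_int (s := s+δ-1/2) (by linarith)).const_mul (3*t^(-δ))
  have hI2 : IntegrableOn ((Ioc t (3*t)).indicator
      (fun r => 3*t^(-(1/2)-δ) * |r-2*t| ^ (-(1/2):ℝ))) (Ioi 0) :=
    (IntegrableOn.integrable_indicator ((sq_int ht).1.const_mul _) measurableSet_Ioc).integrableOn
  have hmaj : ∀ r ∈ Ioi (0:ℝ), _ := fun r hr => gB_maj hs0 hs1 hδ hδ1 ht (mem_Ioi.1 hr)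
  have hInt : IntegrableOn (fun r => exp (-r)*r^s * |r-2*t| ^ (-(1/2):ℝ)) (Ioi 0) := by
    refine Integrable.mono' (hI1.add hI2) ?_ ?_
    · exact (((wS_cont s).aestronglyMeasurable measurableSet_Ioi).mul
        (Measurable.aestronglyMeasurable (by fun_prop)))
    · refine (ae_restrict_iff' measurableSet_Ioi).2 (Eventually.of_forall fun r hr => ?_)
      have hr' :0 < r := hr
      rw [norm_of_nonneg (by positivity)]
      exact hmaj r hr
  refine ⟨hInt, ?_⟩
  calc gB s t ≤ ∫ r in Ioi (0:ℝ), (3*t^(-δ)*(exp (-r)*r^(s+δ-1/2))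
      + (Ioc t (3*t)).indicator (fun r => 3*t^(-(1/2)-δ) * |r-2*t| ^ (-(1/2):ℝ)) r) :=
        setIntegral_mono_on hInt (hI1.add hI2) measurableSet_Ioi hmaj
    _ = _ := by
      rw [integral_add hI1 hI2, integral_const_mul, gam_eq (by linarith),
        setIntegral_indicator measurableSet_Ioc, show Ioi 0 ∩ Ioc t (3*t) = Ioc t (3*t) from
          inter_eq_right.2 fun r hr => ht.trans hr.1,
        integral_const_mul, (sq_int ht).2]
      rw [show 3*t^(-(1/2)-δ)*(4*t^((1/2):ℝ))=12*(t^(-(1/2)-δ)*t^((1/2):ℝ)) by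
        ring, ← rpow_add ht, show -(1/2)-δ+1/2 = -δ by ring]
      ring
lemma kC_dom (t y r:ℝ) (ht :0 < t) (hr :0 < r) (h : r≠2*t) (ε:ℂ) (hε : ε=1 ∨ ε = -1) :
    ‖(r:ℂ)+2*(ε*(t+y*Complex.I))‖ ^ (-(1/2):ℝ) ≤ |r-2*t| ^ (-(1/2):ℝ) := by
  refine rpow_le_rpow_of_nonpos (abs_pos.2 (sub_ne_zero.2 h)) ?_ (by norm_num)
  refine le_trans ?_ (Complex.abs_re_le_norm _)
  rcases hε with rfl | rfl
  · simp
    rw [abs_of_pos (a := r+2*t) (by positivity), abs_le]; constructor <;> linarith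
  · simp [sub_eq_add_neg]
lemma kC_le_gB {s:ℝ} (hs0 : -(1/2) ≤ s) (hs1 : s≤1/2) {t:ℝ} (y:ℝ) (ht :0 < t)
    (ε:ℂ) (hε : ε=1 ∨ ε = -1) : ‖kC s (ε*(t+y*Complex.I))‖ ≤ gB s t := by
  refine norm_integral_le_of_norm_le (gB_int_le hs0 hs1 (δ :=1/2) (by norm_num) le_rfl ht).1 ?_
  have h0 : ∀ᵐ r:ℝ, r≠2*t := by simp [ae_iff]
  refine (ae_restrict_iff' measurableSet_Ioi).2 (h0.mono fun r hne hr => ?_)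
  have hr' :0 < r := hr
  rw [kC_norm s _ _ hr]
  exact mul_le_mul_of_nonneg_left (kC_dom t y r ht hr hne ε hε) (by positivity)
lemma cl {α β : Type*} [TopologicalSpace β] {f : α → β} {l : Filter α} {a b : β}
    (h : Tendsto f l (𝓝 a)) (e : a = b) : Tendsto f l (𝓝 b) := e ▸ h
lemma kC_lim_pos {s:ℝ} (hs0 : -(1/2) ≤ s) (hs1 : s≤1/2) {t:ℝ} (ht :0 < t) {y:ℕ → ℝ}
    (hy : ∀ n,0 < y n) (hy0 : Tendsto y atTop (𝓝 0)) :
    Tendsto (fun n => kC s (t+y n*Complex.I)) atTop (𝓝 (kR s t:ℂ)) := by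
  have e : (kR s t:ℂ) = ∫ r in Ioi (0:ℝ), ((exp (-r)*r^s:ℝ) : ℂ) *
      (((r+2*t)^(-(1/2) : ℝ) : ℝ) : ℂ) := by
    rw [kR, ← integral_complex_ofReal]
    refine integral_congr_ae (Eventually.of_forall fun r => ?_)
    simp only; push_cast; ring
  rw [e]
  refine tendsto_integral_of_dominated_convergence
    (fun r => exp (-r)*r^s * |r-2*t| ^ (-(1/2):ℝ)) ?_
    (gB_int_le hs0 hs1 (δ :=1/2) (by norm_num) le_rfl ht).1 ?_ ?_
  · intro n; exact kC_meas s _ (by simpa using (hy n).ne')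
  · intro n
    have h0 : ∀ᵐ r:ℝ, r≠2*t := by simp [ae_iff]
    refine (ae_restrict_iff' measurableSet_Ioi).2 (h0.mono fun r hne hr => ?_)
    have hr' :0 < r := hr
    rw [kC_norm s _ _ hr]
    have := kC_dom t (y n) r ht hr hne 1 (Or.inl rfl)
    rw [one_mul] at this
    exact mul_le_mul_of_nonneg_left this (by positivity)
  · refine (ae_restrict_iff' measurableSet_Ioi).2 (Eventually.of_forall fun r hr => ?_)
    have hr' :0 < r := hr
    refine Tendsto.const_mul _ ?_
    rw [Complex.ofReal_cpow (by positivity)]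
    have h1 : Tendsto (fun n => (r:ℂ)+2*(t+y n*Complex.I)) atTop (𝓝 (((r+2*t:ℝ)) : ℂ)) := by
      have h2 : Tendsto (fun n => (y n:ℂ)) atTop (𝓝 ((0:ℝ):ℂ)) :=
        (Complex.continuous_ofReal.tendsto 0).comp hy0
      have := (((h2.mul_const Complex.I).const_add (t:ℂ)).const_mul 2).const_add (r:ℂ)
      convert this using 2; simp
    refine (h1.cpow tendsto_const_nhds ?_)
    left; rw [Complex.ofReal_re]; positivity
lemma kC_lim_neg {s:ℝ} (hs0 : -(1/2) ≤ s) (hs1 : s≤1/2) {t:ℝ} (ht :0 < t) {y:ℕ → ℝ}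
    (hy : ∀ n,0 < y n) (hy0 : Tendsto y atTop (𝓝 0)) :
    Tendsto (fun n => kC s (-(t+y n*Complex.I))) atTop (𝓝 (bR s t+cR s t*Complex.I)) := by
  set L:ℝ → ℂ := fun r => if r<2*t then (((2*t-r)^(-(1/2) : ℝ) : ℝ) : ℂ)*Complex.I
    else (((r-2*t)^(-(1/2) : ℝ) : ℝ) : ℂ) with hL
  have hgI := (gB_int_le hs0 hs1 (δ :=1/2) (by norm_num) le_rfl ht).1
  have h2 : Tendsto (fun n => (y n:ℂ)) atTop (𝓝 ((0:ℝ):ℂ)) :=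
    (Complex.continuous_ofReal.tendsto 0).comp hy0
  have hpt : ∀ r,0 < r → r≠2*t → Tendsto (fun n => ((r:ℂ)+2*(-(t+y n*Complex.I))) ^
      ((-(1/2) : ℝ) : ℂ)) atTop (𝓝 (L r)) := by
    intro r hr hne
    have h1 : Tendsto (fun n => (r:ℂ)+2*(-(t+y n*Complex.I))) atTop
        (𝓝 (((r-2*t:ℝ)) : ℂ)) := by
      have := ((((h2.mul_const Complex.I).const_add (t:ℂ)).neg).const_mul 2).const_add (r:ℂ)
      convert this using 2; push_cast; ring
    rcases lt_or_gt_of_ne hne with h | h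
    · rw [hL]; simp only [h, if_true]
      have hneg : r-2*t<0 := by linarith
      have hlog := (Complex.tendsto_log_nhdsWithin_im_neg_of_re_neg_of_im_zero
        (z := ((r-2*t:ℝ) : ℂ)) (by rwa [Complex.ofReal_re]) (Complex.ofReal_im _)).comp
        (tendsto_nhdsWithin_iff.2 ⟨h1, Eventually.of_forall fun n => by
          simpa using hy n⟩)
      have hexp := (Complex.continuous_exp.tendsto _).comp (hlog.mul_const ((-(1/2) : ℝ) : ℂ))
      refine cl (hexp.congr fun n => ?_) ?_
      · simp only [Function.comp]
        rw [Complex.cpow_def_of_ne_zero]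
        intro h0
        have := congrArg Complex.im h0
        simp at this
        exact (hy n).ne' this
      · rw [Complex.norm_real, norm_eq_abs, abs_of_neg hneg, sub_mul, Complex.exp_sub,
          rpow_def_of_pos (by linarith)]
        have e1 : Complex.exp (π*Complex.I*((-(1/2) : ℝ) : ℂ)) = - Complex.I := by
          rw [show (π:ℂ)*Complex.I*((-(1/2) : ℝ) : ℂ) = -(π/2*Complex.I) by push_cast; ring,
            Complex.exp_neg, Complex.exp_pi_div_two_mul_I, Complex.inv_I]
        rw [e1]; push_cast
        rw [div_neg, Complex.div_I]
        simp
    · rw [hL]; simp only [not_lt.2 h.le, if_false]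
      rw [Complex.ofReal_cpow (by linarith)]
      refine (h1.cpow tendsto_const_nhds ?_)
      left; rw [Complex.ofReal_re]; linarith
  have h0 : ∀ᵐ r:ℝ, r≠2*t := by simp [ae_iff]
  have hlim : Tendsto (fun n => kC s (-(t+y n*Complex.I))) atTop
      (𝓝 (∫ r in Ioi (0:ℝ), ((exp (-r)*r^s:ℝ) : ℂ)*L r)) := by
    refine tendsto_integral_of_dominated_convergence
      (fun r => exp (-r)*r^s * |r-2*t| ^ (-(1/2):ℝ)) ?_ hgI ?_ ?_
    · intro n; exact kC_meas s _ (by simpa using (hy n).ne')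
    · intro n
      refine (ae_restrict_iff' measurableSet_Ioi).2 (h0.mono fun r hne hr => ?_)
      have hr' :0 < r := hr
      rw [kC_norm s _ _ hr]
      have := kC_dom t (y n) r ht hr hne (-1) (Or.inr rfl)
      rw [neg_one_mul] at this
      exact mul_le_mul_of_nonneg_left this (by positivity)
    · refine (ae_restrict_iff' measurableSet_Ioi).2 (h0.mono fun r hne hr => ?_)
      exact (hpt r hr hne).const_mul _
  refine cl hlim ?_
  have hb : IntegrableOn (fun r => exp (-r)*r^s*(r-2*t)^(-(1/2):ℝ)) (Ioi (2*t)) := by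
    refine (hgI.mono_set (Ioi_subset_Ioi (by positivity))).congr_fun (fun r hr => ?_) measurableSet_Ioi
    have :2*t < r := hr
    simp only; rw [abs_of_pos (by linarith)]
  have hc : IntegrableOn (fun r => exp (-r)*r^s*(2*t-r)^(-(1/2):ℝ)) (Ioo 0 (2*t)) := by
    refine (hgI.mono_set Ioo_subset_Ioi_self).congr_fun (fun r hr => ?_) measurableSet_Ioo
    simp only; rw [abs_of_neg (by linarith [hr.2])]; simp
  have hb' : IntegrableOn (fun r => ((exp (-r)*r^s:ℝ) : ℂ)*L r) (Ioi (2*t)) := by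
    refine IntegrableOn.congr_fun (f := fun r => ((exp (-r)*r^s*(r-2*t)^(-(1/2):ℝ) : ℝ) : ℂ)) hb.ofReal (fun r hr => ?_) measurableSet_Ioi
    have :2*t < r := hr
    simp only [hL, not_lt.2 this.le, if_false]; simp
  have hc' : IntegrableOn (fun r => ((exp (-r)*r^s:ℝ) : ℂ)*L r) (Ioo 0 (2*t)) := by
    refine IntegrableOn.congr_fun (f := fun r => ((exp (-r)*r^s*(2*t-r)^(-(1/2):ℝ) : ℝ) : ℂ)*Complex.I) (hc.ofReal.mul_const Complex.I) (fun r hr => ?_) measurableSet_Ioo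
    simp only [hL, hr.2, if_true]; simp; ring
  rw [show Ioi (0:ℝ) = Ioc 0 (2*t) ∪ Ioi (2*t) from (Ioc_union_Ioi_eq_Ioi (by positivity)).symm,
    setIntegral_union (by
      rw [Set.disjoint_left]; intro r h1 h2; exact absurd h1.2 (not_le.2 h2)) measurableSet_Ioi
      ((integrableOn_Ioc_iff_integrableOn_Ioo).2 hc') hb', integral_Ioc_eq_integral_Ioo, add_comm]
  congr 1
  · rw [bR, ← integral_complex_ofReal]
    refine setIntegral_congr_fun measurableSet_Ioi (fun r hr => ?_)
    have :2*t < r := hr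
    simp only [hL, not_lt.2 this.le, if_false]; simp
  · rw [cR, ← integral_complex_ofReal, ← integral_mul_const]
    refine setIntegral_congr_fun measurableSet_Ioo (fun r hr => ?_)
    simp only [hL, hr.2, if_true]; simp; ring
def Phi (z:ℂ) : ℂ := kC (-(1/2)) z*kC (-(1/2)) (-z)
def Psi (z:ℂ) : ℂ :=
  -(kC (1/2) z*kC (-(1/2)) (-z)+kC (-(1/2)) z*kC (1/2) (-z))
def ff (z:ℂ) : ℂ := -(13/3)*z*Phi z^3+10*z*Phi z*Psi z^2
lemma Phi_le {z:ℂ} {M:ℝ} (h1 : ‖kC (-(1/2)) z‖ ≤ M) (h2 : ‖kC (-(1/2)) (-z)‖ ≤ M) :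
    ‖Phi z‖ ≤ M^2 := by
  have hM :0 ≤ M := (norm_nonneg _).trans h1
  rw [Phi, norm_mul, sq]; gcongr
lemma Psi_le {z:ℂ} {M:ℝ} (h1 : ‖kC (-(1/2)) z‖ ≤ M) (h2 : ‖kC (-(1/2)) (-z)‖ ≤ M)
    (h3 : ‖kC (1/2) z‖ ≤ M) (h4 : ‖kC (1/2) (-z)‖ ≤ M) : ‖Psi z‖ ≤2*M^2 := by
  have hM :0 ≤ M := (norm_nonneg _).trans h1
  rw [Psi, norm_neg]
  refine (norm_add_le _ _).trans ?_
  rw [norm_mul, norm_mul]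
  calc _ ≤ M*M+M*M := by gcongr
    _ = _ := by ring
lemma ff_le {z:ℂ} {M:ℝ} (h1 : ‖kC (-(1/2)) z‖ ≤ M) (h2 : ‖kC (-(1/2)) (-z)‖ ≤ M)
    (h3 : ‖kC (1/2) z‖ ≤ M) (h4 : ‖kC (1/2) (-z)‖ ≤ M) : ‖ff z‖ ≤50 * ‖z‖ * M^6 := by
  have hM :0 ≤ M := (norm_nonneg _).trans h1
  have a := Phi_le h1 h2
  have b := Psi_le h1 h2 h3 h4
  refine (norm_add_le _ _).trans ?_
  simp only [norm_mul, norm_pow, norm_neg]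
  calc _ ≤ ‖(13/3:ℂ)‖ * ‖z‖ * (M^2)^3 + ‖(10:ℂ)‖ * ‖z‖ * M^2*(2*M^2)^2 := by gcongr
    _ ≤ _ := by
      have e1 : ‖(13/3:ℂ)‖ =13/3 := by norm_num
      have e2 : ‖(10:ℂ)‖ =10 := by norm_num
      rw [e1, e2]
      have :0 ≤ ‖z‖ * M^6 := by positivity
      nlinarith
lemma kC_unif : ∃ C:ℝ,0 < C ∧ ∀ s, (s=1/2 ∨ s = -(1/2)) → ∀ t:ℝ,0 < t → ∀ y:ℝ,
    ∀ ε:ℂ, (ε=1 ∨ ε = -1) → ∀ δ, (δ=1/8 ∨ δ=1/2) →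
    ‖kC s (ε*(t+y*Complex.I))‖ ≤ C*t^(-δ:ℝ) := by
  have key : ∀ s, (s=1/2 ∨ s = -(1/2)) → ∀ δ, (δ=1/8 ∨ δ=1/2) → ∃ C:ℝ,0 < C ∧
    ∀ t,0 < t → gB s t ≤ C*t^(-δ:ℝ) := by
    intro s hs δ hδ
    have hd :0 < δ := by rcases hδ with rfl | rfl <;> norm_num
    have hd1 : δ≤1/2 := by rcases hδ with rfl | rfl <;> norm_num
    have hs0 : -(1/2) ≤ s := by rcases hs with rfl | rfl <;> norm_num
    have hs1 : s≤1/2 := by rcases hs with rfl | rfl <;> norm_num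
    refine ⟨3*Gamma (s+δ-1/2+1)+12, ?_, fun t ht => (gB_int_le hs0 hs1 hd hd1 ht).2⟩
    have := Gamma_pos_of_pos (s := s+δ-1/2+1) (by linarith)
    positivity
  obtain ⟨C1, p1, h1⟩ := key (1/2) (Or.inl rfl) (1/8) (Or.inl rfl)
  obtain ⟨C2, p2, h2⟩ := key (1/2) (Or.inl rfl) (1/2) (Or.inr rfl)
  obtain ⟨C3, p3, h3⟩ := key (-(1/2)) (Or.inr rfl) (1/8) (Or.inl rfl)
  obtain ⟨C4, p4, h4⟩ := key (-(1/2)) (Or.inr rfl) (1/2) (Or.inr rfl)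
  refine ⟨C1+C2+C3+C4, by positivity, fun s hs t ht y ε hε δ hδ => ?_⟩
  have hs0 : -(1/2) ≤ s := by rcases hs with rfl | rfl <;> norm_num
  have hs1 : s≤1/2 := by rcases hs with rfl | rfl <;> norm_num
  refine (kC_le_gB hs0 hs1 y ht ε hε).trans ?_
  have hp :0 < t^(-δ) := by positivity
  rcases hs with rfl | rfl <;> rcases hδ with rfl | rfl
  · exact (h1 t ht).trans (by gcongr; linarith)
  · exact (h2 t ht).trans (by gcongr; linarith)
  · exact (h3 t ht).trans (by gcongr; linarith)
  · exact (h4 t ht).trans (by gcongr; linarith)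
lemma kC_unif4 : ∃ C:ℝ,0 < C ∧ ∀ t:ℝ,0 < t → ∀ y:ℝ, ∀ δ, (δ=1/8 ∨ δ=1/2) →
    (‖kC (-(1/2)) (t+y*Complex.I)‖ ≤ C*t^(-δ:ℝ)) ∧
    (‖kC (-(1/2)) (-(t+y*Complex.I))‖ ≤ C*t^(-δ:ℝ)) ∧
    (‖kC (1/2) (t+y*Complex.I)‖ ≤ C*t^(-δ:ℝ)) ∧
    (‖kC (1/2) (-(t+y*Complex.I))‖ ≤ C*t^(-δ:ℝ)) := by
  obtain ⟨C, hC, h⟩ := kC_unif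
  refine ⟨C, hC, fun t ht y δ hδ => ?_⟩
  have a := h (-(1/2)) (Or.inr rfl) t ht y 1 (Or.inl rfl) δ hδ
  have b := h (-(1/2)) (Or.inr rfl) t ht y (-1) (Or.inr rfl) δ hδ
  have c := h (1/2) (Or.inl rfl) t ht y 1 (Or.inl rfl) δ hδ
  have d := h (1/2) (Or.inl rfl) t ht y (-1) (Or.inr rfl) δ hδ
  rw [one_mul] at a c
  rw [neg_one_mul] at b d
  exact ⟨a, b, c, d⟩
lemma ff_unif : ∃ C:ℝ,0 < C ∧ ∀ t:ℝ,0 < t → ∀ y:ℝ,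
    ‖ff (t+y*Complex.I)‖ ≤ C*(t + |y|)*t^(-(3/4):ℝ) ∧
    ‖ff (t+y*Complex.I)‖ ≤ C*(t + |y|)*t^(-3:ℝ) := by
  obtain ⟨C, hC, h⟩ := kC_unif4
  refine ⟨50*C^6, by positivity, fun t ht y => ?_⟩
  have hz : ‖(t+y*Complex.I:ℂ)‖ ≤ t + |y| := by
    refine (norm_add_le _ _).trans ?_
    simp [abs_of_pos ht]
  have e : ∀ δ:ℝ, (C*t^(-δ))^6 = C^6*t^(-(6*δ)) := by
    intro δ
    rw [mul_pow, ← rpow_natCast (t^(-δ)), ← rpow_mul ht.le]; congr 2; push_cast; ring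
  constructor
  · obtain ⟨a, b, c, d⟩ := h t ht y (1/8) (Or.inl rfl)
    refine (ff_le a b c d).trans ?_
    rw [e, show -(6*(1/8)) = -(3/4:ℝ) by norm_num]
    calc _≤50*(t + |y|)*(C^6*t^(-(3/4):ℝ)) := by gcongr
      _ = _ := by ring
  · obtain ⟨a, b, c, d⟩ := h t ht y (1/2) (Or.inr rfl)
    refine (ff_le a b c d).trans ?_
    rw [e, show -(6*(1/2)) = (-3:ℝ) by norm_num]
    calc _≤50*(t + |y|)*(C^6*t^(-3:ℝ)) := by gcongr
      _ = _ := by ring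
lemma ff_top : ∃ C:ℝ,0 < C ∧ ∀ N:ℝ,1 ≤ N → ∀ x:ℝ,0 ≤ x → x ≤ N →
    ‖ff (x+N*Complex.I)‖ ≤ C*N^(-2:ℝ) := by
  have g1 :0 < Gamma (-(1/2)+1) := Gamma_pos_of_pos (by norm_num)
  have g2 :0 < Gamma (1/2+1) := Gamma_pos_of_pos (by norm_num)
  set G := Gamma (-(1/2)+1)+Gamma (1/2+1) with hG
  have hGp :0 < G := by positivity
  refine ⟨100*G^6, by positivity, fun N hN x hx hxN => ?_⟩
  have hN0 :0 < N := by linarith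
  have him : (x+N*Complex.I:ℂ).im = N := by simp
  have him' : (-(x+N*Complex.I) : ℂ).im = -N := by simp
  have h1 : ∀ s, (s=1/2 ∨ s = -(1/2)) → ∀ z:ℂ, |z.im| = N → ‖kC s z‖ ≤ G*N^(-(1/2):ℝ) := by
    intro s hs z hz
    have hz0 : z.im≠0 := by rw [← abs_pos, hz]; exact hN0
    refine (kC_le_im (by rcases hs with rfl | rfl <;> norm_num) hz0).trans ?_
    rw [hz]
    have e1 : Gamma (s+1) ≤ G := by
      rcases hs with rfl | rfl
      · linarith
      · linarith
    have e2 : (2*N)^(-(1/2):ℝ) ≤ N^(-(1/2):ℝ) :=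
      rpow_le_rpow_of_nonpos hN0 (by linarith) (by norm_num)
    gcongr
  have hz : ‖(x+N*Complex.I:ℂ)‖ ≤2*N := by
    refine (norm_add_le _ _).trans ?_
    simp [abs_of_nonneg hx, abs_of_pos hN0]; linarith
  have p1 : |(x+N*Complex.I:ℂ).im| = N := by rw [him, abs_of_pos hN0]
  have p2 : |(-(x+N*Complex.I) : ℂ).im| = N := by rw [him', abs_neg, abs_of_pos hN0]
  refine (ff_le (h1 _ (Or.inr rfl) _ p1) (h1 _ (Or.inr rfl) _ p2) (h1 _ (Or.inl rfl) _ p1)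
    (h1 _ (Or.inl rfl) _ p2)).trans ?_
  have e : (N^(-(1/2):ℝ))^6 = N^(-3:ℝ) := by
    rw [← rpow_natCast, ← rpow_mul hN0.le]; norm_num
  rw [mul_pow, e]
  calc _≤50*(2*N)*(G^6*N^(-3:ℝ)) := by gcongr
    _=100*G^6*(N^(1:ℝ)*N^(-3:ℝ)) := by rw [rpow_one]; ring
    _ = _ := by rw [← rpow_add hN0]; norm_num
lemma ff_diff {z:ℂ} (hz : z.im≠0) : DifferentiableAt ℂ ff z := by
  have hz' : (-z).im≠0 := by simpa using hz
  have a : DifferentiableAt ℂ (kC (-(1/2))) z := kC_diff (by norm_num) hz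
  have b : DifferentiableAt ℂ (kC (1/2)) z := kC_diff (by norm_num) hz
  have c : DifferentiableAt ℂ (fun z => kC (-(1/2)) (-z)) z :=
    (kC_diff (by norm_num) hz' : DifferentiableAt ℂ (kC (-(1/2))) (-z)).comp z differentiableAt_id.neg
  have d : DifferentiableAt ℂ (fun z => kC (1/2) (-z)) z :=
    (kC_diff (by norm_num) hz' : DifferentiableAt ℂ (kC (1/2)) (-z)).comp z differentiableAt_id.neg
  unfold ff Phi Psi
  fun_prop
lemma ff_axis {y:ℝ} (hy :0 < y) : ∃ g:ℝ, ff (y*Complex.I) = g*Complex.I := by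
  have hc : -(y*Complex.I) = (starRingEnd ℂ) (y*Complex.I) := by simp
  have hz : (y*Complex.I).im≠0 := by simpa using hy.ne'
  have e : ∀ s, kC s (-(y*Complex.I)) = (starRingEnd ℂ) (kC s (y*Complex.I)) := fun s => by
    rw [hc, kC_conj s hz]
  have h1 : Phi (y*Complex.I) = ((Complex.normSq (kC (-(1/2)) (y*Complex.I)) : ℝ) : ℂ) := by
    rw [Phi, e, Complex.mul_conj]
  have h2 : Psi (y*Complex.I) = ((-(2*(kC (1/2) (y*Complex.I) *
      (starRingEnd ℂ) (kC (-(1/2)) (y*Complex.I))).re) : ℝ) : ℂ) := by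
    rw [Psi, e, e]
    have := Complex.add_conj (kC (1/2) (y*Complex.I)*(starRingEnd ℂ) (kC (-(1/2)) (y*Complex.I)))
    rw [map_mul, Complex.conj_conj] at this
    push_cast
    push_cast at this
    rw [← this]; ring
  rw [ff, h1, h2]
  refine ⟨-(13/3)*y*(Complex.normSq (kC (-(1/2)) (y*Complex.I)))^3+10*y *
    (Complex.normSq (kC (-(1/2)) (y*Complex.I)))*(-(2*(kC (1/2) (y*Complex.I) *
      (starRingEnd ℂ) (kC (-(1/2)) (y*Complex.I))).re))^2, ?_⟩
  push_cast; ring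
def Ph0 (t:ℝ) : ℂ := (K0 t^2:ℝ)+(π*(I0 t*K0 t) : ℝ)*Complex.I
def Ps0 (t:ℝ) : ℂ :=
  (-(2*K0 t*Kk t) : ℝ)+(π*(Ii t*K0 t-I0 t*Kk t) : ℝ)*Complex.I
def ff0 (t:ℝ) : ℂ := -(13/3)*t*Ph0 t^3+10*t*Ph0 t*Ps0 t^2
lemma PhPs_lim {t:ℝ} (ht :0 < t) {y:ℕ → ℝ}
    (hy : ∀ n,0 < y n) (hy0 : Tendsto y atTop (𝓝 0)) :
    Tendsto (fun n => Phi (t+y n*Complex.I)) atTop (𝓝 (Ph0 t)) ∧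
    Tendsto (fun n => Psi (t+y n*Complex.I)) atTop (𝓝 (Ps0 t)) := by
  have a := kC_lim_pos (s := -(1/2)) le_rfl (by norm_num) ht hy hy0
  have b := kC_lim_pos (s :=1/2) (by norm_num) le_rfl ht hy hy0
  have c := kC_lim_neg (s := -(1/2)) le_rfl (by norm_num) ht hy hy0
  have d := kC_lim_neg (s :=1/2) (by norm_num) le_rfl ht hy hy0
  have hE : exp t*exp (-t)=1 := by rw [← exp_add]; simp
  have h2 : exp (-(2*t)) = exp (-t)*exp (-t) := by rw [← exp_add]; ring_nf
  have k1 : kR (-(1/2)) t = exp t*K0 t := by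
    rw [K0_eq_kR ht]; linear_combination (-kR (-(1/2)) t)*hE
  have k2 : kR (1/2) t = exp t*(Kk t-t*K0 t) := by
    rw [K0_eq_kR ht, Kk_eq_kR ht]; linear_combination (-kR (1/2) t)*hE
  have k3 : bR (-(1/2)) t = exp (-t)*K0 t := by
    rw [bR_zero ht, h2, k1]; linear_combination (exp (-t)*K0 t)*hE
  have k4 : bR (1/2) t = exp (-t)*(Kk t+t*K0 t) := by
    rw [bR_one ht, h2, k1, k2]; linear_combination (exp (-t)*(Kk t+t*K0 t))*hE
  have hEc : (exp t:ℂ)*(exp (-t) : ℂ)=1 := by exact_mod_cast hE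
  rw [k1] at a
  rw [k2] at b
  rw [k3, cR_zero ht] at c
  rw [k4, cR_one ht] at d
  push_cast at a b c d hEc
  constructor
  · refine cl (a.mul c) ?_
    rw [Ph0]; push_cast
    linear_combination ((K0 t:ℂ)^2+π*(I0 t*K0 t)*Complex.I)*hEc
  · refine cl ((b.mul c).add (a.mul d)).neg ?_
    rw [Ps0]; push_cast
    linear_combination (-(2*K0 t*Kk t:ℂ)+π*(Ii t*K0 t-I0 t*Kk t)*Complex.I)*hEc
lemma ff_lim {t:ℝ} (ht :0 < t) {y:ℕ → ℝ}
    (hy : ∀ n,0 < y n) (hy0 : Tendsto y atTop (𝓝 0)) :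
    Tendsto (fun n => ff (t+y n*Complex.I)) atTop (𝓝 (ff0 t)) := by
  obtain ⟨a, b⟩ := PhPs_lim ht hy hy0
  have h2 : Tendsto (fun n => (y n:ℂ)) atTop (𝓝 ((0:ℝ):ℂ)) :=
    (Complex.continuous_ofReal.tendsto 0).comp hy0
  have h3 : Tendsto (fun n => (t+y n*Complex.I:ℂ)) atTop (𝓝 (t:ℂ)) :=
    cl ((h2.mul_const Complex.I).const_add (t:ℂ)) (by simp)
  exact ((h3.const_mul _).mul (a.pow 3)).add (((h3.const_mul _).mul a).mul (b.pow 2))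
def bdF (C t:ℝ) : ℝ := if t≤1 then C*t^(-(3/4):ℝ) else C*t^(-2:ℝ)
lemma bdF_int (C:ℝ) : IntegrableOn (bdF C) (Ioi 0) := by
  rw [← Ioc_union_Ioi_eq_Ioi (zero_le_one' ℝ)]
  refine IntegrableOn.union ?_ ?_
  · have := intervalIntegral.intervalIntegrable_rpow' (a :=0) (b :=1) (r := -(3/4)) (by norm_num)
    rw [intervalIntegrable_iff_integrableOn_Ioc_of_le zero_le_one] at this
    refine IntegrableOn.congr_fun (f := fun t => C*t^(-(3/4):ℝ)) (this.const_mul C) ?_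
      measurableSet_Ioc
    intro t ht; simp only [bdF, ht.2, if_true]
  · refine IntegrableOn.congr_fun (f := fun t => C*t^(-2:ℝ))
      ((integrableOn_Ioi_rpow_of_lt (a := -2) (by norm_num) one_pos).const_mul C) ?_ measurableSet_Ioi
    intro t ht; simp only [bdF, not_le.2 (mem_Ioi.1 ht), if_false]
lemma ff_bd : ∃ C:ℝ,0 < C ∧ ∀ t:ℝ,0 < t → ∀ y:ℝ, |y| ≤1 →
    ‖ff (t+y*Complex.I)‖ ≤ bdF C t := by
  obtain ⟨C, hC, h⟩ := ff_unif
  refine ⟨2*C, by positivity, fun t ht y hy => ?_⟩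
  obtain ⟨a, b⟩ := h t ht y
  unfold bdF
  split_ifs with h1
  · refine a.trans ?_
    have hp :0 < t^(-(3/4):ℝ) := by positivity
    have : C*(t + |y|)≤2*C := by nlinarith
    exact mul_le_mul_of_nonneg_right this hp.le
  · refine b.trans ?_
    rw [not_le] at h1
    calc C*(t + |y|)*t^(-3:ℝ) ≤ C*(2*t)*t^(-3:ℝ) := by gcongr; linarith
      _=2*C*(t^(1:ℝ)*t^(-3:ℝ)) := by rw [rpow_one]; ring
      _ = _ := by rw [← rpow_add ht]; norm_num
def yy (n:ℕ) : ℝ :=1/((n:ℝ)+1)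
lemma yy_pos (n:ℕ) :0 < yy n := by unfold yy; positivity
lemma yy_le (n:ℕ) : yy n≤1 := by
  unfold yy; rw [div_le_one (by positivity)]; linarith [(Nat.cast_nonneg n : (0:ℝ) ≤ n)]
lemma yy_lim : Tendsto yy atTop (𝓝 0) := tendsto_one_div_add_atTop_nhds_zero_nat
lemma ff_line_cont {y:ℝ} (hy : y≠0) : Continuous (fun x:ℝ => ff (x+y*Complex.I)) := by
  rw [continuous_iff_continuousAt]
  intro x
  have h1 : ContinuousAt ff (x+y*Complex.I) := (ff_diff (by simpa using hy)).continuousAt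
  exact ContinuousAt.comp (f := fun x:ℝ => (x+y*Complex.I:ℂ)) h1 (by fun_prop)
lemma ff0_le : ∃ C:ℝ,0 < C ∧ ∀ t:ℝ,0 < t → ‖ff0 t‖ ≤ bdF C t := by
  obtain ⟨C, hC, h⟩ := ff_bd
  refine ⟨C, hC, fun t ht => ?_⟩
  refine le_of_tendsto (ff_lim ht yy_pos yy_lim).norm (Eventually.of_forall fun n => ?_)
  exact h t ht _ (by rw [abs_of_pos (yy_pos n)]; exact yy_le n)
lemma Ph0_le : ∃ C:ℝ,0 < C ∧ ∀ t:ℝ,0 < t → ∀ δ:ℝ, (δ=1/8 ∨ δ=1/2) →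
    ‖Ph0 t‖ ≤ C*t^(-(2*δ)) ∧ ‖Ps0 t‖ ≤ C*t^(-(2*δ)) := by
  obtain ⟨C, hC, h⟩ := kC_unif4
  refine ⟨2*C^2, by positivity, fun t ht δ hδ => ?_⟩
  have e : (C*t^(-δ))^2 = C^2*t^(-(2*δ)) := by
    rw [mul_pow, ← rpow_natCast (t^(-δ)), ← rpow_mul ht.le]; congr 2; push_cast; ring
  obtain ⟨l1, l2⟩ := PhPs_lim ht yy_pos yy_lim
  have hp :0 < C^2*t^(-(2*δ)) := by positivity
  constructor
  · refine le_of_tendsto l1.norm (Eventually.of_forall fun n => ?_)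
    obtain ⟨a, b, c, d⟩ := h t ht (yy n) δ hδ
    have := Phi_le a b
    rw [e] at this; nlinarith
  · refine le_of_tendsto l2.norm (Eventually.of_forall fun n => ?_)
    obtain ⟨a, b, c, d⟩ := h t ht (yy n) δ hδ
    have := Psi_le a b c d
    rw [e] at this; nlinarith
lemma ff0_contOn : ContinuousOn ff0 (Ioi 0) := by
  have a := K0_contOn
  have b := Kk_contOn
  have c := I0_cont.continuousOn (s := Ioi (0:ℝ))
  have d := Ii_cont.continuousOn (s := Ioi (0:ℝ))
  unfold ff0 Ph0 Ps0
  have e : ContinuousOn (fun t => ((K0 t^2:ℝ):ℂ)) (Ioi 0) :=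
    Complex.continuous_ofReal.comp_continuousOn (a.pow 2)
  have f : ContinuousOn (fun t => ((π*(I0 t*K0 t) : ℝ):ℂ)) (Ioi 0) :=
    Complex.continuous_ofReal.comp_continuousOn ((c.mul a).const_mul π |> fun h => h)
  have g : ContinuousOn (fun t => ((-(2*K0 t*Kk t) : ℝ):ℂ)) (Ioi 0) :=
    Complex.continuous_ofReal.comp_continuousOn (((continuousOn_const.mul a).mul b).neg)
  have h : ContinuousOn (fun t => ((π*(Ii t*K0 t-I0 t*Kk t) : ℝ):ℂ)) (Ioi 0) :=
    Complex.continuous_ofReal.comp_continuousOn (continuousOn_const.mul ((d.mul a).sub (c.mul b)))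
  fun_prop
lemma ff0_int : IntegrableOn ff0 (Ioi 0) := by
  obtain ⟨C, hC, h⟩ := ff0_le
  refine Integrable.mono' (bdF_int C) (ff0_contOn.aestronglyMeasurable measurableSet_Ioi) ?_
  exact (ae_restrict_iff' measurableSet_Ioi).2 (Eventually.of_forall fun t ht => h t ht)
lemma bottom_lim : Tendsto (fun n:ℕ => ∫ x in (0:ℝ)..((n:ℝ)+1), ff (x+yy n*Complex.I)) atTop
    (𝓝 (∫ t in Ioi (0:ℝ), ff0 t)) := by
  obtain ⟨C, hC, h⟩ := ff_bd
  have e : ∀ n:ℕ, ∫ x in (0:ℝ)..((n:ℝ)+1), ff (x+yy n*Complex.I) =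
      ∫ x in Ioi (0:ℝ), (Ioc (0:ℝ) ((n:ℝ)+1)).indicator (fun x => ff (x+yy n*Complex.I)) x := by
    intro n
    rw [intervalIntegral.integral_of_le (by positivity), setIntegral_indicator measurableSet_Ioc,
      show Ioi (0:ℝ) ∩ Ioc 0 ((n:ℝ)+1) = Ioc 0 ((n:ℝ)+1) from inter_eq_right.2 fun r hr => hr.1]
  simp_rw [e]
  refine tendsto_integral_of_dominated_convergence (bdF C) ?_ (bdF_int C) ?_ ?_
  · intro n
    exact ((ff_line_cont (yy_pos n).ne').aestronglyMeasurable.indicator measurableSet_Ioc)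
  · intro n
    refine (ae_restrict_iff' measurableSet_Ioi).2 (Eventually.of_forall fun t ht => ?_)
    refine (norm_indicator_le_norm_self _ _).trans ?_
    exact h t ht _ (by rw [abs_of_pos (yy_pos n)]; exact yy_le n)
  · refine (ae_restrict_iff' measurableSet_Ioi).2 (Eventually.of_forall fun t ht => ?_)
    refine (ff_lim ht yy_pos yy_lim).congr' ?_
    obtain ⟨N, hN⟩ := exists_nat_ge t
    filter_upwards [eventually_ge_atTop N] with n hn
    rw [indicator_of_mem]
    refine ⟨ht, ?_⟩
    have : (N:ℝ) ≤ n := by exact_mod_cast hn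
    linarith
lemma rect_bd : ∃ C:ℝ,0 < C ∧ ∀ n:ℕ,
    |(∫ x in (0:ℝ)..((n:ℝ)+1), ff (x+yy n*Complex.I)).im| ≤ C*yy n := by
  obtain ⟨C1, hC1, h1⟩ := ff_top
  obtain ⟨C2, hC2, h2⟩ := ff_unif
  refine ⟨C1+2*C2, by positivity, fun n => ?_⟩
  set N:ℝ := (n:ℝ)+1 with hN
  have hN1 :1 ≤ N := by rw [hN]; linarith [(Nat.cast_nonneg n : (0:ℝ) ≤ n)]
  have hN0 :0 < N := by linarith
  have hyN : yy n = N⁻¹ := by rw [yy, one_div]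
  have hy1 := yy_le n
  have hy0 := yy_pos n
  have hr := Complex.integral_boundary_rect_eq_zero_of_differentiableOn ff
    (⟨0, yy n⟩ : ℂ) ⟨N, N⟩ (fun z hz => by
      have hzi : z.im ∈ uIcc (yy n) N := hz.2
      rw [uIcc_of_le (by linarith)] at hzi
      exact (ff_diff (ne_of_gt (lt_of_lt_of_le hy0 hzi.1))).differentiableWithinAt)
  simp only at hr
  have e2 : (N:ℝ)*N^(-2:ℝ) = yy n := by
    nth_rewrite 1 [← rpow_one N]
    rw [← rpow_add hN0, hyN]; norm_num [rpow_neg_one]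
  have hT : ‖∫ x in (0:ℝ)..N, ff (x+N*Complex.I)‖ ≤ C1*yy n := by
    have := intervalIntegral.norm_integral_le_of_norm_le_const (a :=0) (b := N)
      (f := fun x:ℝ => ff (x+N*Complex.I)) (C := C1*N^(-2:ℝ)) (fun x hx => by
        rw [uIoc_of_le hN0.le] at hx
        exact h1 N hN1 x hx.1.le hx.2)
    rw [sub_zero, abs_of_pos hN0] at this
    rw [← e2]; linarith
  have hR : ‖∫ y in (yy n)..N, ff (N+y*Complex.I)‖ ≤2*C2*yy n := by
    have := intervalIntegral.norm_integral_le_of_norm_le_const (a := yy n) (b := N)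
      (f := fun y:ℝ => ff (N+y*Complex.I)) (C :=2*C2*N^(-2:ℝ)) (fun y hy => by
        rw [uIoc_of_le (by linarith)] at hy
        refine (h2 N hN0 y).2.trans ?_
        have hy' : |y| ≤ N := by rw [abs_of_pos (by linarith [hy.1])]; exact hy.2
        calc C2*(N + |y|)*N^(-3:ℝ) ≤ C2*(2*N)*N^(-3:ℝ) := by gcongr; linarith
          _=2*C2*(N^(1:ℝ)*N^(-3:ℝ)) := by rw [rpow_one]; ring
          _ = _ := by rw [← rpow_add hN0]; norm_num)
    refine this.trans ?_
    rw [abs_of_nonneg (by linarith)]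
    have hp :0 < N^(-2:ℝ) := by positivity
    have :2*C2*N^(-2:ℝ)*(N-yy n)≤2*C2*N^(-2:ℝ)*N := by gcongr; linarith
    rw [show 2*C2*yy n=2*C2*N^(-2:ℝ)*N by rw [← e2]; ring]; exact this
  have hL : ∃ g:ℝ, ∫ y in (yy n)..N, ff ((0:ℝ)+y*Complex.I) = g*Complex.I := by
    refine ⟨∫ y in (yy n)..N, (ff (y*Complex.I)).im, ?_⟩
    rw [← intervalIntegral.integral_ofReal, ← intervalIntegral.integral_mul_const]
    refine intervalIntegral.integral_congr fun y hy => ?_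
    rw [uIcc_of_le (by linarith)] at hy
    obtain ⟨g, hg⟩ := ff_axis (show 0 < y by linarith [hy.1])
    simp only [Complex.ofReal_zero, zero_add]
    rw [hg]; simp
  obtain ⟨g, hg⟩ := hL
  rw [hg] at hr
  have h3 : (∫ x in (0:ℝ)..N, ff (x+yy n*Complex.I)) = (∫ x in (0:ℝ)..N, ff (x+N*Complex.I))
      - Complex.I*(∫ y in (yy n)..N, ff (N+y*Complex.I))-(g:ℂ) := by
    simp only [smul_eq_mul] at hr
    linear_combination hr+(g:ℂ)*Complex.I_mul_I
  rw [h3, Complex.sub_im, Complex.ofReal_im, sub_zero]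
  refine (Complex.abs_im_le_norm _).trans ((norm_sub_le _ _).trans ?_)
  rw [norm_mul, Complex.norm_I, one_mul]; linarith
lemma ff0_im : ∫ t in Ioi (0:ℝ), (ff0 t).im=0 := by
  have h1 : (∫ t in Ioi (0:ℝ), ff0 t).im=0 := by
    obtain ⟨C, hC, h⟩ := rect_bd
    have hl := ((Complex.continuous_im.tendsto _).comp bottom_lim)
    refine tendsto_nhds_unique hl ?_
    refine squeeze_zero_norm (a := fun n => C*yy n) (fun n => h n) ?_
    simpa using yy_lim.const_mul C
  refine Eq.trans ?_ h1
  exact Complex.imCLM.integral_comp_comm ff0_int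
def pp (t:ℝ) : ℝ := I0 t*K0 t
def qq (t:ℝ) : ℝ := Ii t*K0 t-I0 t*Kk t
def ss (t:ℝ) : ℝ :=2*(t^2*pp t-Ii t*Kk t)
lemma pp_deriv {t:ℝ} (ht :0 < t) : HasDerivAt pp (qq t/t) t :=
  ((I0_deriv ht).mul (K0_deriv ht)).congr_deriv (by rw [qq]; field_simp; ring)
lemma qq_deriv {t:ℝ} (ht :0 < t) : HasDerivAt qq (ss t/t) t :=
  (((Ii_deriv t).mul (K0_deriv ht)).sub ((I0_deriv ht).mul (Kk_deriv ht))).congr_deriv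
    (by rw [ss, pp]; field_simp; ring)
lemma pp_pos {t:ℝ} (ht :0 < t) :0 < pp t :=
  mul_pos (by linarith [I0_ge_one t]) (K0_pos ht)
lemma pp_contOn : ContinuousOn pp (Ioi 0) := I0_cont.continuousOn.mul K0_contOn
lemma qq_contOn : ContinuousOn qq (Ioi 0) :=
  (Ii_cont.continuousOn.mul K0_contOn).sub (I0_cont.continuousOn.mul Kk_contOn)
lemma ss_contOn : ContinuousOn ss (Ioi 0) := by
  have := pp_contOn; have := Kk_contOn; have := Ii_cont.continuousOn (s := Ioi (0:ℝ))
  unfold ss; fun_prop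
lemma pq_bd : ∃ C:ℝ,0 < C ∧ ∀ t:ℝ,0 < t → pp t ≤ C*t^(-(1/4):ℝ) ∧ pp t ≤ C*t⁻¹ ∧
    |qq t| ≤ C*t^(-(1/4):ℝ) ∧ |qq t| ≤ C*t⁻¹ ∧ K0 t^2 ≤ C*t^(-(1/4):ℝ) := by
  obtain ⟨C, hC, h⟩ := Ph0_le
  refine ⟨C, hC, fun t ht => ?_⟩
  have hpi :1 ≤ π := by linarith [pi_gt_three]
  have i1 : (Ph0 t).im = π*pp t := by
    rw [Ph0, Complex.add_im, Complex.ofReal_im, Complex.im_ofReal_mul, Complex.I_im, pp]; ring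
  have i2 : (Ps0 t).im = π*qq t := by
    rw [Ps0, Complex.add_im, Complex.ofReal_im, Complex.im_ofReal_mul, Complex.I_im, qq]; ring
  have i3 : (Ph0 t).re = K0 t^2 := by
    rw [Ph0, Complex.add_re, Complex.ofReal_re, Complex.re_ofReal_mul, Complex.I_re]; ring
  have b1 : pp t ≤ ‖Ph0 t‖ := by
    have := Complex.abs_im_le_norm (Ph0 t)
    rw [i1, abs_of_pos (by have := pp_pos ht; positivity)] at this
    nlinarith [pp_pos ht]
  have b2 : |qq t| ≤ ‖Ps0 t‖ := by
    have := Complex.abs_im_le_norm (Ps0 t)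
    rw [i2, abs_mul, abs_of_pos pi_pos] at this
    nlinarith [abs_nonneg (qq t)]
  have b3 : K0 t^2 ≤ ‖Ph0 t‖ := by
    rw [← i3]; exact Complex.re_le_norm _
  obtain ⟨c1, c2⟩ := h t ht (1/8) (Or.inl rfl)
  obtain ⟨c3, c4⟩ := h t ht (1/2) (Or.inr rfl)
  rw [show -(2*(1/8)) = (-(1/4):ℝ) by norm_num] at c1 c2
  rw [show -(2*(1/2)) = (-1:ℝ) by norm_num, rpow_neg_one] at c3 c4
  exact ⟨b1.trans c1, b1.trans c3, b2.trans c2, b2.trans c4, b3.trans c1⟩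
lemma cube_bd0 {t:ℝ} (ht :0 < t) (h1 : t≤1) : t*(t^(-(1/4):ℝ))^3 ≤ t^(-(3/4):ℝ) := by
  rw [← rpow_natCast, ← rpow_mul ht.le]
  have :0 < t^(-(1/4)*((3:ℕ):ℝ)) := by positivity
  rw [show (-(3/4):ℝ) = -(1/4)*((3:ℕ):ℝ) by norm_num]
  nlinarith
lemma cube_bd1 {t:ℝ} (ht :0 < t) : t*(t⁻¹)^3 = t^(-2:ℝ) := by
  rw [rpow_neg ht.le, show (2:ℝ) = ((2:ℕ):ℝ) by norm_num, rpow_natCast]; field_simp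
lemma e1_int : IntegrableOn (fun t => t*pp t^3) (Ioi 0) := by
  obtain ⟨C, hC, h⟩ := pq_bd
  refine int_of_bounds (C := C^3) (continuousOn_id.mul (pp_contOn.pow 3)) ?_ ?_
  · intro t ht ht1
    have hp := pp_pos ht
    rw [abs_of_pos (by positivity)]
    calc t*pp t^3 ≤ t*(C*t^(-(1/4):ℝ))^3 := by gcongr; exact (h t ht).1
      _ = C^3*(t*(t^(-(1/4):ℝ))^3) := by ring
      _ ≤ _ := by gcongr; exact cube_bd0 ht ht1
  · intro t ht1
    have ht :0 < t := by linarith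
    have hp := pp_pos ht
    rw [abs_of_pos (by positivity)]
    calc t*pp t^3 ≤ t*(C*t⁻¹)^3 := by gcongr; exact (h t ht).2.1
      _ = C^3*(t*(t⁻¹)^3) := by ring
      _ = _ := by rw [cube_bd1 ht]
lemma e2_int : IntegrableOn (fun t => t*pp t*qq t^2) (Ioi 0) := by
  obtain ⟨C, hC, h⟩ := pq_bd
  refine int_of_bounds (C := C^3) ((continuousOn_id.mul pp_contOn).mul (qq_contOn.pow 2)) ?_ ?_
  · intro t ht ht1
    have hp := pp_pos ht
    rw [abs_of_nonneg (by positivity), ← sq_abs (qq t)]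
    calc t*pp t * |qq t|^2 ≤ t*(C*t^(-(1/4):ℝ))*(C*t^(-(1/4):ℝ))^2 := by
          gcongr; exact (h t ht).1; exact (h t ht).2.2.1
      _ = C^3*(t*(t^(-(1/4):ℝ))^3) := by ring
      _ ≤ _ := by gcongr; exact cube_bd0 ht ht1
  · intro t ht1
    have ht :0 < t := by linarith
    have hp := pp_pos ht
    rw [abs_of_nonneg (by positivity), ← sq_abs (qq t)]
    calc t*pp t * |qq t|^2 ≤ t*(C*t⁻¹)*(C*t⁻¹)^2 := by
          gcongr; exact (h t ht).2.1; exact (h t ht).2.2.2.1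
      _ = C^3*(t*(t⁻¹)^3) := by ring
      _ = _ := by rw [cube_bd1 ht]
lemma pow_le_exp (n:ℕ) {t:ℝ} (ht :0 ≤ t) : t^n*exp (-t) ≤ n.factorial := by
  have := pow_div_factorial_le_exp t ht n
  rw [div_le_iff₀ (by positivity)] at this
  calc t^n*exp (-t) ≤ exp t*n.factorial*exp (-t) := by gcongr
    _ = (exp t*exp (-t))*n.factorial := by ring
    _ = _ := by rw [← exp_add]; simp
lemma A_int : IntegrableOn (fun t => I0 t*(K0 t)^5*t*(1-8*t^2)) (Ioi 0) := by
  obtain ⟨C, hC, h⟩ := pq_bd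
  have ha := K0_contOn
  have hb := I0_cont.continuousOn (s := Ioi (0:ℝ))
  refine int_of_bounds (C :=9*C^3+9*C*16*120) (by fun_prop) ?_ ?_
  · intro t ht ht1
    have hp := pp_pos ht
    have hK := K0_pos ht
    have e : I0 t*(K0 t)^5*t*(1-8*t^2) = (t*pp t*(K0 t^2)^2)*(1-8*t^2) := by
      rw [pp]; ring
    have e9 : |1-8*t^2| ≤9 := by rw [abs_le]; constructor <;> nlinarith
    rw [e, abs_mul, abs_of_pos (by positivity)]
    calc t*pp t*(K0 t^2)^2 * |1-8*t^2| ≤ t*(C*t^(-(1/4):ℝ))*(C*t^(-(1/4):ℝ))^2*9 := by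
          gcongr; exact (h t ht).1; exact (h t ht).2.2.2.2
      _=9*C^3*(t*(t^(-(1/4):ℝ))^3) := by ring
      _ ≤ (9*C^3+9*C*16*120)*t^(-(3/4):ℝ) := by
        have := cube_bd0 ht ht1
        gcongr
        linarith [show 0<9*C*16*120 by positivity]
  · intro t ht1
    have ht :0 < t := by linarith
    have hp := pp_pos ht
    have hK := K0_pos ht
    have e : I0 t*(K0 t)^5*t*(1-8*t^2) = (pp t*K0 t^4)*(t*(1-8*t^2)) := by
      rw [pp]; ring
    have e9 : |t*(1-8*t^2)| ≤9*t^3 := by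
      rw [abs_le]; constructor <;> nlinarith [pow_pos ht 2, pow_pos ht 3, mul_pos ht (sub_pos.2 ht1)]
    have hC1 : pp t ≤ C := (h t ht).2.1.trans (by
      have : t⁻¹≤1 := inv_le_one_of_one_le₀ ht1.le
      nlinarith)
    have hKe := K0_le_exp ht1.le
    have h4 : K0 t^4≤16*exp (-t) := by
      calc K0 t^4 ≤ (2*exp (-t))^4 := by gcongr
        _=16*exp (-t)*exp (-t)^3 := by ring
        _≤16*exp (-t)*1 := by
          gcongr; exact pow_le_one₀ (exp_pos _).le (exp_le_one_iff.2 (by linarith))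
        _ = _ := by ring
    rw [e, abs_mul, abs_of_pos (by positivity)]
    have h5 := pow_le_exp 5 ht.le
    have h6 : t^3*exp (-t)≤120*t^(-2:ℝ) := by
      rw [rpow_neg ht.le, show (2:ℝ) = ((2:ℕ):ℝ) by norm_num, rpow_natCast, ← div_eq_mul_inv,
        le_div_iff₀ (by positivity)]
      have : ((5:ℕ).factorial:ℝ)=120 := by norm_num [Nat.factorial]
      rw [this] at h5
      linarith [show t^3*exp (-t)*t^2 = t^5*exp (-t) by ring]
    calc pp t*K0 t^4 * |t*(1-8*t^2)| ≤ C*(16*exp (-t))*(9*t^3) := by gcongr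
      _=9*C*16*(t^3*exp (-t)) := by ring
      _≤9*C*16*(120*t^(-2:ℝ)) := by gcongr
      _ ≤ _ := by
        have :0 < t^(-2:ℝ) := by positivity
        have :0 < C^3*t^(-2:ℝ) := by positivity
        linarith
def Z1 (t:ℝ) : ℝ :=24*t^2*I0 t*K0 t^4*Kk t+8*t^2*I0 t*K0 t^5-4*t^2*K0 t^4
lemma Z1_deriv {t:ℝ} (ht :0 < t) : HasDerivAt Z1 (3*(I0 t*(K0 t)^5*t*(1-8*t^2))
    - ((ff0 t).im/π+π^2*(-(13/3)*(t*pp t^3)+10*(t*pp t*qq t^2)))) t := by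
  have w := wron ht
  have hi : (ff0 t).im/π+π^2*(-(13/3)*(t*pp t^3)+10*(t*pp t*qq t^2))
      = t*(-13*I0 t*K0 t^5+10*(-4*Ii t*K0 t^4*Kk t+8*I0 t*K0 t^3*Kk t^2)) := by
    have : (ff0 t).im = π*t*(-13*I0 t*K0 t^5+10*(-4*Ii t*K0 t^4*Kk t
        + 8*I0 t*K0 t^3*Kk t^2))-π^3*(-(13/3)*(t*pp t^3)+10*(t*pp t*qq t^2)) := by
      have e : ff0 t = ((-(13/3)*t*((K0 t^2)^3-3*K0 t^2*(π*pp t)^2)+10*t*(K0 t^2 *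
          ((2*K0 t*Kk t)^2-(π*qq t)^2)-π*pp t*(2*(-(2*K0 t*Kk t))*(π*qq t))) : ℝ) : ℂ)
          + ((-(13/3)*t*(3*(K0 t^2)^2*(π*pp t)-(π*pp t)^3)+10*t*(K0 t^2 *
            (2*(-(2*K0 t*Kk t))*(π*qq t))+π*pp t*((2*K0 t*Kk t)^2-(π*qq t)^2)) : ℝ) : ℂ)
            * Complex.I := by
        rw [ff0, Ph0, Ps0, ← pp, ← qq]
        push_cast
        have hI := Complex.I_sq
        have hI3 : Complex.I^3 = -Complex.I := by rw [pow_succ, hI]; ring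
        ring_nf
        rw [hI3, hI]; ring
      rw [e]
      simp only [Complex.add_im, Complex.ofReal_im, Complex.mul_im, Complex.ofReal_re, Complex.I_im,
        Complex.I_re, mul_one, mul_zero, zero_add, add_zero]
      rw [qq, pp]; ring
    rw [this]; field_simp; ring
  rw [hi]
  have hK := K0_deriv ht
  have hI := I0_deriv ht
  have hk := Kk_deriv ht
  have h2 : HasDerivAt (fun t:ℝ => t^2) (2*t) t := by simpa using hasDerivAt_pow 2 t
  have := ((((h2.const_mul 24).mul hI).mul (hK.pow 4)).mul hk).add
    (((h2.const_mul 8).mul hI).mul (hK.pow 5)) |>.sub ((h2.const_mul 4).mul (hK.pow 4))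
  refine this.congr_deriv ?_
  simp only [Pi.mul_apply, Pi.pow_apply]
  field_simp
  push_cast
  linear_combination (8*K0 t^4-16*K0 t^3*Kk t)*w
lemma Z1_lim0 : Tendsto Z1 (𝓝[>] 0) (𝓝 0) := by
  have a := tK_lim' 4 (by norm_num)
  have b := tK_lim' 5 (by norm_num)
  have := ((((id_lim0.mul I0_lim).mul a).mul Kk_lim).const_mul 24).add
    (((id_lim0.mul I0_lim).mul b).const_mul 8) |>.sub ((id_lim0.mul a).const_mul 4)
  refine cl (this.congr fun t => ?_) (by simp)
  rw [Z1]; ring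
lemma texp_lim (n:ℕ) : Tendsto (fun t:ℝ => t^n*exp (-t)) atTop (𝓝 0) :=
  tendsto_pow_mul_exp_neg_atTop_nhds_zero n
lemma Z1_lim1 : Tendsto Z1 atTop (𝓝 0) := by
  obtain ⟨C, hC, h⟩ := pq_bd
  have hl := (texp_lim 2).const_mul (24*C*8+8*C*16+4*16)
  rw [mul_zero] at hl
  refine squeeze_zero_norm' ?_ hl
  filter_upwards [eventually_ge_atTop 1] with t ht1
  have ht :0 < t := by linarith
  have hp := pp_pos ht
  have hK := K0_pos ht
  have hk := Kk_nonneg ht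
  have hk1 := Kk_le_one ht
  have hKe := K0_le_exp ht1
  have hee : exp (-t)≤1 := exp_le_one_iff.2 (by linarith)
  have hC1 : pp t ≤ C := (h t ht).2.1.trans (by
      have : t⁻¹≤1 := inv_le_one_of_one_le₀ ht1
      nlinarith)
  have hpw : ∀ j:ℕ, K0 t^(j+1)≤2^(j+1)*exp (-t) := by
    intro j
    calc K0 t^(j+1) ≤ (2*exp (-t))^(j+1) := by gcongr
      _=2^(j+1)*exp (-t)*exp (-t)^j := by ring
      _≤2^(j+1)*exp (-t)*1 := by
        gcongr; exact pow_le_one₀ (exp_pos _).le hee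
      _ = _ := by ring
  have e : Z1 t=24*(t^2*pp t*K0 t^3*Kk t)+8*(t^2*pp t*K0 t^4)-4*(t^2*K0 t^4) := by
    rw [Z1, pp]; ring
  have b1 : t^2*pp t*K0 t^3*Kk t ≤ t^2*C*(8*exp (-t))*1 := by
    have := hpw 2; norm_num at this; gcongr
  have b2 : t^2*pp t*K0 t^4 ≤ t^2*C*(16*exp (-t)) := by
    have := hpw 3; norm_num at this; gcongr
  have b3 : t^2*K0 t^4 ≤ t^2*(16*exp (-t)) := by
    have := hpw 3; norm_num at this; gcongr
  have p1 :0 ≤ t^2*pp t*K0 t^3*Kk t := by positivity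
  have p2 :0 ≤ t^2*pp t*K0 t^4 := by positivity
  have p3 :0 ≤ t^2*K0 t^4 := by positivity
  have p4 :0 ≤ t^2*exp (-t) := by positivity
  have p5 :0 ≤ t^2*exp (-t)*C := by positivity
  rw [e, norm_eq_abs, abs_le]
  constructor <;> nlinarith
lemma A_eq1 :3*(∫ t in Ioi (0:ℝ), I0 t*(K0 t)^5*t*(1-8*t^2)) =
    π^2*(-(13/3)*(∫ t in Ioi (0:ℝ), t*pp t^3)+10 * ∫ t in Ioi (0:ℝ), t*pp t*qq t^2) := by
  have hff : IntegrableOn (fun t => (ff0 t).im/π) (Ioi 0) :=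
    (Complex.imCLM.integrable_comp ff0_int).div_const π
  have hE : IntegrableOn (fun t => π^2*(-(13/3)*(t*pp t^3)+10*(t*pp t*qq t^2))) (Ioi 0) :=
    ((e1_int.const_mul _).add (e2_int.const_mul _)).const_mul _
  have hS : IntegrableOn (fun t => (ff0 t).im/π+π^2*(-(13/3)*(t*pp t^3)+10*(t*pp t*qq t^2))) (Ioi 0) := hff.add hE
  have := ftc0 (fun t ht => Z1_deriv ht) ((A_int.const_mul 3).sub hS) Z1_lim0 Z1_lim1
  rw [integral_sub (A_int.const_mul 3) hS, integral_const_mul] at this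
  rw [integral_add hff hE, integral_div, ff0_im, integral_const_mul,
    integral_add (e1_int.const_mul _) (e2_int.const_mul _), integral_const_mul, integral_const_mul] at this
  rw [zero_div, zero_add, sub_zero, sub_eq_zero] at this; exact this
lemma ss_rel {t:ℝ} (ht :0 < t) :2*pp t*ss t = qq t^2+4*t^2*pp t^2-1 := by
  have w := wron ht
  rw [ss, qq, pp]
  linear_combination (-(Ii t*K0 t+I0 t*Kk t)-1)*w
def G3 (t:ℝ) : ℝ :=1/2*(qq t^3/3-qq t)+2*t^2*pp t^2*qq t-4/3*t^2*pp t^3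
lemma G3_deriv {t:ℝ} (ht :0 < t) : HasDerivAt G3 (pp t*ss t^2/t
    - (8/3*(t*pp t^3)-4*(t*pp t*qq t^2))) t := by
  have hr := ss_rel ht
  have hp := pp_deriv ht
  have hq := qq_deriv ht
  have h2 : HasDerivAt (fun t:ℝ => t^2) (2*t) t := by simpa using hasDerivAt_pow 2 t
  have := ((((hq.pow 3).div_const 3).sub hq).const_mul (1/2)).add
    (((h2.const_mul 2).mul (hp.pow 2)).mul hq) |>.sub ((h2.const_mul (4/3)).mul (hp.pow 3))
  refine this.congr_deriv ?_
  simp only [Pi.mul_apply, Pi.pow_apply]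
  field_simp
  push_cast
  linear_combination (-3*ss t)*hr
lemma pp_lim0 : Tendsto (fun t => t*pp t^3) (𝓝[>] 0) (𝓝 0) := by
  have := (I0_lim.pow 3).mul (tK_lim' 3 (by norm_num))
  refine cl (this.congr fun t => ?_) (by simp)
  rw [pp]; ring
lemma pp_lim0' : Tendsto (fun t => t*pp t^2) (𝓝[>] 0) (𝓝 0) := by
  have := (I0_lim.pow 2).mul (tK_lim' 2 (by norm_num))
  refine cl (this.congr fun t => ?_) (by simp)
  rw [pp]; ring
lemma qq_lim0 : Tendsto qq (𝓝[>] 0) (𝓝 (-1)) :=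
  cl (IiK_lim.sub (I0_lim.mul Kk_lim)) (by simp)
lemma qq_lim1 : Tendsto qq atTop (𝓝 0) := by
  obtain ⟨C, hC, h⟩ := pq_bd
  have hl := tendsto_inv_atTop_zero.const_mul C
  rw [mul_zero] at hl
  refine squeeze_zero_norm' ?_ hl
  filter_upwards [eventually_gt_atTop 0] with t ht
  exact (h t ht).2.2.2.1
lemma G3_lim0 : Tendsto G3 (𝓝[>] 0) (𝓝 (1/3)) := by
  have := ((((qq_lim0.pow 3).div_const 3).sub qq_lim0).const_mul (1/2)).add
    (((id_lim0.mul pp_lim0').mul qq_lim0).const_mul 2) |>.sub ((id_lim0.mul pp_lim0).const_mul (4/3))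
  refine cl (this.congr fun t => ?_) (by norm_num)
  rw [G3]; ring
lemma G3_lim1 : Tendsto G3 atTop (𝓝 0) := by
  obtain ⟨C, hC, h⟩ := pq_bd
  have b1 : Tendsto (fun t => t^2*pp t^2*qq t) atTop (𝓝 0) := by
    have hl := qq_lim1.abs.const_mul (C^2)
    rw [abs_zero, mul_zero] at hl
    refine squeeze_zero_norm' ?_ hl
    filter_upwards [eventually_gt_atTop 0] with t ht
    rw [norm_mul, norm_eq_abs, norm_eq_abs, abs_of_nonneg (by positivity)]
    have hb := (h t ht).2.1
    have hp := pp_pos ht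
    have : t*pp t ≤ C := by
      calc t*pp t ≤ t*(C*t⁻¹) := by gcongr
        _ = C := by field_simp
    have h0 :0 ≤ t*pp t := by positivity
    have : t^2*pp t^2 ≤ C^2 := by rw [← mul_pow]; gcongr
    gcongr
  have b2 : Tendsto (fun t => t^2*pp t^3) atTop (𝓝 0) := by
    have hl := tendsto_inv_atTop_zero.const_mul (C^3)
    rw [mul_zero] at hl
    refine squeeze_zero_norm' ?_ hl
    filter_upwards [eventually_gt_atTop 0] with t ht
    have hb := (h t ht).2.1
    have hp := pp_pos ht
    rw [norm_eq_abs, abs_of_nonneg (by positivity)]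
    calc t^2*pp t^3 ≤ t^2*(C*t⁻¹)^3 := by gcongr
      _ = _ := by field_simp
  have := ((((qq_lim1.pow 3).div_const 3).sub qq_lim1).const_mul (1/2)).add
    (b1.const_mul 2) |>.sub (b2.const_mul (4/3))
  refine cl (this.congr fun t => ?_) (by norm_num)
  rw [G3]; ring
lemma ps2_int : IntegrableOn (fun t => pp t*ss t^2/t) (Ioi 0) ∧
    ∫ t in Ioi (0:ℝ), pp t*ss t^2/t = -(1/3)+(8/3*(∫ t in Ioi (0:ℝ), t*pp t^3)
      - 4 * ∫ t in Ioi (0:ℝ), t*pp t*qq t^2) := by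
  have a := pp_contOn
  have b := qq_contOn
  have c := ss_contOn
  have := ftc0_nonneg (fun t ht => G3_deriv ht) (fun t ht => by have := pp_pos ht; positivity)
    ((a.mul (c.pow 2)).div continuousOn_id fun t ht => (mem_Ioi.1 ht).ne')
    ((e1_int.const_mul (8/3)).sub (e2_int.const_mul 4)) (by fun_prop) G3_lim0 G3_lim1
  refine ⟨this.1, ?_⟩
  rw [this.2, integral_sub (e1_int.const_mul (8/3)) (e2_int.const_mul 4), integral_const_mul,
    integral_const_mul]
  ring
def yI (t:ℝ) : ℝ := pp t*(t^2*I0 t^2-Ii t^2)*(Kk t^2-t^2*K0 t^2)/t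
def I33:ℝ := ∫ t in Ioi (0:ℝ), t*pp t^3
def YY:ℝ := ∫ t in Ioi (0:ℝ), yI t
lemma yI_eq {t:ℝ} (ht :0 < t) : yI t = t*pp t*qq t^2-1/4*(pp t*ss t^2/t) := by
  rw [yI, ss, qq, pp]; field_simp; ring
lemma yI_int : IntegrableOn yI (Ioi 0) :=
  (e2_int.sub (ps2_int.1.const_mul (1/4))).congr_fun (fun t ht => (yI_eq ht).symm) measurableSet_Ioi
lemma A_eq2 :3*(∫ t in Ioi (0:ℝ), I0 t*(K0 t)^5*t*(1-8*t^2)) =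
    π^2*(5*YY-I33-5/12) := by
  have hY : YY = (∫ t in Ioi (0:ℝ), t*pp t*qq t^2)-1/4 * ∫ t in Ioi (0:ℝ), pp t*ss t^2/t := by
    rw [YY, setIntegral_congr_fun measurableSet_Ioi (fun t ht => yI_eq (mem_Ioi.1 ht)),
      integral_sub e2_int (ps2_int.1.const_mul (1/4)), integral_const_mul]
  rw [A_eq1, hY, ps2_int.2, I33]; ring
section series
open PowerSeries
def fP : PowerSeries ℝ := PowerSeries.mk cI
def gP : PowerSeries ℝ := X*(derivative ℝ fP)
lemma coeff_delta (F : PowerSeries ℝ) (n:ℕ) : coeff n (X*derivative ℝ F) = n*coeff n F := by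
  cases n with
  | zero => simp
  | succ n => rw [coeff_succ_X_mul, coeff_derivative]; push_cast; ring
lemma gP_delta : X*derivative ℝ gP = X*fP := by
  ext n
  rw [coeff_delta, gP, coeff_delta, fP, coeff_mk]
  cases n with
  | zero => simp
  | succ n => rw [coeff_succ_X_mul, coeff_mk, ← cI_succ n]; push_cast; ring
def al (j n:ℕ) : ℝ := coeff n (fP^(3-j)*gP^j)
lemma al_r0 (n:ℕ) : n*al 0 n=3*al 1 n := by
  have h : X*derivative ℝ (fP^3) = C (3:ℝ)*(fP^2*gP) := by
    rw [derivative_pow, gP]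
    simp only [map_ofNat]; push_cast; ring
  have := congrArg (coeff n) h
  rw [coeff_delta, coeff_C_mul] at this
  simpa [al] using this
lemma al_r1 (n:ℕ) : n*al 1 n=2*al 2 n+coeff n (X*fP^3) := by
  have h : X*derivative ℝ (fP^2*gP) = C (2:ℝ)*(fP*gP^2)+X*fP^3 := by
    rw [Derivation.leibniz, derivative_pow]
    simp only [map_ofNat, smul_eq_mul]
    have := gP_delta
    have e : gP = X*derivative ℝ fP := rfl
    push_cast
    linear_combination fP^2*this-2*fP*gP*e
  have := congrArg (coeff n) h
  rw [coeff_delta, map_add, coeff_C_mul] at this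
  simpa [al] using this
lemma al_r2 (n:ℕ) : n*al 2 n = al 3 n+2*coeff n (X*(fP^2*gP)) := by
  have h : X*derivative ℝ (fP*gP^2) = gP^3+C (2:ℝ)*(X*(fP^2*gP)) := by
    rw [Derivation.leibniz, derivative_pow]
    simp only [map_ofNat, smul_eq_mul]
    have := gP_delta
    have e : gP = X*derivative ℝ fP := rfl
    push_cast
    linear_combination 2*fP*gP*this-gP^2*e
  have := congrArg (coeff n) h
  rw [coeff_delta, map_add, coeff_C_mul] at this
  simpa [al] using this
lemma al_r3 (n:ℕ) : n*al 3 n=3*coeff n (X*(fP*gP^2)) := by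
  have h : X*derivative ℝ (gP^3) = C (3:ℝ)*(X*(fP*gP^2)) := by
    rw [derivative_pow]
    simp only [map_ofNat]
    have := gP_delta
    push_cast
    linear_combination 3*gP^2*this
  have := congrArg (coeff n) h
  rw [coeff_delta, coeff_C_mul] at this
  simpa [al] using this
lemma al_s1 (n:ℕ) : (n+1)*al 1 (n+1)=2*al 2 (n+1)+al 0 n := by
  have := al_r1 (n+1)
  rw [coeff_succ_X_mul] at this
  push_cast at this; simpa [al] using this
lemma al_s2 (n:ℕ) : (n+1)*al 2 (n+1) = al 3 (n+1)+2*al 1 n := by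
  have := al_r2 (n+1)
  rw [coeff_succ_X_mul] at this
  push_cast at this; simpa [al] using this
lemma al_s3 (n:ℕ) : (n+1)*al 3 (n+1)=3*al 2 n := by
  have := al_r3 (n+1)
  rw [coeff_succ_X_mul] at this
  push_cast at this; simpa [al] using this
def ent (F : PowerSeries ℝ) (f:ℝ → ℝ) : Prop :=
  (∀ n,0 ≤ coeff n F) ∧ ∀ x, HasSum (fun n => coeff n F*x^n) (f x)
lemma ent.mul {F G : PowerSeries ℝ} {f g:ℝ → ℝ} (hF : ent F f) (hG : ent G g) :
    ent (F*G) (fun x => f x*g x) := by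
  refine ⟨fun n => ?_, fun x => ?_⟩
  · rw [coeff_mul]; exact Finset.sum_nonneg fun i _ => mul_nonneg (hF.1 _) (hG.1 _)
  · have sF := (hF.2 x).summable.norm
    have sG := (hG.2 x).summable.norm
    have e := tsum_mul_tsum_eq_tsum_sum_antidiagonal_of_summable_norm sF sG
    have hs := (summable_norm_sum_mul_antidiagonal_of_summable_norm sF sG).of_norm.hasSum
    rw [← e, (hF.2 x).tsum_eq, (hG.2 x).tsum_eq] at hs
    refine hs.congr_fun fun n => ?_
    rw [coeff_mul, Finset.sum_mul]
    refine Finset.sum_congr rfl fun i hi => ?_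
    rw [← Finset.HasAntidiagonal.mem_antidiagonal.1 hi, pow_add]; ring
lemma ent_fP : ent fP (ps cI) := by
  refine ⟨fun n => by rw [fP, coeff_mk]; exact (cI_pos n).le, fun x => ?_⟩
  simp only [fP, coeff_mk]
  exact ((cI_cb (|x|+1) (by positivity)).summable (by linarith [abs_nonneg x])).hasSum
lemma ent_gP : ent gP gI := by
  refine ⟨fun n => ?_, fun x => ?_⟩
  · rw [gP, coeff_delta, fP, coeff_mk]; have := cI_pos n; positivity
  · simp only [gP, coeff_delta, fP, coeff_mk]
    exact ((gI_cb (|x|+1) (by positivity)).summable (by linarith [abs_nonneg x])).hasSum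
end series
def an (n:ℕ) : ℝ := (n.factorial:ℝ)^2*al 0 n
lemma al_eq (n:ℕ) : al 0 n = an n*cI n := by
  rw [an, cI]; field_simp
lemma al_nonneg (n:ℕ) :0 ≤ al 0 n := by
  have := ((ent_fP.mul ent_fP).mul ent_fP).1 n
  rwa [show fP*fP*fP = fP^(3-0)*gP^0 by norm_num; ring] at this
lemma an_nonneg (n:ℕ) :0 ≤ an n := mul_nonneg (by positivity) (al_nonneg n)
lemma al_zero : al 0 0=1 ∧ al 1 0=0 ∧ al 2 0=0 ∧ al 3 0=0 := by
  simp [al, gP, fP, cI, PowerSeries.coeff_zero_eq_constantCoeff]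
lemma an_zero : an 0=1 := by rw [an, al_zero.1]; simp
lemma an_succ_eq (n:ℕ) : ((n:ℝ)+1)^2*al 0 (n+1) = an (n+1)*cI n := by
  rw [al_eq, ← cI_succ n]; ring
lemma al_diff (n:ℕ) : al 0 n-al 2 (n+1) = (9*an n-an (n+1))*cI n/6 := by
  have h0 := al_r0 (n+1)
  have h1 := al_s1 n
  have h2 := an_succ_eq n
  push_cast at h0
  have e := al_eq n
  linear_combination (3/2:ℝ)*e-h2/6+h1/2  + (n+1)*h0/6
lemma an_one : an 1=3 := by
  have h0 := al_r0 1
  have h1 := al_s1 0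
  have h2 := al_s2 0
  have h3 := al_s3 0
  obtain ⟨z0, z1, z2, z3⟩ := al_zero
  norm_num at h0 h1 h2 h3
  have : an 1 = al 0 1 := by simp [an]
  linarith
lemma an_rec (n:ℕ) : ((n:ℝ)+2)^2*an (n+2) =
    (10*((n:ℝ)+1)^2+10*((n:ℝ)+1)+3)*an (n+1)-9*((n:ℝ)+1)^2*an n := by
  have a0 := al_r0 (n+1)
  have b0 := al_r0 (n+2)
  have a1 := al_s1 n
  have b1 := al_s1 (n+1)
  have b2 := al_s2 (n+1)
  have b3 := al_s3 (n+1)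
  have e0 := al_eq n
  have e1 := an_succ_eq n
  have e2 := an_succ_eq (n+1)
  have c1 := cI_succ n
  have hc := cI_pos n
  rw [show n+1+1 = n+2 from rfl] at *
  push_cast at *
  rw [show (n:ℝ)+1+1 = n+2 by ring] at *
  have hN : ((n:ℝ)+1)^2≠0 := by positivity
  have key : ((n:ℝ)+2)^4*al 0 (n+2) = (3*((n:ℝ)+2)^2+4*((n:ℝ)+2)*((n:ℝ)+1)
    + 3*((n:ℝ)+1)^2)*al 0 (n+1)-9*al 0 n := by
    linear_combination ((n:ℝ)+2)^3*b0+3*((n:ℝ)+2)^2*b1 +  6*((n:ℝ)+2)*b2+6*b3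
      - (4*((n:ℝ)+2)+3*(n+1))*a0-9*a1
  have k2 : (((n:ℝ)+2)^2*an (n+2) -
    ((10*((n:ℝ)+1)^2+10*((n:ℝ)+1)+3)*an (n+1)-9*((n:ℝ)+1)^2*an n))*cI n=0 := by
    linear_combination ((n:ℝ)+1)^2*key-((n:ℝ)+2)^2*((n:ℝ)+1)^2*e2-((n:ℝ)+2)^2*an (n+2)*c1
      + (10*((n:ℝ)+1)^2+10*((n:ℝ)+1)+3)*e1-9*((n:ℝ)+1)^2*e0
  rcases mul_eq_zero.1 k2 with h | h
  · linarith
  · exact absurd h hc.ne'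
lemma an_le (n:ℕ) : an (n+1)≤9*an n := by
  induction n with
  | zero => rw [an_zero, an_one]; norm_num
  | succ n ih =>
    have h := an_rec n
    have p := an_nonneg (n+1)
    have hn : (0:ℝ) ≤ n := Nat.cast_nonneg n
    have h2 : ((n:ℝ)+2)^2*an (n+2) ≤ ((n:ℝ)+2)^2*(9*an (n+1)) := by
      rw [h]
      have := mul_le_mul_of_nonneg_left ih (show 0 ≤ ((n:ℝ)+1)^2 by positivity)
      nlinarith [mul_nonneg hn p]
    exact le_of_mul_le_mul_left h2 (by positivity)
lemma an_le_pow (n:ℕ) : an n≤9^n := by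
  induction n with
  | zero => simp [an_zero]
  | succ n ih => rw [pow_succ]; linarith [an_le n]
lemma I0_cube (t:ℝ) : HasSum (fun n => an n*(t^(2*n)*cI n/4^n)) (I0 t^3) := by
  have h := ((ent_fP.mul ent_fP).mul ent_fP).2 (t^2/4)
  rw [show fP*fP*fP = fP^(3-0)*gP^0 by norm_num; ring] at h
  simp only [← I0_eq] at h
  rw [show I0 t^3 = I0 t*I0 t*I0 t by ring]
  refine h.congr_fun fun n => ?_
  rw [← al, al_eq, div_pow, ← pow_mul]; ring
lemma I0_cube2 (t:ℝ) : HasSum (fun n => (9*an n-an (n+1))*(t^(2*n)*t^2*cI n/4^n/6))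
    (I0 t*(t^2*I0 t^2-Ii t^2)) := by
  have h := ((ent_fP.mul ent_gP).mul ent_gP).2 (t^2/4)
  rw [show fP*gP*gP = fP^(3-2)*gP^2 by norm_num; ring] at h
  simp only [← I0_eq] at h
  change HasSum (fun n => al 2 n*_) _ at h
  rw [← hasSum_nat_add_iff' 1] at h
  simp only [Finset.sum_range_one, al_zero.2.2.1, zero_mul, sub_zero] at h
  have h3 := ((I0_cube t).mul_left (t^2)).sub (h.mul_left 4)
  rw [show I0 t*(t^2*I0 t^2-Ii t^2) = t^2*I0 t^3-4*(I0 t*gI (t^2/4)*gI (t^2/4)) by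
    rw [Ii]; ring]
  refine h3.congr_fun fun n => ?_
  have e := al_diff n
  have e2 := al_eq n
  have e4 : (t^2/4)^(n+1) = t^(2*n)*t^2/4^n/4 := by rw [div_pow, ← pow_mul]; ring
  rw [e4]
  linear_combination (-e+e2)*(t^(2*n)*t^2/4^n)
lemma tK0_le {t:ℝ} (ht :0 < t) : t*K0 t ≤ Kk t := by
  have h1 : Kk t = t*K0 t+exp (-t)*kR (1/2) t := by rw [Kk_eq_kR ht, K0_eq_kR ht]; ring
  have := kR_nonneg (1/2) ht
  have := exp_pos (-t)
  rw [h1]; nlinarith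
def mi (j s:ℕ) (t:ℝ) : ℝ := t^s*(K0 t^(3-j)*Kk t^j)
lemma mi_bd {j s:ℕ} (hj : j≤3) {t:ℝ} (ht :1 ≤ t) : mi j s t≤27*(t^(s+3)*exp (-t)) := by
  have h1 := K0_le_exp ht
  have h2 := Kk_le_exp ht
  have hk := K0_pos (by linarith :0 < t)
  have hk2 := Kk_nonneg (t := t) (by linarith)
  have he := exp_pos (-t)
  have he1 : exp (-t)≤1 := by rw [exp_le_one_iff]; linarith
  have h3 : K0 t≤3*t*exp (-t) := h1.trans (by nlinarith)
  calc mi j s t ≤ t^s*((3*t*exp (-t))^(3-j)*(3*t*exp (-t))^j) := by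
        unfold mi; gcongr
    _=27*(t^(s+3)*(exp (-t)*(exp (-t)*exp (-t)))) := by
        rw [← pow_add, Nat.sub_add_cancel hj]; ring
    _ ≤ _ := by
        gcongr; nlinarith
lemma mi_nonneg (j s:ℕ) {t:ℝ} (ht :0 < t) :0 ≤ mi j s t := by
  have hk := K0_pos ht
  have hk2 := Kk_nonneg ht
  unfold mi; positivity
lemma mi_cont (j s:ℕ) : ContinuousOn (mi j s) (Ioi 0) := by
  have := K0_contOn
  have := Kk_contOn
  unfold mi; fun_prop
lemma mi_int {j s:ℕ} (hj : j≤3) (hs :1 ≤ s) : IntegrableOn (mi j s) (Ioi 0) := by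
  set D :=1+Real.Gamma (1/4) with hD
  have hG :0 < Real.Gamma (1/4) := Real.Gamma_pos_of_pos (by norm_num)
  refine int_of_bounds (C := D^3+27*(s+5).factorial) (mi_cont j s) ?_ ?_
  · intro t ht ht1
    have hk := K0_pos ht
    have hk2 := Kk_nonneg ht
    have hk3 := Kk_le_one ht
    rw [abs_of_nonneg (mi_nonneg j s ht)]
    have h1 : (1:ℝ) ≤ t^(-(1/4):ℝ) := Real.one_le_rpow_of_pos_of_le_one_of_nonpos ht ht1 (by norm_num)
    have hb : K0 t ≤ D*t^(-(1/4):ℝ) := by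
      refine (K0_le ht (δ :=1/4) (by norm_num) (by norm_num)).trans ?_
      have : exp (-t)≤1 := by rw [exp_le_one_iff]; linarith
      calc _ ≤ Real.Gamma (1/4)*t^(-(1/4):ℝ)*1 := by gcongr
        _ ≤ _ := by rw [hD]; nlinarith
    have hD1 :1 ≤ D*t^(-(1/4):ℝ) := by nlinarith
    calc mi j s t ≤ t^1*((D*t^(-(1/4):ℝ))^(3-j)*1) := by
          unfold mi
          have : t^s ≤ t^1 := pow_le_pow_of_le_one ht.le ht1 hs
          have : Kk t^j≤1 := pow_le_one₀ hk2 hk3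
          gcongr
      _ ≤ t^1*((D*t^(-(1/4):ℝ))^3*1) := by
          gcongr
          omega
      _ = D^3*(t*(t^(-(1/4):ℝ))^3) := by ring
      _ ≤ D^3*t^(-(3/4):ℝ) := by gcongr; exact cube_bd0 ht ht1
      _ ≤ _ := by gcongr; linarith [show (0:ℝ)≤27*(s+5).factorial by positivity]
  · intro t ht
    have ht0 :0 < t := by linarith
    rw [abs_of_nonneg (mi_nonneg j s ht0)]
    refine (mi_bd hj ht.le).trans ?_
    have := pow_le_exp (s+5) ht0.le
    rw [Real.rpow_neg ht0.le, show (2:ℝ) = ((2:ℕ):ℝ) by norm_num, Real.rpow_natCast, ← div_eq_mul_inv,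
      le_div_iff₀ (by positivity)]
    calc _=27*(t^(s+5)*exp (-t)) := by push_cast; ring
      _≤27*(s+5).factorial := by gcongr
      _ ≤ _ := by push_cast; linarith [show 0 ≤ D^3 by positivity]
lemma mi_lim0 {j s:ℕ} (hs :1 ≤ s) : Tendsto (mi j s) (𝓝[>] 0) (𝓝 0) := by
  refine squeeze_zero' ?_ ?_ (tK_lim' (3-j) (by omega))
  · filter_upwards [self_mem_nhdsWithin] with t ht using mi_nonneg j s ht
  · filter_upwards [Ioo_mem_nhdsGT (zero_lt_one' ℝ)] with t ht
    have hk := K0_pos ht.1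
    have hk2 := Kk_nonneg ht.1
    have hk3 := Kk_le_one ht.1
    have ht0 := ht.1
    calc mi j s t ≤ t^1*(K0 t^(3-j)*1) := by
          unfold mi
          have : t^s ≤ t^1 := pow_le_pow_of_le_one ht.1.le ht.2.le hs
          have : Kk t^j≤1 := pow_le_one₀ hk2 hk3
          gcongr
      _ = _ := by ring
lemma mi_lim1 {j s:ℕ} (hj : j≤3) : Tendsto (mi j s) atTop (𝓝 0) := by
  have h := (texp_lim (s+3)).const_mul 27
  rw [mul_zero] at h
  refine squeeze_zero' ?_ ?_ h
  · filter_upwards [eventually_gt_atTop 0] with t ht using mi_nonneg j s ht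
  · filter_upwards [eventually_ge_atTop 1] with t ht using mi_bd hj ht
def Mm (j s:ℕ) : ℝ := ∫ t in Ioi (0:ℝ), mi j s t
lemma Mm_r0 {s:ℕ} (hs :1 ≤ s) : (s+1)*Mm 0 s=3*Mm 1 s := by
  have := ftc0 (G := mi 0 (s+1)) (g := fun t => (s+1)*mi 0 s t-3*mi 1 s t) ?_
    (((mi_int (by norm_num) hs).const_mul _).sub ((mi_int (by norm_num) hs).const_mul _))
    (mi_lim0 (by omega)) (mi_lim1 (by norm_num))
  · rw [integral_sub ((mi_int (by norm_num) hs).const_mul _) ((mi_int (by norm_num) hs).const_mul _),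
      integral_const_mul, integral_const_mul] at this
    simp only [Mm]; linarith
  · intro t ht
    have := (hasDerivAt_pow (s+1) t).mul (((K0_deriv ht).pow 3).mul ((Kk_deriv ht).pow 0))
    refine this.congr_deriv ?_
    simp only [Pi.mul_apply, Pi.pow_apply, mi]
    norm_num
    field_simp
    ring
lemma Mm_r1 {s:ℕ} (hs :1 ≤ s) : (s+1)*Mm 1 s=2*Mm 2 s+Mm 0 (s+2) := by
  have i1 := mi_int (j :=1) (by norm_num) hs
  have i2 := mi_int (j :=2) (by norm_num) hs
  have i0 := mi_int (j :=0) (s := s+2) (by norm_num) (by omega)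
  have iS : IntegrableOn (fun t => 2*mi 2 s t+mi 0 (s+2) t) (Ioi 0) := (i2.const_mul 2).add i0
  have := ftc0 (G := mi 1 (s+1)) (g := fun t => (s+1)*mi 1 s t-(2*mi 2 s t+mi 0 (s+2) t)) ?_
    ((i1.const_mul _).sub iS) (mi_lim0 (by omega)) (mi_lim1 (by norm_num))
  · rw [integral_sub (i1.const_mul _) iS, integral_add (i2.const_mul 2) i0,
      integral_const_mul, integral_const_mul] at this
    simp only [Mm]; linarith
  · intro t ht
    have := (hasDerivAt_pow (s+1) t).mul (((K0_deriv ht).pow 2).mul ((Kk_deriv ht).pow 1))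
    refine this.congr_deriv ?_
    simp only [Pi.mul_apply, Pi.pow_apply, mi]
    norm_num
    field_simp
    ring
lemma Mm_r2 {s:ℕ} (hs :1 ≤ s) : (s+1)*Mm 2 s = Mm 3 s+2*Mm 1 (s+2) := by
  have i1 := mi_int (j :=2) (by norm_num) hs
  have i2 := mi_int (j :=3) (by norm_num) hs
  have i0 := mi_int (j :=1) (s := s+2) (by norm_num) (by omega)
  have iS : IntegrableOn (fun t => mi 3 s t+2*mi 1 (s+2) t) (Ioi 0) := i2.add (i0.const_mul 2)
  have := ftc0 (G := mi 2 (s+1)) (g := fun t => (s+1)*mi 2 s t-(mi 3 s t+2*mi 1 (s+2) t)) ?_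
    ((i1.const_mul _).sub iS) (mi_lim0 (by omega)) (mi_lim1 (by norm_num))
  · rw [integral_sub (i1.const_mul _) iS, integral_add i2 (i0.const_mul 2),
      integral_const_mul, integral_const_mul] at this
    simp only [Mm]; linarith
  · intro t ht
    have := (hasDerivAt_pow (s+1) t).mul (((K0_deriv ht).pow 1).mul ((Kk_deriv ht).pow 2))
    refine this.congr_deriv ?_
    simp only [Pi.mul_apply, Pi.pow_apply, mi]
    norm_num
    field_simp
    ring
lemma Mm_r3 {s:ℕ} (hs :1 ≤ s) : (s+1)*Mm 3 s=3*Mm 2 (s+2) := by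
  have i1 := mi_int (j :=3) (by norm_num) hs
  have i0 := mi_int (j :=2) (s := s+2) (by norm_num) (by omega)
  have := ftc0 (G := mi 3 (s+1)) (g := fun t => (s+1)*mi 3 s t-3*mi 2 (s+2) t) ?_
    ((i1.const_mul _).sub (i0.const_mul _)) (mi_lim0 (by omega)) (mi_lim1 (by norm_num))
  · rw [integral_sub (i1.const_mul _) (i0.const_mul _),
      integral_const_mul, integral_const_mul] at this
    simp only [Mm]; linarith
  · intro t ht
    have := (hasDerivAt_pow (s+1) t).mul (((K0_deriv ht).pow 0).mul ((Kk_deriv ht).pow 3))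
    refine this.congr_deriv ?_
    simp only [Pi.mul_apply, Pi.pow_apply, mi]
    norm_num
    ring
def mn (n:ℕ) : ℝ := Mm 0 (2*n+1)*cI n/4^n
lemma Mm_diff (n:ℕ) : (Mm 2 (2*n+1)-Mm 0 (2*n+3))*cI n/4^n =
    (2/3)*((n:ℝ)+1)^2*(mn n-9*mn (n+1)) := by
  have h0 := Mm_r0 (s :=2*n+1) (by omega)
  have h1 := Mm_r1 (s :=2*n+1) (by omega)
  rw [show 2*n+1+2=2*n+3 from rfl] at h1
  push_cast at h0 h1
  rw [mn, mn, show 2*(n+1)+1=2*n+3 from rfl, ← cI_succ n]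
  have h4 : (4:ℝ)^n≠0 := by positivity
  have key : Mm 2 (2*n+1)-Mm 0 (2*n+3) = (4*((n:ℝ)+1)^2*Mm 0 (2*n+1)-9*Mm 0 (2*n+3))/6 := by
    linear_combination (-1/2)*h1-((n:ℝ)+1)/3* h0
  rw [key, pow_succ (4:ℝ) n]
  field_simp
  ring
lemma mn_rec (n:ℕ) : ((n:ℝ)+1)^2*mn n-(10*((n:ℝ)+1)^2+10*((n:ℝ)+1)+3)*mn (n+1)
    + 9*((n:ℝ)+2)^2*mn (n+2)=0 := by
  have h0 := Mm_r0 (s :=2*n+1) (by omega)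
  have h1 := Mm_r1 (s :=2*n+1) (by omega)
  have h2 := Mm_r2 (s :=2*n+1) (by omega)
  have h3 := Mm_r3 (s :=2*n+1) (by omega)
  have g0 := Mm_r0 (s :=2*n+3) (by omega)
  have g1 := Mm_r1 (s :=2*n+3) (by omega)
  rw [show 2*n+1+2=2*n+3 from rfl] at h1 h2 h3
  rw [show 2*n+3+2=2*n+5 from rfl] at g1
  push_cast at *
  rw [mn, mn, mn, show 2*(n+1)+1=2*n+3 from rfl, show 2*(n+2)+1=2*n+5 from rfl, ← cI_succ n,
    ← cI_succ (n+1), pow_succ, pow_succ, pow_succ]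
  push_cast
  have key : ((n:ℝ)+1)^4*Mm 0 (2*n+1)-(10*((n:ℝ)+1)^2+10*((n:ℝ)+1)+3)/4*Mm 0 (2*n+3)
      + 9/16*Mm 0 (2*n+5)=0 := by
    linear_combination (3/8)*((4/3)*((n:ℝ)+1)^3*h0+2*((n:ℝ)+1)^2*h1+2*((n:ℝ)+1)*h2+h3-(3/2)*g1-(4*((n:ℝ)+1)+3*(n+2))/3*g0)
  simp only [div_eq_mul_inv, mul_inv] at key ⊢
  linear_combination key*(((n:ℝ)+2)^2*cI (n+2)*(4^n)⁻¹)
lemma tonelli {F:ℕ → ℝ → ℝ} {f:ℝ → ℝ} (hF : ∀ n, ContinuousOn (F n) (Ioi 0))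
    (h0 : ∀ n t,0 < t → 0 ≤ F n t) (hs : ∀ t,0 < t → HasSum (fun n => F n t) (f t))
    (hf : IntegrableOn f (Ioi 0)) : HasSum (fun n => ∫ t in Ioi (0:ℝ), F n t) (∫ t in Ioi (0:ℝ), f t) := by
  have ae : ∀ {p:ℝ → Prop}, (∀ t,0 < t → p t) → ∀ᵐ t ∂(volume.restrict (Ioi (0:ℝ))), p t :=
    fun h => (ae_restrict_iff' measurableSet_Ioi).2 (Eventually.of_forall fun t ht => h t ht)
  refine hasSum_integral_of_dominated_convergence F
    (fun n => (hF n).aestronglyMeasurable measurableSet_Ioi) (fun n => ae fun t ht => ?_)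
    (ae fun t ht => (hs t ht).summable) ?_ (ae hs)
  · rw [norm_eq_abs, abs_of_nonneg (h0 n t ht)]
  · exact hf.congr (ae fun t ht => (hs t ht).tsum_eq.symm)
lemma I33_sum : HasSum (fun n => an n*mn n) I33 := by
  have h := tonelli (F := fun n t => an n*(cI n/4^n)*mi 0 (2*n+1) t) (f := fun t => t*pp t^3)
    (fun n => continuousOn_const.mul (mi_cont _ _))
    (fun n t ht => by
      have := an_nonneg n; have := cI_pos n; have := mi_nonneg 0 (2*n+1) ht; positivity)
    (fun t ht => by
      have := (I0_cube t).mul_left (t*K0 t^3)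
      rw [show t*pp t^3 = t*K0 t^3*I0 t^3 by rw [pp]; ring]
      refine this.congr_fun fun n => ?_
      rw [mi]; norm_num; ring) e1_int
  rw [I33]
  refine h.congr_fun fun n => ?_
  rw [integral_const_mul, mn, Mm]; ring
lemma YY_sum : HasSum (fun n:ℕ => (1/9)*((n:ℝ)+1)^2*(9*an n-an (n+1))*(mn n-9*mn (n+1))) YY := by
  have h := tonelli (F := fun n t => (9*an n-an (n+1))*(cI n/4^n/6)*(mi 2 (2*n+1) t-mi 0 (2*n+3) t))
    (f := yI) (fun n => continuousOn_const.mul ((mi_cont _ _).sub (mi_cont _ _)))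
    (fun n t ht => by
      have := an_le n; have := cI_pos n
      refine mul_nonneg (mul_nonneg (by linarith) (by positivity)) ?_
      have hk := K0_pos ht
      have := tK0_le ht
      have e : mi 2 (2*n+1) t-mi 0 (2*n+3) t = t^(2*n+1)*K0 t*(Kk t^2-(t*K0 t)^2) := by
        rw [mi, mi]; norm_num; ring
      rw [e]
      have : (t*K0 t)^2 ≤ Kk t^2 := by gcongr
      exact mul_nonneg (by positivity) (by linarith))
    (fun t ht => by
      have := (I0_cube2 t).mul_left (K0 t*(Kk t^2-t^2*K0 t^2)/t)
      rw [show yI t = K0 t*(Kk t^2-t^2*K0 t^2)/t*(I0 t*(t^2*I0 t^2-Ii t^2)) by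
        rw [yI, pp]; ring]
      refine this.congr_fun fun n => ?_
      rw [mi, mi]; norm_num; field_simp; ring) yI_int
  rw [YY]
  refine h.congr_fun fun n => ?_
  have e := Mm_diff n
  rw [integral_const_mul, integral_sub (mi_int (by norm_num) (by omega)) (mi_int (by norm_num) (by omega))]
  change _ = _*(Mm 2 (2*n+1)-Mm 0 (2*n+3))
  linear_combination (-(9*an n-an (n+1))/6)*e
def kap:ℝ := √π^3*2^(-(3/2):ℝ)
lemma K3_bd {t:ℝ} (ht :0 < t) : kap*t^(-(3/2):ℝ)*exp (-(3*t))*(1-3/(8*t)) ≤ K0 t^3 ∧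
    K0 t^3 ≤ kap*t^(-(3/2):ℝ)*exp (-(3*t)) := by
  set w := (2*t)^(-(1/2):ℝ)*√π*exp (-t) with hw
  have hwp :0 < w := by positivity
  have e : kap*t^(-(3/2):ℝ)*exp (-(3*t)) = w^3 := by
    have e1 : (2*t)^(-(3/2):ℝ) = ((2*t)^(-(1/2):ℝ))^3 := by
      rw [← Real.rpow_natCast, ← Real.rpow_mul (by positivity)]; norm_num
    have e2 : exp (-(3*t)) = exp (-t)^3 := by rw [← Real.exp_nat_mul]; congr 1; push_cast; ring
    rw [hw, mul_pow, mul_pow, ← e1, ← e2, kap, Real.mul_rpow (by norm_num) ht.le]; ring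
  have hu : K0 t ≤ w := by
    rw [K0_eq_kR ht, hw]
    have := kR_le ht (δ :=1/2) (by norm_num) le_rfl
    rw [Real.Gamma_one_half_eq] at this
    have he := exp_pos (-t)
    nlinarith
  have hl : w*(1-1/(8*t)) ≤ K0 t := by
    rw [K0_eq_kR ht, hw]
    have := kR_ge ht
    have he := exp_pos (-t)
    nlinarith
  have hk := K0_pos ht
  rw [e]
  refine ⟨?_, by gcongr⟩
  set x :=1/(8*t) with hx
  have hx0 :0 < x := by positivity
  rw [show 3/(8*t)=3*x by rw [hx]; ring]
  by_cases h1 : x≤1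
  · calc w^3*(1-3*x) ≤ w^3*(1-x)^3 := by
          gcongr; nlinarith [mul_nonneg (mul_nonneg hx0.le hx0.le) (show 0≤3-x by linarith)]
      _ = (w*(1-x))^3 := by ring
      _ ≤ _ := by
        have :0 ≤ w*(1-x) := mul_nonneg hwp.le (by linarith)
        gcongr
  · have : w^3*(1-3*x)≤0 := mul_nonpos_of_nonneg_of_nonpos (by positivity) (by linarith)
    exact this.trans (by positivity)
lemma gi_int {a:ℝ} (ha :0 < a) : IntegrableOn (fun t:ℝ => t^(a-1)*exp (-(3*t))) (Ioi 0) := by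
  have := integrableOn_rpow_mul_exp_neg_mul_rpow (p :=1) (s := a-1) (b :=3) (by linarith) one_pos (by norm_num)
  simpa using this
lemma Gam_ris (n:ℕ) : Real.Gamma (2*n+1/2) = √π*4^n*(ris (1/4) n*ris (1-1/4) n) := by
  induction n with
  | zero => rw [ris_zero, ris_zero, ← Real.Gamma_one_half_eq]; norm_num
  | succ n ih =>
    rw [ris_succ, ris_succ]
    have hn : (0:ℝ) ≤ n := Nat.cast_nonneg n
    rw [show (2*((n+1:ℕ):ℝ)+1/2) = ((2*n+1/2)+1)+1 by push_cast; ring, Real.Gamma_add_one (by positivity),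
      Real.Gamma_add_one (by positivity), ih]
    ring
def un (n:ℕ) : ℝ := kap*(1/3)^((1:ℝ)/2)*√π*(ris (1/4) n*ris (1-1/4) n/(n.factorial:ℝ)^2)
lemma un_eq (n:ℕ) : kap*((1/3)^(2*(n:ℝ)+1/2)*Real.Gamma (2*n+1/2))*cI n/4^n*9^n = un n := by
  rw [Gam_ris, Real.rpow_add (by norm_num), un, cI]
  have : ((1:ℝ)/3)^(2*(n:ℝ))=1/9^n := by
    rw [show 2*(n:ℝ) = ((2*n:ℕ):ℝ) by push_cast; ring, Real.rpow_natCast, pow_mul, one_div, one_div, ← inv_pow]; norm_num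
  rw [this]
  field_simp
lemma mn_up (n:ℕ) :9^n*mn n ≤ un n := by
  have ha : (0:ℝ)<2*n+1/2 := by positivity
  have h : Mm 0 (2*n+1) ≤ kap*((1/3)^(2*(n:ℝ)+1/2)*Real.Gamma (2*n+1/2)) := by
    rw [← Real.integral_rpow_mul_exp_neg_mul_Ioi ha (by norm_num : (0:ℝ)<3), ← integral_const_mul, Mm]
    refine setIntegral_mono_on (mi_int (by norm_num) (by omega)) ((gi_int ha).const_mul _) measurableSet_Ioi
      fun t ht => ?_
    have ht :0 < t := ht
    have hb := (K3_bd ht).2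
    calc mi 0 (2*n+1) t = t^(2*n+1)*K0 t^3 := by rw [mi]; norm_num
      _ ≤ t^(2*n+1)*(kap*t^(-(3/2):ℝ)*exp (-(3*t))) := by gcongr
      _ = _ := by
        have : t^(2*(n:ℝ)+1/2-1) = t^(2*n+1)*t^(-(3/2):ℝ) := by
          rw [← Real.rpow_natCast t (2*n+1), ← Real.rpow_add ht]; congr 1; push_cast; ring
        rw [this]; ring
  have := cI_pos n
  rw [← un_eq, mn]
  calc 9^n*(Mm 0 (2*n+1)*cI n/4^n) = Mm 0 (2*n+1)*cI n/4^n*9^n := by ring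
    _ ≤ _ := by gcongr
lemma mn_low {n:ℕ} (hn :1 ≤ n) : un n*(1-(9/8)/(2*n-1/2))≤9^n*mn n := by
  have hn' : (1:ℝ) ≤ n := by exact_mod_cast hn
  have ha : (0:ℝ)<2*n+1/2 := by positivity
  have hb : (0:ℝ)<2*n-1/2 := by linarith
  have hG : Real.Gamma (2*n-1/2) = Real.Gamma (2*n+1/2)/(2*n-1/2) := by
    rw [show (2*(n:ℝ)+1/2) = (2*n-1/2)+1 by ring, Real.Gamma_add_one hb.ne', mul_div_cancel_left₀ _ hb.ne']
  have h3 : ((1:ℝ)/3)^(2*(n:ℝ)-1/2) = (1/3)^(2*(n:ℝ)+1/2)*3 := by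
    rw [show (2*(n:ℝ)+1/2) = (2*n-1/2)+1 by ring, Real.rpow_add (by norm_num), Real.rpow_one]; ring
  have i1 := (gi_int ha).const_mul kap
  have i2 := (gi_int hb).const_mul (kap*(3/8))
  have h : kap*((1/3)^(2*(n:ℝ)+1/2)*Real.Gamma (2*n+1/2))*(1-(9/8)/(2*n-1/2)) ≤ Mm 0 (2*n+1) := by
    have e : kap*((1/3)^(2*(n:ℝ)+1/2)*Real.Gamma (2*n+1/2))*(1-(9/8)/(2*n-1/2)) =
        kap*((1/3)^(2*(n:ℝ)+1/2)*Real.Gamma (2*n+1/2)) -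
        kap*(3/8)*((1/3)^(2*(n:ℝ)-1/2)*Real.Gamma (2*n-1/2)) := by
      rw [hG, h3]; ring
    rw [e, ← Real.integral_rpow_mul_exp_neg_mul_Ioi ha (by norm_num : (0:ℝ)<3),
      ← Real.integral_rpow_mul_exp_neg_mul_Ioi hb (by norm_num : (0:ℝ)<3), ← integral_const_mul,
      ← integral_const_mul, ← integral_sub i1 i2, Mm]
    refine setIntegral_mono_on (i1.sub i2) (mi_int (by norm_num) (by omega)) measurableSet_Ioi
      fun t ht => ?_
    have ht :0 < t := ht
    have hb := (K3_bd ht).1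
    calc _ = t^(2*n+1)*(kap*t^(-(3/2):ℝ)*exp (-(3*t))*(1-3/(8*t))) := by
          have e1 : t^(2*(n:ℝ)+1/2-1) = t^(2*n+1)*t^(-(3/2):ℝ) := by
            rw [← Real.rpow_natCast t (2*n+1), ← Real.rpow_add ht]; congr 1; push_cast; ring
          have e2 : t^(2*(n:ℝ)-1/2-1) = t^(2*n+1)*t^(-(3/2):ℝ)/t := by
            rw [← e1, show (2*(n:ℝ)+1/2-1) = (2*n-1/2-1)+1 by ring, Real.rpow_add ht, Real.rpow_one]
            field_simp
          rw [e1, e2]; field_simp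
      _ ≤ t^(2*n+1)*K0 t^3 := by gcongr
      _ = mi 0 (2*n+1) t := by rw [mi]; norm_num
  have := cI_pos n
  rw [← un_eq, mn]
  calc _ = kap*((1/3)^(2*(n:ℝ)+1/2)*Real.Gamma (2*n+1/2))*(1-(9/8)/(2*n-1/2))*cI n/4^n*9^n := by ring
    _ ≤ Mm 0 (2*n+1)*cI n/4^n*9^n := by gcongr
    _ = _ := by ring
lemma un_lim : Tendsto (fun n:ℕ => n*un n) atTop (𝓝 (π/(4*√3))) := by
  have h := (ris_lim (a :=1/4) (by norm_num) (by norm_num)).const_mul (kap*(1/3)^((1:ℝ)/2)*√π)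
  refine cl (h.congr fun n => by rw [un]; ring) ?_
  rw [show π*(1/4) = π/4 by ring, Real.sin_pi_div_four, kap]
  have e2 : (2:ℝ)^(-(3/2):ℝ)=1/(2*√2) := by
    rw [Real.rpow_neg (by norm_num), show (3/2:ℝ)=1+1/2 by norm_num, Real.rpow_add (by norm_num),
      Real.rpow_one, ← Real.sqrt_eq_rpow]; simp
  have e3 : ((1:ℝ)/3)^((1:ℝ)/2)=1/√3 := by
    rw [← Real.sqrt_eq_rpow]; simp
  have hp : √π^2 = π := Real.sq_sqrt pi_pos.le
  have hp4 : √π^4 = π^2 := by rw [show √π^4 = (√π^2)^2 by ring, hp]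
  rw [e2, e3]
  field_simp
  rw [hp4]; ring
lemma mn_lim : Tendsto (fun n:ℕ => n*(9^n*mn n)) atTop (𝓝 (π/(4*√3))) := by
  have h1 : Tendsto (fun n:ℕ => (n*un n)*(1-(9/8)/(2*(n:ℝ)-1/2))) atTop (𝓝 (π/(4*√3))) := by
    have t : Tendsto (fun n:ℕ => 2*(n:ℝ)-1/2) atTop atTop :=
      tendsto_atTop_add_const_right _ _ (tendsto_natCast_atTop_atTop.const_mul_atTop (by norm_num))
    have := un_lim.mul ((t.const_div_atTop (9/8)).const_sub 1)
    exact cl this (by simp)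
  refine tendsto_of_tendsto_of_tendsto_of_le_of_le' h1 un_lim ?_ ?_
  · filter_upwards [eventually_ge_atTop 1] with n hn
    rw [mul_assoc]; exact mul_le_mul_of_nonneg_left (mn_low hn) (Nat.cast_nonneg n)
  · exact Eventually.of_forall fun n => mul_le_mul_of_nonneg_left (mn_up n) (Nat.cast_nonneg n)
def eh (n:ℕ) : ℝ := ris (1/3) n*ris (1-1/3) n/(n.factorial:ℝ)^2
def hz (z:ℝ) : ℝ := ps eh z
def cg (n:ℕ) : ℝ :=2/9*eh n/(n+1)
def gz (z:ℝ) : ℝ := ps cg z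
def uz (z:ℝ) : ℝ := z*gz z
lemma eh_pos (n:ℕ) :0 < eh n := by
  have := ris_pos (a :=1/3) (by norm_num) n
  have := ris_pos (a :=1-1/3) (by norm_num) n
  unfold eh; positivity
lemma eh_zero : eh 0=1 := by simp [eh, ris_zero]
lemma eh_succ (n:ℕ) : ((n:ℝ)+1)^2*eh (n+1) = ((n:ℝ)^2+n+2/9)*eh n := by
  rw [eh, eh, ris_succ, ris_succ, Nat.factorial_succ]; push_cast; field_simp; ring
lemma eh_le (n:ℕ) : eh n≤1/((n:ℝ)+1) := by
  induction n with
  | zero => simp [eh_zero]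
  | succ n ih =>
    have h := eh_succ n
    have hn : (0:ℝ) ≤ n := Nat.cast_nonneg n
    rw [le_div_iff₀ (by positivity)] at ih ⊢
    push_cast
    have : ((n:ℝ)+1)^2*(eh (n+1)*(n+1+1)) ≤ ((n:ℝ)+1)^2*1 := by
      have e : ((n:ℝ)+1)^2*(eh (n+1)*(n+1+1)) = ((n:ℝ)^2+n+2/9)*(n+2)*eh n := by
        linear_combination ((n:ℝ)+2)*h
      rw [e]
      have e0 := eh_pos n
      calc _ ≤ ((n:ℝ)+1)^3*eh n := by gcongr; nlinarith
        _ = ((n:ℝ)+1)^2*(eh n*(n+1)) := by ring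
        _ ≤ _ := by gcongr
    exact le_of_mul_le_mul_left this (by positivity)
lemma eh_le_one (n:ℕ) : eh n≤1 := (eh_le n).trans (by
  rw [div_le_one (by positivity)]; linarith [(Nat.cast_nonneg n : (0:ℝ) ≤ n)])
lemma eh_lim : Tendsto (fun n:ℕ => n*eh n) atTop (𝓝 (√3/(2*π))) := by
  refine cl (ris_lim (a :=1/3) (by norm_num) (by norm_num)) ?_
  rw [show π*(1/3) = π/3 by ring, Real.sin_pi_div_three]; ring
lemma eh_cb : cb eh 1 := ⟨1, fun n => by rw [one_pow, mul_one, abs_of_pos (eh_pos n)]; exact eh_le_one n⟩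
lemma cg_pos (n:ℕ) :0 < cg n := by have := eh_pos n; unfold cg; positivity
lemma cg_eq (n:ℕ) : cg n = ((n:ℝ)+1)*eh (n+1)-n*eh n := by
  have := eh_succ n
  have h : ((n:ℝ)+1)≠0 := by positivity
  rw [cg, div_eq_iff h]; linear_combination -this
lemma cg_hasSum : HasSum cg (√3/(2*π)) := by
  rw [hasSum_iff_tendsto_nat_of_nonneg (fun n => (cg_pos n).le)]
  refine eh_lim.congr fun n => ?_
  induction n with
  | zero => simp
  | succ n ih => rw [Finset.sum_range_succ, ← ih, cg_eq]; push_cast; ring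
lemma cg_cb : cb cg 1 := ⟨1, fun n => by
  rw [one_pow, mul_one, abs_of_pos (cg_pos n), cg, div_le_one (by positivity)]
  have := eh_le_one n
  have hn : (0:ℝ) ≤ n := Nat.cast_nonneg n
  linarith⟩
lemma gz_one : gz 1 = √3/(2*π) := by
  rw [gz, ps]; simpa using cg_hasSum.tsum_eq
lemma gz_nonneg {z:ℝ} (hz :0 ≤ z) :0 ≤ gz z := ps_nonneg (fun n => (cg_pos n).le) hz
lemma gz_cont : ContinuousOn gz (Icc (-1) 1) := by
  unfold gz ps
  refine continuousOn_tsum (u := cg) (fun n => by fun_prop) cg_hasSum.summable fun n x hx => ?_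
  rw [norm_mul, norm_pow, norm_eq_abs, norm_eq_abs, abs_of_pos (cg_pos n)]
  exact mul_le_of_le_one_right (cg_pos n).le (pow_le_one₀ (abs_nonneg x) (abs_le.2 hx))
lemma gz_le {z:ℝ} (h0 :0 ≤ z) (h1 : z≤1) : gz z≤1 := by
  have h : gz z ≤ gz 1 := by
    rw [gz, gz, ps, ps]
    have hs : ∀ x:ℝ,0 ≤ x → x≤1 → Summable fun n => cg n*x^n := fun x hx hx1 =>
      Summable.of_nonneg_of_le (fun n => mul_nonneg (cg_pos n).le (by positivity))
        (fun n => mul_le_of_le_one_right (cg_pos n).le (pow_le_one₀ hx hx1)) cg_hasSum.summable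
    refine (hs z h0 h1).tsum_le_tsum (fun n => ?_) (hs 1 zero_le_one le_rfl)
    have := cg_pos n
    gcongr
  refine h.trans ?_
  rw [gz_one, div_le_one (by positivity)]
  have : √3≤2 := by rw [Real.sqrt_le_left (by norm_num)]; norm_num
  linarith [pi_gt_three]
lemma hz_deriv0 {z:ℝ} (h : |z| <1) : HasDerivAt hz (ps (dc eh) z) z := ps_hasDerivAt eh_cb h
lemma dh_eq {z:ℝ} (h : |z| <1) : (1-z)*ps (dc eh) z = gz z := by
  obtain ⟨r, hr, hr1⟩ := exists_between h
  have s1 := (eh_cb.dc ((abs_nonneg z).trans hr.le) hr1).summable hr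
  have e1 : z*ps (dc eh) z = ∑' n:ℕ, (n*eh n)*z^n := by
    have sh : HasSum (fun n:ℕ => (((n+1:ℕ):ℝ)*eh (n+1))*z^(n+1)) (z*ps (dc eh) z) := by
      refine (s1.hasSum.mul_left z).congr_fun fun n => ?_
      rw [dc]; push_cast; ring
    have := (hasSum_nat_add_iff (f := fun n:ℕ => (n*eh n)*z^n) 1).1 sh
    simpa using this.tsum_eq.symm
  have s2 : Summable fun n:ℕ => (n*eh n)*z^n := by
    rw [← summable_nat_add_iff 1]
    refine (s1.mul_left z).congr fun n => ?_
    rw [dc]; push_cast; ring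
  rw [sub_mul, one_mul, e1, ps, ← s1.tsum_sub s2, gz, ps]
  congr 1; ext n
  rw [cg_eq, dc]; ring
lemma hz_deriv {z:ℝ} (h0 :0 < z) (h1 : z<1) : HasDerivAt hz (uz z/(z*(1-z))) z := by
  have hz : |z| <1 := by rw [abs_of_pos h0]; exact h1
  refine (hz_deriv0 hz).congr_deriv ?_
  have :1-z≠0 := by linarith
  rw [uz, ← dh_eq hz]; field_simp
def cu:ℕ → ℝ
  | 0 => 0
  | n+1 => cg n
lemma uz_eq {z:ℝ} (h : |z| <1) : uz z = ps cu z := by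
  have s := (cg_cb.summable h).hasSum.mul_left z
  have sh : HasSum (fun n:ℕ => cu (n+1)*z^(n+1)) (uz z) := by
    refine s.congr_fun fun n => ?_
    rw [cu]; ring
  have := (hasSum_nat_add_iff (f := fun n:ℕ => cu n*z^n) 1).1 sh
  have e := this.tsum_eq.symm
  rw [Finset.sum_range_one, show cu 0=0 from rfl, zero_mul, add_zero] at e
  exact e
lemma uz_deriv {z:ℝ} (h : |z| <1) : HasDerivAt uz (2/9*hz z) z := by
  have hc : cb cu 1 := by
    obtain ⟨C, hC⟩ := cg_cb
    refine ⟨C, fun n => ?_⟩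
    cases n with
    | zero => simp only [cu]; simp; exact (by positivity :0 ≤ |cg 0| * 1^0).trans (hC 0)
    | succ n => simpa [cu] using hC n
  have := (ps_hasDerivAt hc h).congr_of_eventuallyEq (f₁ := uz) ?_
  · refine this.congr_deriv ?_
    rw [hz, ps, ps, ← tsum_mul_left]
    congr 1; ext n
    rw [dc, cu, cg]; field_simp
  · filter_upwards [(isOpen_lt continuous_abs continuous_const).mem_nhds h] with x hx using uz_eq hx
lemma hz_ge {z:ℝ} (h0 :0 ≤ z) (h1 : z<1) :1 ≤ hz z := by
  have hs := eh_cb.summable (x := z) (by rwa [abs_of_nonneg h0])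
  have := hs.le_tsum 0 (fun n _ => mul_nonneg (eh_pos n).le (by positivity))
  rw [hz, ps]; simpa [eh_zero] using this
lemma hz_le {z:ℝ} (h0 :0 ≤ z) (h1 : z<1) : hz z≤9*(1-z)^(-(1/8):ℝ) := by
  have ha : |z| <1 := by rwa [abs_of_nonneg h0]
  have hs := eh_cb.summable ha
  have hl := Real.hasSum_pow_div_log_of_abs_lt_one ha
  have h1' : hz z≤1-log (1-z) := by
    rw [hz, ps, hs.tsum_eq_zero_add, eh_zero]
    have : ∑' n, eh (n+1)*z^(n+1) ≤ -log (1-z) := by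
      rw [← hl.tsum_eq]
      refine ((summable_nat_add_iff 1).2 hs).tsum_le_tsum (fun n => ?_) hl.summable
      rw [div_eq_inv_mul, ← one_div]
      gcongr
      refine (eh_le (n+1)).trans ?_
      push_cast
      gcongr; linarith
    simp only [pow_zero, mul_one]; linarith
  have hp :0<1-z := by linarith
  have h2 := Real.log_le_rpow_div (x := (1-z)⁻¹) (ε :=1/8) (by positivity) (by norm_num)
  rw [Real.log_inv, Real.inv_rpow hp.le, ← Real.rpow_neg hp.le] at h2
  have h3 : (1:ℝ) ≤ (1-z)^(-(1/8):ℝ) := Real.one_le_rpow_of_pos_of_le_one_of_nonpos hp (by linarith) (by norm_num)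
  linarith
lemma hz_zero : hz 0=1 := by
  rw [hz, ps, tsum_eq_single 0 (fun n hn => by simp [hn])]; simp [eh_zero]
lemma hz_contAt {z:ℝ} (h : |z| <1) : ContinuousAt hz z := (hz_deriv0 h).continuousAt
/-! Legendre variable -/
def HA (y:ℝ) : ℝ := hz ((1+y)/2)
def HB (y:ℝ) : ℝ := hz ((1-y)/2)
def UA (y:ℝ) : ℝ :=2*uz ((1+y)/2)
def UB (y:ℝ) : ℝ := -2*uz ((1-y)/2)
lemma HA_deriv {y:ℝ} (h : y ∈ Ioo (-1) 1) : HasDerivAt HA (UA y/(1-y^2)) y := by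
  have h1 : HasDerivAt (fun y:ℝ => (1+y)/2) (1/2) y := ((hasDerivAt_id y).const_add 1).div_const 2
  refine ((hz_deriv (by linarith [h.1]) (by linarith [h.2])).comp y h1).congr_deriv ?_
  have := h.1; have := h.2
  have a :1+y≠0 := by linarith
  have b :1-y≠0 := by linarith
  rw [UA, show 1-(1+y)/2 = (1-y)/2 by ring, show 1-y^2 = (1+y)*(1-y) by ring]; field_simp
lemma HB_deriv {y:ℝ} (h : y ∈ Ioo (-1) 1) : HasDerivAt HB (UB y/(1-y^2)) y := by
  have h1 : HasDerivAt (fun y:ℝ => (1-y)/2) (-1/2) y := ((hasDerivAt_id y).const_sub 1).div_const 2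
  refine ((hz_deriv (by linarith [h.2]) (by linarith [h.1])).comp y h1).congr_deriv ?_
  have := h.1; have := h.2
  have a :1+y≠0 := by linarith
  have b :1-y≠0 := by linarith
  rw [UB, show 1-(1-y)/2 = (1+y)/2 by ring, show 1-y^2 = (1+y)*(1-y) by ring]; field_simp
lemma UA_deriv {y:ℝ} (h : y ∈ Ioo (-1) 1) : HasDerivAt UA (2/9*HA y) y := by
  have h1 : HasDerivAt (fun y:ℝ => (1+y)/2) (1/2) y := ((hasDerivAt_id y).const_add 1).div_const 2
  have := h.1; have := h.2
  refine (((uz_deriv (by rw [abs_lt]; constructor <;> linarith)).comp y h1).const_mul 2).congr_deriv ?_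
  rw [HA]; ring
lemma UB_deriv {y:ℝ} (h : y ∈ Ioo (-1) 1) : HasDerivAt UB (2/9*HB y) y := by
  have h1 : HasDerivAt (fun y:ℝ => (1-y)/2) (-1/2) y := ((hasDerivAt_id y).const_sub 1).div_const 2
  have := h.1; have := h.2
  refine (((uz_deriv (by rw [abs_lt]; constructor <;> linarith)).comp y h1).const_mul (-2)).congr_deriv ?_
  rw [HB]; ring
def T3 (c:ℝ) : ℝ :=4*c^3-3*c
abbrev JJ : Set ℝ := Ioo (-1) (-1/2)
def fA (c:ℝ) : ℝ := HA (T3 c)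
def fB (c:ℝ) : ℝ := HB (T3 c)
def pA (c:ℝ) : ℝ :=3*UA (T3 c)
def pB (c:ℝ) : ℝ :=3*UB (T3 c)
def gA (c:ℝ) : ℝ := gz ((1+T3 c)/2)
def gB' (c:ℝ) : ℝ := gz ((1-T3 c)/2)
lemma T3_plus (c:ℝ) :1+T3 c = (1+c)*(2*c-1)^2 := by rw [T3]; ring
lemma T3_minus (c:ℝ) :1-T3 c = (1-c)*(2*c+1)^2 := by rw [T3]; ring
lemma T3_cont : Continuous T3 := by unfold T3; fun_prop
lemma T3_deriv (c:ℝ) : HasDerivAt T3 (3*(4*c^2-1)) c := by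
  have := ((hasDerivAt_pow 3 c).const_mul 4).sub ((hasDerivAt_id c).const_mul 3)
  exact this.congr_deriv (by norm_num; ring)
lemma JJ_facts {c:ℝ} (h : c ∈ JJ) :0<1+c ∧ 0 < -1/2-c ∧ 0<1-c ∧ 0<4*c^2-1 ∧ 0<1-c^2 ∧
    2*c-1<0 ∧ 2*c+1<0 := by
  obtain ⟨h1, h2⟩ := h
  refine ⟨by linarith, by linarith, by linarith, by nlinarith, by nlinarith, by linarith, by linarith⟩
lemma T3_mem {c:ℝ} (h : c ∈ JJ) : T3 c ∈ Ioo (-1) 1 := by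
  obtain ⟨h1, h2, h3, h4, h5, h6, h7⟩ := JJ_facts h
  have a := T3_plus c
  have b := T3_minus c
  have :0 < (1+c)*(2*c-1)^2 := mul_pos h1 (sq_pos_of_neg h6)
  have :0 < (1-c)*(2*c+1)^2 := mul_pos h3 (sq_pos_of_neg h7)
  constructor <;> linarith
lemma T3_memc {c:ℝ} (h : c ∈ Icc (-1:ℝ) (-1/2)) : T3 c ∈ Icc (-1) 1 := by
  have a := T3_plus c
  have b := T3_minus c
  have :0 ≤ (1+c)*(2*c-1)^2 := mul_nonneg (by linarith [h.1]) (sq_nonneg _)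
  have :0 ≤ (1-c)*(2*c+1)^2 := mul_nonneg (by linarith [h.2]) (sq_nonneg _)
  constructor <;> linarith
lemma rho_eq (c:ℝ) :1-T3 c^2 = (1-c^2)*(4*c^2-1)*(4*c^2-1) := by rw [T3]; ring
lemma fA_deriv {c:ℝ} (h : c ∈ JJ) : HasDerivAt fA (pA c/((1-c^2)*(4*c^2-1))) c := by
  obtain ⟨h1, h2, h3, h4, h5, h6, h7⟩ := JJ_facts h
  refine ((HA_deriv (T3_mem h)).comp c (T3_deriv c)).congr_deriv ?_
  rw [rho_eq, pA]; field_simp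
lemma fB_deriv {c:ℝ} (h : c ∈ JJ) : HasDerivAt fB (pB c/((1-c^2)*(4*c^2-1))) c := by
  obtain ⟨h1, h2, h3, h4, h5, h6, h7⟩ := JJ_facts h
  refine ((HB_deriv (T3_mem h)).comp c (T3_deriv c)).congr_deriv ?_
  rw [rho_eq, pB]; field_simp
lemma pA_deriv {c:ℝ} (h : c ∈ JJ) : HasDerivAt pA (2*(4*c^2-1)*fA c) c := by
  refine (((UA_deriv (T3_mem h)).comp c (T3_deriv c)).const_mul 3).congr_deriv ?_
  rw [fA]; ring
lemma pB_deriv {c:ℝ} (h : c ∈ JJ) : HasDerivAt pB (2*(4*c^2-1)*fB c) c := by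
  refine (((UB_deriv (T3_mem h)).comp c (T3_deriv c)).const_mul 3).congr_deriv ?_
  rw [fB]; ring
lemma pA_eq (c:ℝ) : pA c=3*(1+c)*(2*c-1)^2*gA c := by
  rw [pA, UA, uz, gA, T3_plus]; ring
lemma pB_eq (c:ℝ) : pB c = -(3*(1-c)*(2*c+1)^2*gB' c) := by
  rw [pB, UB, uz, gB', T3_minus]; ring
lemma gA_cont : ContinuousOn gA (Icc (-1) (-1/2)) := by
  have := T3_cont
  refine gz_cont.comp (f := fun c => (1+T3 c)/2) (by fun_prop) fun c hc => ?_
  have := T3_memc hc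
  constructor <;> linarith [this.1, this.2]
lemma gB'_cont : ContinuousOn gB' (Icc (-1) (-1/2)) := by
  have := T3_cont
  refine gz_cont.comp (f := fun c => (1-T3 c)/2) (by fun_prop) fun c hc => ?_
  have := T3_memc hc
  constructor <;> linarith [this.1, this.2]
lemma g_bd {c:ℝ} (h : c ∈ Icc (-1:ℝ) (-1/2)) :0 ≤ gA c ∧ gA c≤1 ∧ 0 ≤ gB' c ∧ gB' c≤1 := by
  have := T3_memc h
  have h1 := this.1
  have h2 := this.2
  exact ⟨gz_nonneg (by linarith), gz_le (by linarith) (by linarith), gz_nonneg (by linarith),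
    gz_le (by linarith) (by linarith)⟩
lemma pA_cont : ContinuousOn pA (Icc (-1) (-1/2)) := by
  have := gA_cont
  rw [show pA = fun c => 3*(1+c)*(2*c-1)^2*gA c from funext pA_eq]; fun_prop
lemma pB_cont : ContinuousOn pB (Icc (-1) (-1/2)) := by
  have := gB'_cont
  rw [show pB = fun c => -(3*(1-c)*(2*c+1)^2*gB' c) from funext pB_eq]; fun_prop
lemma fA_contJ : ContinuousOn fA JJ := fun c hc => (fA_deriv hc).continuousAt.continuousWithinAt
lemma fB_contJ : ContinuousOn fB JJ := fun c hc => (fB_deriv hc).continuousAt.continuousWithinAt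
lemma gA_contJ : ContinuousOn gA JJ := gA_cont.mono Ioo_subset_Icc_self
lemma gB'_contJ : ContinuousOn gB' JJ := gB'_cont.mono Ioo_subset_Icc_self
lemma fA_bd {c:ℝ} (h : c ∈ JJ) :1 ≤ fA c ∧ fA c≤9*(-1/2-c)^(-(1/4):ℝ) := by
  obtain ⟨h1, h2, h3, h4, h5, h6, h7⟩ := JJ_facts h
  have m := T3_mem h
  have m1 := m.1
  have m2 := m.2
  refine ⟨hz_ge (by linarith) (by linarith), (hz_le (by linarith) (by linarith)).trans ?_⟩
  have e : (-1/2-c)^(-(1/4):ℝ) = ((-1/2-c)^2)^(-(1/8):ℝ) := by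
    rw [← Real.rpow_natCast (-1/2-c) 2, ← Real.rpow_mul h2.le]; norm_num
  rw [e, show 1-(1+T3 c)/2 = (1-T3 c)/2 by ring, T3_minus]
  gcongr 9 * ?_
  refine Real.rpow_le_rpow_of_nonpos (by positivity) ?_ (by norm_num)
  nlinarith [sq_nonneg (2*c+1)]
lemma fB_bd {c:ℝ} (h : c ∈ JJ) :1 ≤ fB c ∧ fB c≤9*(1+c)^(-(1/4):ℝ) := by
  obtain ⟨h1, h2, h3, h4, h5, h6, h7⟩ := JJ_facts h
  have m := T3_mem h
  have m1 := m.1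
  have m2 := m.2
  refine ⟨hz_ge (by linarith) (by linarith), (hz_le (by linarith) (by linarith)).trans ?_⟩
  have e : (1+c)^(-(1/8):ℝ) ≤ (1+c)^(-(1/4):ℝ) :=
    Real.rpow_le_rpow_of_exponent_ge h1 (by linarith) (by norm_num)
  refine le_trans ?_ (mul_le_mul_of_nonneg_left e (by norm_num))
  rw [show 1-(1-T3 c)/2 = (1+T3 c)/2 by ring, T3_plus]
  gcongr 9 * ?_
  refine Real.rpow_le_rpow_of_nonpos h1 ?_ (by norm_num)
  nlinarith [mul_nonneg h1.le (show 0 ≤ (2*c-1)^2/2-1 by nlinarith)]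
lemma intJ {f:ℝ → ℝ} {C:ℝ} (hc : ContinuousOn f JJ)
    (hb : ∀ c ∈ JJ, |f c| ≤ C*(1+fA c^2+fB c^2)) (hC :0 ≤ C) :
    IntervalIntegrable f volume (-1) (-1/2) := by
  have i1 : IntervalIntegrable (fun c:ℝ => (1+c)^(-(1/2):ℝ)) volume (-1) (-1/2) := by
    have := (intervalIntegral.intervalIntegrable_rpow' (a :=0) (b :=1/2) (r := -(1/2)) (by norm_num)).comp_add_left 1
    norm_num at this ⊢
    exact this
  have i2 : IntervalIntegrable (fun c:ℝ => (-1/2-c)^(-(1/2):ℝ)) volume (-1) (-1/2) := by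
    have := (intervalIntegral.intervalIntegrable_rpow' (a :=1/2) (b :=0) (r := -(1/2)) (by norm_num)).comp_sub_left (-1/2)
    norm_num at this ⊢
    exact this
  have i0 : IntervalIntegrable (fun c:ℝ => (1:ℝ)) volume (-1) (-1/2) := intervalIntegrable_const
  have iS := ((i0.add (i2.const_mul 81)).add (i1.const_mul 81)).const_mul C
  rw [intervalIntegrable_iff_integrableOn_Ioo_of_le (by norm_num)] at iS ⊢
  refine Integrable.mono' iS (hc.aestronglyMeasurable measurableSet_Ioo) ?_
  refine (ae_restrict_iff' measurableSet_Ioo).2 (Eventually.of_forall fun c h => ?_)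
  obtain ⟨h1, h2, -⟩ := JJ_facts h
  refine (hb c h).trans ?_
  have sq : ∀ x:ℝ,0 < x → (9*x^(-(1/4):ℝ))^2=81*x^(-(1/2):ℝ) := fun x hx => by
    rw [mul_pow, ← Real.rpow_natCast (x^(-(1/4):ℝ)) 2, ← Real.rpow_mul hx.le]; norm_num
  have a := fA_bd h
  have b := fB_bd h
  have a2 : fA c^2 ≤ (9*(-1/2-c)^(-(1/4):ℝ))^2 := by have := a.1; gcongr; exact a.2
  have b2 : fB c^2 ≤ (9*(1+c)^(-(1/4):ℝ))^2 := by have := b.1; gcongr; exact b.2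
  rw [sq _ h2] at a2
  rw [sq _ h1] at b2
  show C*_ ≤ C*(1+81*_+81*_)
  gcongr
lemma ftcJ {f f':ℝ → ℝ} {a b:ℝ} (hd : ∀ c ∈ JJ, HasDerivAt f (f' c) c)
    (hi : IntervalIntegrable f' volume (-1) (-1/2)) (ha : Tendsto f (𝓝[>] (-1)) (𝓝 a))
    (hb : Tendsto f (𝓝[<] (-1/2)) (𝓝 b)) : ∫ c in (-1:ℝ)..(-1/2), f' c = b-a :=
  intervalIntegral.integral_eq_sub_of_hasDerivAt_of_tendsto (by norm_num) hd hi ha hb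
lemma nhJ0 : ∀ᶠ c in 𝓝[>] (-1:ℝ), c ∈ JJ := Ioo_mem_nhdsGT (by norm_num)
lemma nhJ1 : ∀ᶠ c in 𝓝[<] (-1/2:ℝ), c ∈ JJ := Ioo_mem_nhdsLT (by norm_num)
lemma lim0 {f:ℝ → ℝ} (h : ContinuousOn f (Icc (-1) (-1/2))) : Tendsto f (𝓝[>] (-1)) (𝓝 (f (-1))) :=
  ((h (-1) ⟨le_rfl, by norm_num⟩).mono Ioo_subset_Icc_self).tendsto.mono_left
    (by rw [nhdsWithin_Ioo_eq_nhdsGT (by norm_num)])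
lemma lim1 {f:ℝ → ℝ} (h : ContinuousOn f (Icc (-1) (-1/2))) : Tendsto f (𝓝[<] (-1/2)) (𝓝 (f (-1/2))) :=
  ((h (-1/2) ⟨by norm_num, le_rfl⟩).mono Ioo_subset_Icc_self).tendsto.mono_left
    (by rw [nhdsWithin_Ioo_eq_nhdsLT (by norm_num)])
lemma fA_lim0 : Tendsto fA (𝓝[>] (-1)) (𝓝 1) := by
  have h : ContinuousAt fA (-1) := by
    have : ContinuousAt hz ((1+T3 (-1))/2) := hz_contAt (by rw [T3]; norm_num)
    exact ContinuousAt.comp (f := fun c => (1+T3 c)/2) (g := hz) this (by have := T3_cont; fun_prop)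
  have e : fA (-1)=1 := by rw [fA, HA, T3]; norm_num; exact hz_zero
  exact cl (h.tendsto.mono_left nhdsWithin_le_nhds) e
lemma fB_lim1 : Tendsto fB (𝓝[<] (-1/2)) (𝓝 1) := by
  have h : ContinuousAt fB (-1/2) := by
    have : ContinuousAt hz ((1-T3 (-1/2))/2) := hz_contAt (by rw [T3]; norm_num)
    exact ContinuousAt.comp (f := fun c => (1-T3 c)/2) (g := hz) this (by have := T3_cont; fun_prop)
  have e : fB (-1/2)=1 := by rw [fB, HB, T3]; norm_num; exact hz_zero
  exact cl (h.tendsto.mono_left nhdsWithin_le_nhds) e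
lemma fB_lim0 : Tendsto (fun c => (1+c)*fB c) (𝓝[>] (-1)) (𝓝 0) := by
  have h : Tendsto (fun c:ℝ => 9*(1+c)^(3/4:ℝ)) (𝓝[>] (-1)) (𝓝 0) := by
    have : ContinuousAt (fun c:ℝ => 9*(1+c)^(3/4:ℝ)) (-1) :=
      continuousAt_const.mul (ContinuousAt.rpow_const (by fun_prop) (Or.inr (by norm_num)))
    refine cl (this.tendsto.mono_left nhdsWithin_le_nhds) ?_
    norm_num
  refine squeeze_zero' ?_ ?_ h
  · filter_upwards [nhJ0] with c hc
    have := (fB_bd hc).1; have := (JJ_facts hc).1; positivity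
  · filter_upwards [nhJ0] with c hc
    have h1 := (JJ_facts hc).1
    calc (1+c)*fB c ≤ (1+c)^(1:ℝ)*(9*(1+c)^(-(1/4):ℝ)) := by
          rw [Real.rpow_one]; gcongr; exact (fB_bd hc).2
      _=9*((1+c)^(1:ℝ)*(1+c)^(-(1/4):ℝ)) := by ring
      _ = _ := by rw [← Real.rpow_add h1]; norm_num
lemma fA_lim1 : Tendsto (fun c => (2*c+1)*fA c) (𝓝[<] (-1/2)) (𝓝 0) := by
  have h : Tendsto (fun c:ℝ => 18*(-1/2-c)^(3/4:ℝ)) (𝓝[<] (-1/2)) (𝓝 0) := by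
    have : ContinuousAt (fun c:ℝ => 18*(-1/2-c)^(3/4:ℝ)) (-1/2) :=
      continuousAt_const.mul (ContinuousAt.rpow_const (by fun_prop) (Or.inr (by norm_num)))
    refine cl (this.tendsto.mono_left nhdsWithin_le_nhds) ?_
    norm_num
  refine squeeze_zero_norm' ?_ h
  filter_upwards [nhJ1] with c hc
  have h1 := (JJ_facts hc).2.1
  have hA := (fA_bd hc).1
  rw [norm_mul, norm_eq_abs, norm_eq_abs, abs_of_neg (by linarith), abs_of_pos (by linarith)]
  calc -(2*c+1)*fA c=2*((-1/2-c)^(1:ℝ)*fA c) := by rw [Real.rpow_one]; ring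
    _≤2*((-1/2-c)^(1:ℝ)*(9*(-1/2-c)^(-(1/4):ℝ))) := by
          rw [Real.rpow_one]; gcongr; exact (fA_bd hc).2
    _=18*((-1/2-c)^(1:ℝ)*(-1/2-c)^(-(1/4):ℝ)) := by ring
    _ = _ := by rw [← Real.rpow_add h1]; norm_num
lemma pA_lim0 : Tendsto pA (𝓝[>] (-1)) (𝓝 0) := cl (lim0 pA_cont) (by rw [pA_eq]; norm_num)
lemma pB_lim1 : Tendsto pB (𝓝[<] (-1/2)) (𝓝 0) := cl (lim1 pB_cont) (by rw [pB_eq]; norm_num)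
lemma pA_lim1 : Tendsto pA (𝓝[<] (-1/2)) (𝓝 (3*√3/π)) := cl (lim1 pA_cont) (by
  rw [pA_eq, gA, T3]; norm_num; rw [gz_one]; ring)
lemma pB_lim0 : Tendsto pB (𝓝[>] (-1)) (𝓝 (-(3*√3/π))) := cl (lim0 pB_cont) (by
  rw [pB_eq, gB', T3]; norm_num; rw [gz_one]; ring)
lemma pAfB_lim0 : Tendsto (fun c => pA c*fB c) (𝓝[>] (-1)) (𝓝 0) := by
  have h : ContinuousOn (fun c => 3*(2*c-1)^2*gA c) (Icc (-1) (-1/2)) := by have := gA_cont; fun_prop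
  refine cl (((lim0 h).mul fB_lim0).congr fun c => ?_) (by simp)
  rw [pA_eq]; ring
lemma pBfA_lim1 : Tendsto (fun c => pB c*fA c) (𝓝[<] (-1/2)) (𝓝 0) := by
  have h : ContinuousOn (fun c => -(3*(1-c)*(2*c+1)*gB' c)) (Icc (-1) (-1/2)) := by
    have := gB'_cont; fun_prop
  refine cl (((lim1 h).mul fA_lim1).congr fun c => ?_) (by simp)
  rw [pB_eq]; ring
lemma an_cb : cb an (1/9) := ⟨1, fun n => by
  rw [abs_of_nonneg (an_nonneg n), one_div, inv_pow, ← div_eq_mul_inv]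
  exact (div_le_one (by positivity)).2 (an_le_pow n)⟩
def F0 (x:ℝ) : ℝ := ps an x
def F1 (x:ℝ) : ℝ := x*ps (dc an) x
def F2 (x:ℝ) : ℝ := x*ps (dc an) x+x^2*ps (dc (dc an)) x
lemma F_sums {x:ℝ} (h : |x| <1/9) : HasSum (fun n:ℕ => an n*x^n) (F0 x) ∧
    HasSum (fun n:ℕ => n*an n*x^n) (F1 x) ∧ HasSum (fun n:ℕ => (n:ℝ)^2*an n*x^n) (F2 x) := by
  obtain ⟨r, hr, hr1⟩ := exists_between h
  obtain ⟨s, hs, hs1⟩ := exists_between hr1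
  have r0 := (abs_nonneg x).trans hr.le
  have c1 := an_cb.dc (r0.trans hs.le) hs1
  have c2 := c1.dc r0 hs
  have s1 : HasSum (fun n:ℕ => dc an n*x^n) (ps (dc an) x) := (c1.summable (hr.trans hs)).hasSum
  have s2 : HasSum (fun n:ℕ => dc (dc an) n*x^n) (ps (dc (dc an)) x) := (c2.summable hr).hasSum
  have t1 : HasSum (fun n:ℕ => n*an n*x^n) (F1 x) := by
    have sh : HasSum (fun n:ℕ => (((n+1:ℕ):ℝ)*an (n+1))*x^(n+1)) (F1 x) := by
      refine (s1.mul_left x).congr_fun fun n => ?_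
      rw [dc]; push_cast; ring
    have := (hasSum_nat_add_iff (f := fun n:ℕ => (n*an n)*x^n) 1).1 sh
    simpa using this
  have t2 : HasSum (fun n:ℕ => n*(n-1:ℝ)*an n*x^n) (x^2*ps (dc (dc an)) x) := by
    have sh : HasSum (fun n:ℕ => (((n+2:ℕ):ℝ)*(((n+2:ℕ):ℝ)-1)*an (n+2))*x^(n+2)) (x^2*ps (dc (dc an)) x) := by
      refine (s2.mul_left (x^2)).congr_fun fun n => ?_
      rw [dc, dc]; push_cast; ring
    have := (hasSum_nat_add_iff (f := fun n:ℕ => (n*(n-1:ℝ)*an n)*x^n) 2).1 sh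
    simpa [Finset.sum_range_succ] using this
  refine ⟨(an_cb.summable h).hasSum, t1, ?_⟩
  refine (t1.add t2).congr_fun fun n => ?_
  ring
lemma F_ode {x:ℝ} (h : |x| <1/9) :
    (1-10*x+9*x^2)*F2 x = (10*x-18*x^2)*F1 x+(3*x-9*x^2)*F0 x := by
  obtain ⟨h0, h1, h2⟩ := F_sums h
  have g2 := (hasSum_nat_add_iff' 2).2 h2
  have g1 := (hasSum_nat_add_iff' 1).2 (((h2.mul_left 10).add (h1.mul_left 10)).add (h0.mul_left 3))
  have g0 := ((h2.add (h1.mul_left 2)).add h0).mul_left (9*x^2)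
  have := (g2.sub (g1.mul_left x)).add g0
  have z : HasSum (fun _:ℕ => (0:ℝ)) (F2 x-(∑ n ∈ Finset.range 2, (n:ℝ)^2*an n*x^n)-x*(10*F2 x+10*F1 x+3*F0 x - ∑ n ∈ Finset.range 1, (10*((n:ℝ)^2*an n*x^n)+10*(n*an n*x^n)+3*(an n*x^n))) +
     9*x^2*(F2 x+2*F1 x+F0 x)) := by
    refine this.congr_fun fun n => ?_
    have := an_rec n
    push_cast
    linear_combination (-x^(n+2))*this
  have e := z.unique hasSum_zero
  simp only [Finset.sum_range_succ, Finset.sum_range_zero, an_zero, an_one] at e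
  norm_num at e
  linear_combination e
def vc (c:ℝ) : ℝ := (1+c)/(3*(1-c))
lemma vc_deriv {c:ℝ} (h : c<1) : HasDerivAt vc ((2/3)/(1-c)^2) c := by
  have h1 :1-c≠0 := by linarith
  have := ((hasDerivAt_id c).const_add 1).div (((hasDerivAt_id c).const_sub 1).const_mul 3) (by simpa using h1)
  refine this.congr_deriv ?_
  simp only [id]; field_simp; ring
lemma vc_mem {c:ℝ} (h : c ∈ JJ) :0 < vc c ∧ vc c<1/9 := by
  obtain ⟨h1, h2, h3, h4, h5, h6, h7⟩ := JJ_facts h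
  refine ⟨by unfold vc; positivity, ?_⟩
  rw [vc, div_lt_div_iff₀ (by positivity) (by norm_num)]; linarith
lemma vc_abs {c:ℝ} (h : c ∈ JJ) : |vc c| <1/9 := by
  rw [abs_of_pos (vc_mem h).1]; exact (vc_mem h).2
lemma vc_cont : ContinuousOn vc (Icc (-1) (-1/2)) := fun c hc =>
  (vc_deriv (by linarith [hc.2])).continuousAt.continuousWithinAt
lemma F0_deriv {x:ℝ} (h : |x| <1/9) (hx : x≠0) : HasDerivAt F0 (F1 x/x) x :=
  (ps_hasDerivAt an_cb h).congr_deriv (by rw [F1]; field_simp)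
lemma F1_deriv {x:ℝ} (h : |x| <1/9) (hx : x≠0) : HasDerivAt F1 (F2 x/x) x := by
  obtain ⟨r, hr, hr1⟩ := exists_between h
  have c1 := an_cb.dc ((abs_nonneg x).trans hr.le) hr1
  refine ((hasDerivAt_id x).mul (ps_hasDerivAt c1 hr)).congr_deriv ?_
  rw [F2]; field_simp; simp; ring
lemma constJ {f:ℝ → ℝ} {a:ℝ} (hd : ∀ c ∈ JJ, HasDerivAt f 0 c) (ha : Tendsto f (𝓝[>] (-1)) (𝓝 a)) :
    ∀ c ∈ JJ, f c = a := by
  intro c hc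
  have := intervalIntegral.integral_eq_sub_of_hasDerivAt_of_tendsto (f' := fun _ => (0:ℝ)) hc.1
    (fun x hx => hd x ⟨hx.1, hx.2.trans hc.2⟩) intervalIntegrable_const ha
    ((hd c hc).continuousAt.tendsto.mono_left nhdsWithin_le_nhds)
  simp at this; linarith
def Ft (c:ℝ) : ℝ :=2*F0 (vc c)/(1-c)
def qt (c:ℝ) : ℝ := (4*c^2-1)*(2*F0 (vc c)*(1+c)+4*F1 (vc c))/(1-c)
lemma Ft_deriv {c:ℝ} (h : c ∈ JJ) : HasDerivAt Ft (qt c/((1-c^2)*(4*c^2-1))) c := by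
  obtain ⟨h1, h2, h3, h4, h5, h6, h7⟩ := JJ_facts h
  have v0 := vc_mem h
  have := (((F0_deriv (vc_abs h) v0.1.ne').comp c (vc_deriv (by linarith))).const_mul 2).div
    ((hasDerivAt_id c).const_sub 1) h3.ne'
  refine this.congr_deriv ?_
  simp only [id, Function.comp, qt]
  have : vc c = (1+c)/(3*(1-c)) := rfl
  generalize F0 (vc c) = a
  generalize F1 (vc c) = b
  rw [this, show 1-c^2 = (1-c)*(1+c) by ring]
  generalize hw :4*c^2-1 = w at *
  field_simp; ring
lemma qt_deriv {c:ℝ} (h : c ∈ JJ) : HasDerivAt qt (2*(4*c^2-1)*Ft c) c := by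
  obtain ⟨h1, h2, h3, h4, h5, h6, h7⟩ := JJ_facts h
  have v0 := vc_mem h
  have d0 := (F0_deriv (vc_abs h) v0.1.ne').comp c (vc_deriv (by linarith))
  have d1 := (F1_deriv (vc_abs h) v0.1.ne').comp c (vc_deriv (by linarith))
  have dw : HasDerivAt (fun c:ℝ => 4*c^2-1) (8*c) c :=
    (((hasDerivAt_pow 2 c).const_mul 4).sub_const 1).congr_deriv (by norm_num; ring)
  have := (dw.mul (((d0.const_mul 2).mul ((hasDerivAt_id c).const_add 1)).add (d1.const_mul 4))).div
    ((hasDerivAt_id c).const_sub 1) h3.ne'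
  refine this.congr_deriv ?_
  have o := F_ode (vc_abs h)
  simp only [id, Function.comp, Ft, Pi.mul_apply, Pi.add_apply]
  have e : vc c = (1+c)/(3*(1-c)) := rfl
  generalize F0 (vc c) = a at *
  generalize F1 (vc c) = b at *
  generalize F2 (vc c) = d at *
  rw [e] at o ⊢
  have o2 :2*(4*c^2-1)*d = (1+c)*((2-8*c)*b-3*c*a) := by
    field_simp at o
    linear_combination o/6
  field_simp
  linear_combination 4*o2
lemma F_at : Tendsto (fun c => F0 (vc c)) (𝓝[>] (-1)) (𝓝 1) ∧ Tendsto (fun c => F1 (vc c)) (𝓝[>] (-1)) (𝓝 0) := by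
  have v1 : vc (-1)=0 := by rw [vc]; norm_num
  have hv : ContinuousAt vc (-1) := (vc_deriv (by norm_num)).continuousAt
  have c0 : ContinuousAt F0 (vc (-1)) := (ps_hasDerivAt an_cb (by rw [v1]; norm_num)).continuousAt
  have c1 : ContinuousAt F1 (vc (-1)) := continuousAt_id.mul
    (ps_hasDerivAt (an_cb.dc (r :=1/10) (by norm_num) (by norm_num)) (by rw [v1]; norm_num)).continuousAt
  refine ⟨cl ((c0.comp hv).tendsto.mono_left nhdsWithin_le_nhds) ?_,
    cl ((c1.comp hv).tendsto.mono_left nhdsWithin_le_nhds) ?_⟩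
  · rw [Function.comp, v1, F0, ps, tsum_eq_single 0 (fun n hn => by simp [hn])]; simp [an_zero]
  · rw [Function.comp, v1, F1, zero_mul]
lemma contl0 {f:ℝ → ℝ} (h : ContinuousAt f (-1)) : Tendsto f (𝓝[>] (-1)) (𝓝 (f (-1))) :=
  h.tendsto.mono_left nhdsWithin_le_nhds
lemma Ft_lim : Tendsto Ft (𝓝[>] (-1)) (𝓝 1) := by
  refine cl ((F_at.1.const_mul 2).div (contl0 (f := fun c => 1-c) (by fun_prop)) (by norm_num)) (by norm_num)
lemma qt_lim : Tendsto qt (𝓝[>] (-1)) (𝓝 0) := by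
  refine cl (((contl0 (f := fun c => 4*c^2-1) (by fun_prop)).mul (((F_at.1.const_mul 2).mul
    (contl0 (f := fun c => 1+c) (by fun_prop))).add
    (F_at.2.const_mul 4))).div (contl0 (f := fun c => 1-c) (by fun_prop)) (by norm_num)) (by norm_num)
lemma ident {c:ℝ} (h : c ∈ JJ) : Ft c = fA c ∧ qt c = pA c := by
  have w : ∀ c ∈ JJ, fA c*qt c-pA c*Ft c=0 := by
    refine constJ (fun c h => ?_) (cl ((fA_lim0.mul qt_lim).sub (pA_lim0.mul Ft_lim)) (by norm_num))
    refine (((fA_deriv h).mul (qt_deriv h)).sub ((pA_deriv h).mul (Ft_deriv h))).congr_deriv ?_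
    ring
  have r : ∀ c ∈ JJ, Ft c/fA c=1 := by
    refine constJ (fun c h => ?_) (cl (Ft_lim.div fA_lim0 (by norm_num)) (by norm_num))
    have hA : fA c≠0 := by have := (fA_bd h).1; linarith
    refine ((Ft_deriv h).div (fA_deriv h) hA).congr_deriv ?_
    rw [div_eq_zero_iff]; left
    linear_combination (1/((1-c^2)*(4*c^2-1)))*w c h
  have hA : fA c≠0 := by have := (fA_bd h).1; linarith
  have e : Ft c = fA c := by have := r c h; rwa [div_eq_one_iff_eq hA] at this
  refine ⟨e, ?_⟩
  have := w c h
  rw [e] at this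
  apply mul_left_cancel₀ hA; linarith
lemma F0_eq {c:ℝ} (h : c ∈ JJ) : F0 (vc c) = (1-c)/2*fA c := by
  obtain ⟨h1, h2, h3, h4, h5, h6, h7⟩ := JJ_facts h
  rw [← (ident h).1, Ft]; field_simp
lemma F1_eq {c:ℝ} (h : c ∈ JJ) : F1 (vc c) = (1-c)/4*(pA c/(4*c^2-1)-(1+c)*fA c) := by
  obtain ⟨h1, h2, h3, h4, h5, h6, h7⟩ := JJ_facts h
  rw [← (ident h).1, ← (ident h).2, Ft, qt]
  generalize hw :4*c^2-1 = w at *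
  field_simp; ring
lemma iJ (f:ℝ → ℝ) : ∫ c in (-1:ℝ)..(-1/2), f c = ∫ c in JJ, f c := by
  rw [intervalIntegral.integral_of_le (by norm_num), integral_Ioc_eq_integral_Ioo]
lemma aeJ {p:ℝ → Prop} (h : ∀ c ∈ JJ, p c) : ∀ᵐ c ∂(volume.restrict JJ), p c :=
  (ae_restrict_iff' measurableSet_Ioo).2 (Eventually.of_forall h)
lemma congJ {f g:ℝ → ℝ} (h : ∀ c ∈ JJ, f c = g c) :
    ∫ c in (-1:ℝ)..(-1/2), f c = ∫ c in (-1:ℝ)..(-1/2), g c := by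
  rw [iJ, iJ]; exact setIntegral_congr_fun measurableSet_Ioo h
lemma tonelliJ {F:ℕ → ℝ → ℝ} {f:ℝ → ℝ} (hF : ∀ n, ContinuousOn (F n) JJ)
    (h0 : ∀ n, ∀ c ∈ JJ,0 ≤ F n c) (hs : ∀ c ∈ JJ, HasSum (fun n => F n c) (f c))
    (hf : IntervalIntegrable f volume (-1) (-1/2)) :
    HasSum (fun n => ∫ c in (-1:ℝ)..(-1/2), F n c) (∫ c in (-1:ℝ)..(-1/2), f c) := by
  simp only [iJ]
  rw [intervalIntegrable_iff_integrableOn_Ioo_of_le (by norm_num)] at hf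
  refine hasSum_integral_of_dominated_convergence F
    (fun n => (hF n).aestronglyMeasurable measurableSet_Ioo) (fun n => aeJ fun t ht => ?_)
    (aeJ fun t ht => (hs t ht).summable) ?_ (aeJ hs)
  · rw [norm_eq_abs, abs_of_nonneg (h0 n t ht)]
  · exact hf.congr (aeJ fun t ht => (hs t ht).tsum_eq.symm)
lemma vc_contJ : ContinuousOn vc JJ := vc_cont.mono Ioo_subset_Icc_self
lemma one_sub_ne {c:ℝ} (h : c ∈ JJ) :1-c≠0 := (JJ_facts h).2.2.1.ne'
def mf (n:ℕ) (c:ℝ) : ℝ := vc c^n*fB c/(3*(1-c))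
def mu (n:ℕ) : ℝ := ∫ c in (-1:ℝ)..(-1/2), mf n c
lemma mf_cont (n:ℕ) : ContinuousOn (mf n) JJ :=
  ((vc_contJ.pow n).mul fB_contJ).div (by fun_prop) fun c hc => by have := one_sub_ne hc; positivity
lemma mf_pos (n:ℕ) {c:ℝ} (h : c ∈ JJ) :0 < mf n c := by
  have := (vc_mem h).1; have := (fB_bd h).1; have := (JJ_facts h).2.2.1
  unfold mf; positivity
lemma mf_int (n:ℕ) : IntervalIntegrable (mf n) volume (-1) (-1/2) := by
  refine intJ (C :=1) (mf_cont n) (fun c h => ?_) (by norm_num)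
  have v := vc_mem h; have b := (fB_bd h).1; have h3 := (JJ_facts h).2.2.1
  have h2 := h.2
  rw [abs_of_pos (mf_pos n h), mf, div_le_iff₀ (by positivity)]
  have : vc c^n≤1 := pow_le_one₀ v.1.le (by linarith [v.2])
  calc vc c^n*fB c≤1*fB c := by gcongr
    _≤1*(1+fA c^2+fB c^2)*1 := by nlinarith [sq_nonneg (fA c)]
    _≤1*(1+fA c^2+fB c^2)*(3*(1-c)) := by gcongr; linarith
lemma mu_pos (n:ℕ) :0 < mu n :=
  intervalIntegral.intervalIntegral_pos_of_pos_on (mf_int n) (fun _ h => mf_pos n h) (by norm_num)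
lemma vpow_deriv {c:ℝ} (h : c ∈ JJ) (n:ℕ) :
    HasDerivAt (fun c => vc c^n) (n*vc c^n*(2/(1-c^2))) c := by
  have h3 := one_sub_ne h
  have h1 := (JJ_facts h).1
  refine ((vc_deriv (by linarith [h.2])).pow n).congr_deriv ?_
  cases n with
  | zero => simp
  | succ n =>
    rw [show 1-c^2 = (1-c)*(1+c) by ring, Nat.add_sub_cancel]
    simp only [pow_succ]
    generalize vc c^n = V
    rw [show vc c = (1+c)/(3*(1-c)) from rfl]
    field_simp
lemma w_deriv (c:ℝ) : HasDerivAt (fun c:ℝ => 4*c^2-1) (8*c) c :=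
    (((hasDerivAt_pow 2 c).const_mul 4).sub_const 1).congr_deriv (by norm_num; ring)
lemma mu_rec (n:ℕ) : ((n:ℝ)+1)^2*mu n-(10*((n:ℝ)+1)^2+10*((n:ℝ)+1)+3)*mu (n+1)
    + 9*((n:ℝ)+2)^2*mu (n+2)=0 := by
  have key := ftcJ (f := fun c => vc c^(n+1)*(((4*c^2-1)*(2*n+3+c))*fB c-pB c)/(3*(1-c)))
    (f' := fun c => ((n:ℝ)+1)^2*mf n c-(10*((n:ℝ)+1)^2+10*((n:ℝ)+1)+3)*mf (n+1) c
    + 9*((n:ℝ)+2)^2*mf (n+2) c) (a :=0) (b :=0) ?_ ?_ ?_ ?_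
  · rw [intervalIntegral.integral_add, intervalIntegral.integral_sub] at key
    · simp only [intervalIntegral.integral_const_mul] at key
      rw [mu, mu, mu, key]; ring
    · exact (mf_int n).const_mul _
    · exact (mf_int _).const_mul _
    · exact ((mf_int n).const_mul _).sub ((mf_int _).const_mul _)
    · exact (mf_int _).const_mul _
  · intro c h
    obtain ⟨h1, h2, h3, h4, h5, h6, h7⟩ := JJ_facts h
    have d := (((vpow_deriv h (n+1)).mul ((((w_deriv c).mul ((hasDerivAt_id c).const_add (2*(n:ℝ)+3))).mul
      (fB_deriv h)).sub (pB_deriv h)))).div (((hasDerivAt_id c).const_sub 1).const_mul 3) (by simpa using h3.ne')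
    refine d.congr_deriv ?_
    simp only [id, mf, Pi.mul_apply, Pi.sub_apply]
    have e : vc c = (1+c)/(3*(1-c)) := rfl
    rw [pow_succ (vc c) (n+1), pow_succ (vc c) n]
    generalize vc c^n = V
    generalize fB c = a
    generalize pB c = b
    rw [e]
    rw [show 1-c^2 = (1-c)*(1+c) by ring]
    push_cast
    generalize hw :4*c^2-1 = w at *
    field_simp
    rw [← hw]
    ring
  · exact (((mf_int n).const_mul _).sub ((mf_int _).const_mul _)).add ((mf_int _).const_mul _)
  · have c1 : ContinuousOn (fun c => vc c^n*((4*c^2-1)*(2*n+3+c))/(9*(1-c)^2)) (Icc (-1) (-1/2)) := by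
      have := vc_cont
      refine ContinuousOn.div (by fun_prop) (by fun_prop) fun c hc => ?_
      have :1-c≠0 := by linarith [hc.2]
      positivity
    have c2 : ContinuousOn (fun c => vc c^(n+1)/(3*(1-c))) (Icc (-1) (-1/2)) := by
      have := vc_cont
      refine ContinuousOn.div (by fun_prop) (by fun_prop) fun c hc => ?_
      have :1-c≠0 := by linarith [hc.2]
      positivity
    have e := (((lim0 c1).mul fB_lim0).sub ((lim0 c2).mul pB_lim0))
    refine (cl e (by rw [vc]; simp)).congr' ?_
    filter_upwards [nhJ0] with c hc
    have := one_sub_ne hc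
    simp only [pow_succ]
    generalize vc c^n = V
    rw [show vc c = (1+c)/(3*(1-c)) from rfl]
    field_simp
    ring
  · have c1 : ContinuousOn (fun c => vc c^(n+1)*((4*c^2-1)*(2*n+3+c))/(3*(1-c))) (Icc (-1) (-1/2)) := by
      have := vc_cont
      refine ContinuousOn.div (by fun_prop) (by fun_prop) fun c hc => ?_
      have :1-c≠0 := by linarith [hc.2]
      positivity
    have c2 : ContinuousOn (fun c => vc c^(n+1)/(3*(1-c))) (Icc (-1) (-1/2)) := by
      have := vc_cont
      refine ContinuousOn.div (by fun_prop) (by fun_prop) fun c hc => ?_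
      have :1-c≠0 := by linarith [hc.2]
      positivity
    have e := (((lim1 c1).mul fB_lim1).sub ((lim1 c2).mul pB_lim1))
    refine (cl e (by norm_num)).congr' ?_
    filter_upwards [nhJ1] with c hc
    ring
def kB (c:ℝ) : ℝ := (fB c-3*(2*c+1)*gB' c/(2*c-1))/6
lemma kB_cont : ContinuousOn kB JJ := by
  have h := fB_contJ; have := gB'_contJ
  refine (ContinuousOn.sub h (ContinuousOn.div (by fun_prop) (by fun_prop) fun c hc => (JJ_facts hc).2.2.2.2.2.1.ne)).div_const 6
lemma kB_bd {c:ℝ} (h : c ∈ JJ) : |kB c| ≤1*(1+fA c^2+fB c^2) := by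
  obtain ⟨h1, h2, h3, h4, h5, h6, h7⟩ := JJ_facts h
  have b := (fB_bd h).1
  obtain ⟨-, -, g0, g1⟩ := g_bd (Ioo_subset_Icc_self h)
  have r0 :0 ≤ (2*c+1)/(2*c-1) := div_nonneg_of_nonpos h7.le h6.le
  have r1 : (2*c+1)/(2*c-1)≤1 := by rw [div_le_iff_of_neg h6]; linarith
  have e : kB c = (fB c-3*((2*c+1)/(2*c-1)*gB' c))/6 := by rw [kB]; ring
  have p0 :0 ≤ (2*c+1)/(2*c-1)*gB' c := mul_nonneg r0 g0
  have p1 : (2*c+1)/(2*c-1)*gB' c≤1 := by nlinarith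
  rw [e, abs_le]
  constructor <;> nlinarith [sq_nonneg (fA c)]
lemma v9 {c:ℝ} (h : c ∈ JJ) :0≤9*vc c ∧ 9*vc c<1 := by
  have := vc_mem h; constructor <;> linarith
lemma k_int (n:ℕ) : IntervalIntegrable (fun c => (9*vc c)^n*kB c) volume (-1) (-1/2) := by
  have := kB_cont; have := vc_contJ
  refine intJ (C :=1) (by fun_prop) (fun c h => ?_) (by norm_num)
  have v := v9 h
  rw [abs_mul, abs_of_nonneg (pow_nonneg v.1 n)]
  exact (mul_le_of_le_one_left (abs_nonneg _) (pow_le_one₀ v.1 v.2.le)).trans (kB_bd h)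
lemma mu_asy (n:ℕ) : n*(9^n*mu n) + ∫ c in (-1:ℝ)..(-1/2), (9*vc c)^n*kB c=1/12 := by
  have key := ftcJ (f := fun c => 9^n*(vc c^n*((1+c)*fB c/6)))
    (f' := fun c => (n*9^n)*mf n c+(9*vc c)^n*kB c) (a :=0) (b :=1/12) ?_
    (((mf_int n).const_mul _).add (k_int n)) ?_ ?_
  · rw [intervalIntegral.integral_add ((mf_int n).const_mul _) (k_int n), intervalIntegral.integral_const_mul] at key
    rw [mu, ← mul_assoc, key]; ring
  · intro c h
    obtain ⟨h1, h2, h3, h4, h5, h6, h7⟩ := JJ_facts h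
    have d := ((vpow_deriv h n).mul ((((hasDerivAt_id c).const_add 1).mul (fB_deriv h)).div_const 6)).const_mul (9^n)
    refine d.congr_deriv ?_
    simp only [id, mf, kB, Pi.mul_apply, mul_pow]
    rw [pB_eq]
    generalize vc c^n = V
    generalize fB c = a
    generalize gB' c = b
    rw [show 1-c^2 = (1-c)*(1+c) by ring, show 4*c^2-1 = (2*c-1)*(2*c+1) by ring]
    have := h6.ne
    have := h7.ne
    field_simp
    ring
  · have c1 : ContinuousOn (fun c => 9^n*vc c^n/6) (Icc (-1) (-1/2)) := by
      have := vc_cont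
      fun_prop
    refine (cl ((lim0 c1).mul fB_lim0) (by norm_num)).congr fun c => ?_
    ring
  · have c1 : ContinuousOn (fun c => 9^n*vc c^n*(1+c)/6) (Icc (-1) (-1/2)) := by
      have := vc_cont
      fun_prop
    refine (cl ((lim1 c1).mul fB_lim1) ?_).congr fun c => ?_
    · rw [show vc (-1/2)=1/9 by rw [vc]; norm_num]; rw [← mul_pow]; norm_num
    · ring
lemma mu_lim : Tendsto (fun n:ℕ => n*(9^n*mu n)) atTop (𝓝 (1/12)) := by
  have h : Tendsto (fun n:ℕ => ∫ c in JJ, (9*vc c)^n*kB c) atTop (𝓝 (∫ c in JJ, (0:ℝ))) := by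
    have hk := k_int 0
    rw [intervalIntegrable_iff_integrableOn_Ioo_of_le (by norm_num)] at hk
    refine tendsto_integral_of_dominated_convergence (fun c => |kB c|) (fun n => ?_) ?_ (fun n => ?_) ?_
    · have := kB_cont; have := vc_contJ
      exact ContinuousOn.aestronglyMeasurable (by fun_prop) measurableSet_Ioo
    · simpa using hk.abs
    · refine aeJ fun c h => ?_
      have v := v9 h
      rw [norm_mul, norm_eq_abs, norm_eq_abs, abs_of_nonneg (pow_nonneg v.1 n)]
      exact mul_le_of_le_one_left (abs_nonneg _) (pow_le_one₀ v.1 v.2.le)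
    · refine aeJ fun c h => ?_
      have v := v9 h
      simpa using (tendsto_pow_atTop_nhds_zero_of_lt_one v.1 v.2).mul_const (kB c)
  have := h.const_sub (1/12)
  simp only [integral_zero, sub_zero] at this
  refine this.congr fun n => ?_
  rw [← iJ, ← mu_asy n]; ring
lemma small_of {x:ℕ → ℝ} {L:ℝ} (h : Tendsto (fun n:ℕ => n*x n) atTop (𝓝 L)) : Tendsto x atTop (𝓝 0) := by
  have := h.mul (tendsto_one_div_atTop_nhds_zero_nat (𝕜 := ℝ))
  rw [mul_zero] at this
  refine this.congr' ?_
  filter_upwards [eventually_ge_atTop 1] with n hn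
  have : (n:ℝ)≠0 := by positivity
  field_simp
lemma cross (n:ℕ) : mn (n+1)*mu n-mn n*mu (n+1)=0 := by
  set D:ℕ → ℝ := fun n => mn (n+1)*mu n-mn n*mu (n+1) with hD
  have hrec : ∀ n:ℕ,9*(((n:ℝ)+2)^2*D (n+1)) = ((n:ℝ)+1)^2*D n := fun n => by
    simp only [hD]
    linear_combination (mu (n+1))*mn_rec n-(mn (n+1))*mu_rec n
  have cst : ∀ n:ℕ,9^n*(((n:ℝ)+1)^2*D n) = D 0 := fun n => by
    induction n with
    | zero => norm_num
    | succ n ih => rw [← ih]; push_cast; rw [pow_succ]; linear_combination (9^n)*hrec n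
  have L := mn_lim
  have U := mu_lim
  have L1 := (tendsto_add_atTop_iff_nat 1).2 L
  have U1 := (tendsto_add_atTop_iff_nat 1).2 U
  have l0 := small_of L
  have u0 := small_of U
  have g : Tendsto (fun n:ℕ => (1/9:ℝ)^(n+1)) atTop (𝓝 0) :=
    (tendsto_add_atTop_iff_nat 1).2 (tendsto_pow_atTop_nhds_zero_of_lt_one (by norm_num) (by norm_num))
  have tot := g.mul ((L1.mul (U.add u0)).sub (U1.mul (L.add l0)))
  rw [zero_mul] at tot
  have D0 : D 0=0 := by
    refine tendsto_nhds_unique (tendsto_const_nhds (x := D 0) (f := (atTop : Filter ℕ))) (tot.congr fun n => ?_)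
    rw [← cst n]
    simp only [hD]
    have e : (1/9:ℝ)^(n+1)*9^(n+1)=1 := by rw [← mul_pow]; norm_num
    push_cast
    linear_combination (9^n*((n:ℝ)+1)^2*(mn (n+1)*mu n-mn n*mu (n+1)))*e
  have := cst n
  rw [D0] at this
  have p : (0:ℝ)<9^n*((n:ℝ)+1)^2 := by positivity
  apply mul_left_cancel₀ p.ne'
  simp only [hD] at this
  linarith
lemma mn_eq (n:ℕ) : mn n = √3*π*mu n := by
  have r : ∀ n, mn n = mn 0/mu 0*mu n := fun n => by
    induction n with
    | zero => have := mu_pos 0; field_simp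
    | succ n ih =>
      have h := cross n
      have := mu_pos n
      have := mu_pos 0
      apply mul_left_cancel₀ (mu_pos n).ne'
      rw [ih] at h
      linarith
  have h := (mu_lim.const_mul (mn 0/mu 0))
  have e : mn 0/mu 0*(1/12) = π/(4*√3) := by
    refine tendsto_nhds_unique h (mn_lim.congr fun n => ?_)
    rw [r n]; ring
  have s3 : √3*√3=3 := Real.mul_self_sqrt (by norm_num)
  have sp : √3≠0 := by positivity
  rw [r n]
  have : mn 0/mu 0 = √3*π := by
    generalize mn 0/mu 0 = k at e ⊢
    field_simp at e
    linear_combination √3/12*e-k*s3/3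
  rw [this]
lemma AB_int : IntervalIntegrable (fun c => fA c*fB c) volume (-1) (-1/2) := by
  refine intJ (C :=1) (fA_contJ.mul fB_contJ) (fun c _ => ?_) (by norm_num)
  rw [abs_le]
  constructor <;> nlinarith [sq_nonneg (fA c+fB c), sq_nonneg (fA c-fB c)]
lemma I33_eq : I33 = √3*π*(1/6) * ∫ c in (-1:ℝ)..(-1/2), fA c*fB c := by
  have h := tonelliJ (F := fun n c => √3*π*(an n*mf n c)) (f := fun c => √3*π*(1/6)*(fA c*fB c))
    (fun n => by have := mf_cont n; fun_prop)
    (fun n c h => by have := mf_pos n h; have := an_nonneg n; positivity)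
    (fun c h => by
      have s := ((F_sums (vc_abs h)).1.mul_left (√3*π*fB c/(3*(1-c))))
      have := one_sub_ne h
      rw [F0_eq h] at s
      rw [show √3*π*(1/6)*(fA c*fB c) = √3*π*fB c/(3*(1-c))*((1-c)/2*fA c) by field_simp; ring]
      refine s.congr_fun fun n => ?_
      rw [mf]; field_simp) (AB_int.const_mul _)
  rw [intervalIntegral.integral_const_mul] at h
  rw [← h.unique (I33_sum.congr_fun fun n => ?_)]
  simp only [intervalIntegral.integral_const_mul]
  rw [mn_eq, mu]; ring
def XA (c:ℝ) : ℝ :=2*fA c+3*(2*c-1)*gA c/(1-c)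
def XB (c:ℝ) : ℝ :=2*fB c-3*(2*c+1)^2*gB' c/((1+c)*(2*c-1))
lemma XA_eq {c:ℝ} (h : c ∈ JJ) : XA c=2*fA c+pA c/((1-c^2)*(2*c-1)) := by
  obtain ⟨h1, h2, h3, h4, h5, h6, h7⟩ := JJ_facts h
  have := h6.ne
  rw [XA, pA_eq, show 1-c^2 = (1-c)*(1+c) by ring]; field_simp
lemma XB_eq {c:ℝ} (h : c ∈ JJ) : XB c=2*fB c+pB c/((1-c^2)*(2*c-1)) := by
  obtain ⟨h1, h2, h3, h4, h5, h6, h7⟩ := JJ_facts h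
  have := h6.ne
  rw [XB, pB_eq, show 1-c^2 = (1-c)*(1+c) by ring]; field_simp; ring
lemma XA_cont : ContinuousOn XA JJ := by
  have h := fA_contJ; have := gA_contJ
  unfold XA
  refine ContinuousOn.add (by fun_prop) (ContinuousOn.div (by fun_prop) (by fun_prop) fun c hc => one_sub_ne hc)
lemma XB_cont : ContinuousOn XB JJ := by
  have h := fB_contJ; have := gB'_contJ
  unfold XB
  refine ContinuousOn.sub (by fun_prop) (ContinuousOn.div (by fun_prop) (by fun_prop) fun c hc =>
    mul_ne_zero (JJ_facts hc).1.ne' (JJ_facts hc).2.2.2.2.2.1.ne)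
lemma XA_bd {c:ℝ} (h : c ∈ JJ) : |XA c| ≤9*fA c := by
  obtain ⟨h1, h2, h3, h4, h5, h6, h7⟩ := JJ_facts h
  have b := (fA_bd h).1
  obtain ⟨g0, g1, -, -⟩ := g_bd (Ioo_subset_Icc_self h)
  have r0 : (2*c-1)/(1-c)≤0 := div_nonpos_of_nonpos_of_nonneg h6.le h3.le
  have r1 : -2 ≤ (2*c-1)/(1-c) := by rw [le_div_iff₀ h3]; linarith
  have e : XA c=2*fA c+3*((2*c-1)/(1-c)*gA c) := by rw [XA]; ring
  have p0 : (2*c-1)/(1-c)*gA c≤0 := mul_nonpos_of_nonpos_of_nonneg r0 g0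
  have p1 : -2 ≤ (2*c-1)/(1-c)*gA c := by nlinarith
  rw [e, abs_le]
  constructor <;> linarith
lemma XB_bd {c:ℝ} (h : c ∈ JJ) :0 ≤ XB c ∧ (1+c)*XB c≤9*fB c := by
  obtain ⟨h1, h2, h3, h4, h5, h6, h7⟩ := JJ_facts h
  have b := (fB_bd h).1
  obtain ⟨-, -, g0, g1⟩ := g_bd (Ioo_subset_Icc_self h)
  have r0 : (2*c+1)^2/(2*c-1)≤0 := div_nonpos_of_nonneg_of_nonpos (sq_nonneg _) h6.le
  have r1 : -1 ≤ (2*c+1)^2/(2*c-1) := by rw [le_div_iff_of_neg h6]; nlinarith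
  have e : (1+c)*XB c = (1+c)*2*fB c-3*((2*c+1)^2/(2*c-1)*gB' c) := by rw [XB]; field_simp
  have p0 : (2*c+1)^2/(2*c-1)*gB' c≤0 := mul_nonpos_of_nonpos_of_nonneg r0 g0
  have p1 : -1 ≤ (2*c+1)^2/(2*c-1)*gB' c := by nlinarith
  have q :0 ≤ (1+c)*XB c := by rw [e]; have := mul_pos h1 (show 0 < fB c by linarith); linarith
  refine ⟨nonneg_of_mul_nonneg_right q h1, ?_⟩
  rw [e]; nlinarith
lemma vX_int (n:ℕ) : IntervalIntegrable (fun c => vc c^(n+1)*XB c) volume (-1) (-1/2) := by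
  have := vc_contJ; have := XB_cont
  refine intJ (C :=9) (by fun_prop) (fun c h => ?_) (by norm_num)
  obtain ⟨h1, h2, h3, h4, h5, h6, h7⟩ := JJ_facts h
  have v := vc_mem h
  have b := XB_bd h
  have hb := (fB_bd h).1
  rw [abs_of_nonneg (mul_nonneg (pow_nonneg v.1.le _) b.1)]
  have : vc c^n≤1 := pow_le_one₀ v.1.le (by linarith [v.2])
  have v2 : vc c≤1+c := by rw [vc]; exact div_le_self h1.le (by linarith)
  calc vc c^(n+1)*XB c = vc c^n*(vc c*XB c) := by ring
    _≤1*((1+c)*XB c) := by gcongr; exact mul_nonneg v.1.le b.1; exact b.1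
    _≤9*(1+fA c^2+fB c^2) := by nlinarith [sq_nonneg (fA c)]
lemma mu_diff (n:ℕ) : ((n:ℝ)+1)*(mu n-9*mu (n+1)) = ∫ c in (-1:ℝ)..(-1/2), vc c^(n+1)*XB c := by
  have key := ftcJ (f := fun c => vc c^(n+1)*((1+2*c)*fB c))
    (f' := fun c => vc c^(n+1)*XB c-((n:ℝ)+1)*(mf n c-9*mf (n+1) c)) (a :=0) (b :=0) ?_
    ((vX_int n).sub (((mf_int n).sub ((mf_int _).const_mul 9)).const_mul _)) ?_ ?_
  · rw [intervalIntegral.integral_sub (vX_int n) (((mf_int n).sub ((mf_int _).const_mul 9)).const_mul _),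
      intervalIntegral.integral_const_mul, intervalIntegral.integral_sub (mf_int n) ((mf_int _).const_mul 9),
      intervalIntegral.integral_const_mul] at key
    rw [mu, mu]; linarith
  · intro c h
    obtain ⟨h1, h2, h3, h4, h5, h6, h7⟩ := JJ_facts h
    have d := ((vpow_deriv h (n+1)).mul ((((hasDerivAt_id c).const_mul 2).const_add 1).mul (fB_deriv h)))
    refine d.congr_deriv ?_
    simp only [id, mf, XB_eq h, Pi.mul_apply, pow_succ (vc c) n]
    have e : (1+2*c)*(pB c/((1-c^2)*(4*c^2-1))) = pB c/((1-c^2)*(2*c-1)) := by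
      rw [mul_div_assoc', div_eq_div_iff (by positivity) (mul_ne_zero h5.ne' h6.ne)]; ring
    rw [e]
    generalize vc c^n = V
    generalize fB c = a
    generalize pB c = b
    rw [show 1-c^2 = (1-c)*(1+c) by ring, show vc c = (1+c)/(3*(1-c)) from rfl]
    push_cast
    have := h6.ne
    field_simp
    ring
  · have c1 : ContinuousOn (fun c => vc c^n*(1+2*c)/(3*(1-c))) (Icc (-1) (-1/2)) := by
      have := vc_cont
      refine ContinuousOn.div (by fun_prop) (by fun_prop) fun c hc => ?_
      have :1-c≠0 := by linarith [hc.2]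
      positivity
    refine (cl ((lim0 c1).mul fB_lim0) (by norm_num)).congr fun c => ?_
    rw [pow_succ]
    generalize vc c^n = V
    rw [show vc c = (1+c)/(3*(1-c)) from rfl]; ring
  · have c1 : ContinuousOn (fun c => vc c^(n+1)*(1+2*c)) (Icc (-1) (-1/2)) := by
      have := vc_cont
      fun_prop
    refine (cl ((lim1 c1).mul fB_lim1) (by norm_num)).congr fun c => ?_
    ring
lemma XX_int : IntervalIntegrable (fun c => (1-c^2)*(XA c*XB c)) volume (-1) (-1/2) := by
  have := XA_cont; have := XB_cont
  refine intJ (C :=162) (by fun_prop) (fun c h => ?_) (by norm_num)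
  obtain ⟨h1, h2, h3, h4, h5, h6, h7⟩ := JJ_facts h
  have a := XA_bd h
  have b := XB_bd h
  have ha := (fA_bd h).1
  have hb := (fB_bd h).1
  rw [show (1-c^2)*(XA c*XB c) = (1-c)*(XA c*((1+c)*XB c)) by ring, abs_mul, abs_mul,
    abs_of_pos h3, abs_of_nonneg (mul_nonneg h1.le b.1)]
  calc (1-c)*(|XA c| * ((1+c)*XB c))≤2*((9*fA c)*(9*fB c)) := by
        have := h.1
        have := mul_nonneg h1.le b.1
        exact mul_le_mul (by linarith) (mul_le_mul a b.2 this (by positivity)) (by positivity) (by norm_num)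
    _ ≤ _ := by nlinarith [sq_nonneg (fA c-fB c), sq_nonneg (fA c), sq_nonneg (fB c)]
lemma YY_eq : YY = √3*π*(1/18) * ∫ c in (-1:ℝ)..(-1/2), (1-c^2)*(XA c*XB c) := by
  have h := tonelliJ (F := fun n c => √3*π/9*(((n:ℝ)+1)*(9*an n-an (n+1)))*(vc c^(n+1)*XB c))
    (f := fun c => √3*π*(1/18)*((1-c^2)*(XA c*XB c)))
    (fun n => by have := XB_cont; have := vc_contJ; fun_prop)
    (fun n c h => by
      have := (vc_mem h).1; have := an_le n; have := (XB_bd h).1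
      have :0≤9*an n-an (n+1) := by linarith
      positivity)
    (fun c h => by
      obtain ⟨s0, s1, -⟩ := F_sums (vc_abs h)
      obtain ⟨h1, h2, h3, h4, h5, h6, h7⟩ := JJ_facts h
      have s2 := (hasSum_nat_add_iff' 1).2 s1
      have s := ((s1.add s0).mul_left (9*vc c)).sub s2
      simp only [Finset.sum_range_one, CharP.cast_eq_zero, zero_mul, sub_zero] at s
      have e : √3*π*(1/18)*((1-c^2)*(XA c*XB c)) =
          √3*π/9*XB c*(9*vc c*(F1 (vc c)+F0 (vc c))-F1 (vc c)) := by
        have eb : pA c/((1-c^2)*(2*c-1)) = pA c/(4*c^2-1)*(2*c+1)/(1-c^2) := by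
          rw [div_mul_eq_mul_div, div_div, div_eq_div_iff (mul_ne_zero h5.ne' h6.ne) (by positivity)]; ring
        rw [F0_eq h, F1_eq h, XA_eq h, eb]
        generalize fA c = a
        generalize pA c/(4*c^2-1) = b
        generalize XB c = x
        rw [show 1-c^2 = (1-c)*(1+c) by ring, show vc c = (1+c)/(3*(1-c)) from rfl]
        field_simp
        ring
      rw [e]
      refine (s.mul_left (√3*π/9*XB c)).congr_fun fun n => ?_
      push_cast
      ring) (XX_int.const_mul _)
  rw [intervalIntegral.integral_const_mul] at h
  rw [← h.unique (YY_sum.congr_fun fun n => ?_)]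
  rw [intervalIntegral.integral_const_mul, ← mu_diff, mn_eq, mn_eq]; ring
def pe : List ℝ → ℝ → ℝ
  | [], _ => 0
  | a :: l, x => a+x*pe l x
def dpe : List ℝ → ℝ → ℝ
  | [], _ => 0
  | _ :: l, x => pe l x+x*dpe l x
lemma pe_deriv (l : List ℝ) (x:ℝ) : HasDerivAt (pe l) (dpe l x) x := by
  induction l with
  | nil => exact hasDerivAt_const x 0
  | cons a l ih =>
    refine (((hasDerivAt_id x).mul ih).const_add a).congr_deriv ?_
    simp [dpe]
lemma pe_derivu (l : List ℝ) (c:ℝ) : HasDerivAt (fun c => pe l (2*c-1)) (2*dpe l (2*c-1)) c := by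
  have := (pe_deriv l (2*c-1)).comp c (((hasDerivAt_id c).const_mul 2).sub_const 1)
  exact this.congr_deriv (by ring)
def lr : List ℝ := [-11/432,55/432,55/432, -55/432, -55/432, -11/432]
def lq : List ℝ := [5/27, -5/864, -175/576,55/72,275/288, -55/216, -275/432, -55/216, -55/1728]
def lpp : List ℝ := [5/6,1/3, -55/108, -35/216,265/864, -47/96, -385/432, -55/432,55/144,55/216,55/864,5/864]
def sg (c:ℝ) : ℝ := -2560*c^7+3840*c^5-1600*c^3+170*c
lemma fA_int : IntervalIntegrable fA volume (-1) (-1/2) := by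
  refine intJ (C :=1) fA_contJ (fun c h => ?_) (by norm_num)
  rw [abs_of_pos (by linarith [(fA_bd h).1])]; nlinarith [sq_nonneg (fA c-1), sq_nonneg (fB c)]
lemma fB_int : IntervalIntegrable fB volume (-1) (-1/2) := by
  refine intJ (C :=1) fB_contJ (fun c h => ?_) (by norm_num)
  rw [abs_of_pos (by linarith [(fB_bd h).1])]; nlinarith [sq_nonneg (fB c-1), sq_nonneg (fA c)]
lemma uI : Set.uIcc (-1:ℝ) (-1/2) = Icc (-1) (-1/2) := Set.uIcc_of_le (by norm_num)
lemma sN_int : IntervalIntegrable (fun c => sg c*(fA c*pB c+pA c*fB c)) volume (-1) (-1/2) := by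
  have ca : ContinuousOn (fun c => sg c*pB c) (uIcc (-1) (-1/2)) := by
    rw [uI]; have := pB_cont; unfold sg; fun_prop
  have cb : ContinuousOn (fun c => sg c*pA c) (uIcc (-1) (-1/2)) := by
    rw [uI]; have := pA_cont; unfold sg; fun_prop
  refine ((fA_int.mul_continuousOn ca).add (fB_int.mul_continuousOn cb)).congr ?_
  exact fun c _ => by show _ = _; ring
lemma Z_eq1 (c:ℝ) :2*dpe lpp (2*c-1)+4*(4*c^2-1)*pe lq (2*c-1)=10/9*(1-c^2)-1/6 := by
  simp only [lpp, lq, pe, dpe]; ring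
lemma Z_eq3 {c:ℝ} (h :2*c-1≠0) :2*pe lq (2*c-1)+(1-c^2)*(4*c^2-1)*(10/27/(2*c-1)^2+2*dpe lr (2*c-1))
    =5/18*(2*c+1)/(2*c-1) := by
  simp only [lr, lq, pe, dpe]; field_simp; ring
lemma Z_eq2 {c:ℝ} (h :2*c-1≠0) : pe lpp (2*c-1) = (1-c^2)*(4*c^2-1)*(5/9/(2*c-1)+21/720*sg c
    - 2*dpe lq (2*c-1)-2*(4*c^2-1)*(-5/27/(2*c-1)+pe lr (2*c-1))) := by
  simp only [lr, lq, lpp, sg, pe, dpe]; field_simp; ring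
lemma u_deriv {c:ℝ} (h :2*c-1≠0) : HasDerivAt (fun c:ℝ => -5/27/(2*c-1)) (10/27/(2*c-1)^2) c := by
  have := (hasDerivAt_const c (-5/27:ℝ)).div (((hasDerivAt_id c).const_mul 2).sub_const 1) h
  refine this.congr_deriv ?_
  simp only [id]; ring
lemma contl1 {f:ℝ → ℝ} (h : ContinuousAt f (-1/2)) : Tendsto f (𝓝[<] (-1/2)) (𝓝 (f (-1/2))) :=
  h.tendsto.mono_left nhdsWithin_le_nhds
lemma cid :5*YY-I33-5/12 = -(√3*π*(21/720)) * ∫ c in (-1:ℝ)..(-1/2), sg c*(fA c*pB c+pA c*fB c) := by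
  have key := ftcJ (f := fun c => pe lpp (2*c-1)*(fA c*fB c)+pe lq (2*c-1)*(fA c*pB c+pA c*fB c)
      + (-5/27/(2*c-1)+pe lr (2*c-1))*(pA c*pB c))
    (f' := fun c => 5/18*((1-c^2)*(XA c*XB c))-1/6*(fA c*fB c)+21/720*(sg c*(fA c*pB c+pA c*fB c)))
    (a := -(5*√3/(36*π))) (b :=0) ?_ (((XX_int.const_mul _).sub (AB_int.const_mul _)).add (sN_int.const_mul _)) ?_ ?_
  · rw [intervalIntegral.integral_add ((XX_int.const_mul _).sub (AB_int.const_mul _)) (sN_int.const_mul _),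
      intervalIntegral.integral_sub (XX_int.const_mul _) (AB_int.const_mul _)] at key
    simp only [intervalIntegral.integral_const_mul] at key
    rw [YY_eq, I33_eq]
    have s3 : √3*√3=3 := Real.mul_self_sqrt (by norm_num)
    have e : √3*π*(5*√3/(36*π))=5/12 := by field_simp; linear_combination 12*s3
    linear_combination (√3*π)*key+e
  · intro c h
    obtain ⟨h1, h2, h3, h4, h5, h6, h7⟩ := JJ_facts h
    have e1 := Z_eq1 c
    have e2 := Z_eq2 h6.ne
    have e3 := Z_eq3 h6.ne
    have dA := fA_deriv h
    have dB := fB_deriv h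
    have dpA := pA_deriv h
    have dpB := pB_deriv h
    have d := (((pe_derivu lpp c).mul (dA.mul dB)).add ((pe_derivu lq c).mul ((dA.mul dpB).add (dpA.mul dB)))).add
      (((u_deriv h6.ne).add (pe_derivu lr c)).mul (dpA.mul dpB))
    refine d.congr_deriv ?_
    simp only [Pi.mul_apply, Pi.add_apply, XA_eq h, XB_eq h]
    rw [e2]
    have e3' : pe lq (2*c-1)*2=5/18*(2*c+1)/(2*c-1)-(1-c^2)*(4*c^2-1)*(10/27/(2*c-1)^2+2*dpe lr (2*c-1)) := by
      linarith
    have f1 : (1-c^2)*(4*c^2-1)≠0 := by positivity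
    have f2 : (1-c^2)*(pB c/((1-c^2)*(2*c-1))) = pB c/(2*c-1) := by field_simp
    have f3 : (1-c^2)*(pA c/((1-c^2)*(2*c-1))) = pA c/(2*c-1) := by field_simp
    have f4 : pe lq (2*c-1)*2/((1-c^2)*(4*c^2-1))=5/18/((1-c^2)*(2*c-1)^2)-(10/27/(2*c-1)^2+2*dpe lr (2*c-1)) := by
      rw [e3', sub_div, mul_div_cancel_left₀ _ f1]
      congr 1
      rw [div_div, div_eq_div_iff (mul_ne_zero h6.ne f1) (mul_ne_zero h5.ne' (pow_ne_zero 2 h6.ne))]; ring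
    have f5 : ∀ x y:ℝ, (1-c^2)*(4*c^2-1)*x*(y/((1-c^2)*(4*c^2-1))) = x*y := fun x y => by
      have gen : ∀ W:ℝ, W≠0 → W*x*(y/W) = x*y := fun W hW => by field_simp
      exact gen _ f1
    have f6 : pA c*pB c/((1-c^2)*(2*c-1)^2) = (1-c^2)*(pA c/((1-c^2)*(2*c-1))*(pB c/((1-c^2)*(2*c-1)))) := by
      field_simp
    generalize hr : -5/27/(2*c-1)+pe lr (2*c-1) = r at *
    generalize hr' :10/27/(2*c-1)^2+2*dpe lr (2*c-1) = r' at *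
    generalize hK :5/9/(2*c-1)+21/720*sg c-2*dpe lq (2*c-1)-2*(4*c^2-1)*r = k at *
    have g1 := f5 k (pA c*fB c+fA c*pB c)
    linear_combination (fA c*fB c)*e1+(pA c*pB c)*f4+g1-(pA c*fB c+fA c*pB c)*hK
      - 5/9*fA c*f2-5/9*fB c*f3+5/18*f6
  · have cp : ContinuousAt (fun c:ℝ => (1-c)*(4*c^2-1)*(5/9/(2*c-1)+21/720*sg c
       - 2*dpe lq (2*c-1)-2*(4*c^2-1)*(-5/27/(2*c-1)+pe lr (2*c-1)))) (-1) := by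
      simp only [lq, lr, sg, pe, dpe]
      have h : ContinuousAt (fun c:ℝ => (2*c-1)⁻¹) (-1) := ContinuousAt.inv₀ (by fun_prop) (by norm_num)
      have dv : ∀ a c:ℝ, a/(2*c-1) = a*(2*c-1)⁻¹ := fun a c => div_eq_mul_inv _ _
      simp only [dv]
      fun_prop
    have cr : ContinuousAt (fun c:ℝ => -5/27/(2*c-1)+pe lr (2*c-1)) (-1) :=
      (u_deriv (by norm_num)).continuousAt.add (pe_derivu lr _).continuousAt
    have cq := (pe_derivu lq (-1)).continuousAt
    have t := (((contl0 cp).mul (fB_lim0.mul fA_lim0)).add ((contl0 cq).mul ((fA_lim0.mul pB_lim0).add pAfB_lim0))).add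
      ((contl0 cr).mul (pA_lim0.mul pB_lim0))
    refine (cl t ?_).congr' ?_
    · have e : pe lq (2 * -1-1)=5/108 := by simp only [lq, pe]; norm_num
      rw [e]; ring
    · filter_upwards [nhJ0] with c hc
      rw [Z_eq2 (JJ_facts hc).2.2.2.2.2.1.ne]; ring
  · have cp : ContinuousAt (fun c:ℝ => (1-c^2)*(2*c-1)*(5/9/(2*c-1)+21/720*sg c
       - 2*dpe lq (2*c-1)-2*(4*c^2-1)*(-5/27/(2*c-1)+pe lr (2*c-1)))) (-1/2) := by
      simp only [lq, lr, sg, pe, dpe]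
      have h : ContinuousAt (fun c:ℝ => (2*c-1)⁻¹) (-1/2) := ContinuousAt.inv₀ (by fun_prop) (by norm_num)
      have dv : ∀ a c:ℝ, a/(2*c-1) = a*(2*c-1)⁻¹ := fun a c => div_eq_mul_inv _ _
      simp only [dv]
      fun_prop
    have cr : ContinuousAt (fun c:ℝ => -5/27/(2*c-1)+pe lr (2*c-1)) (-1/2) :=
      (u_deriv (by norm_num)).continuousAt.add (pe_derivu lr _).continuousAt
    have cq := (pe_derivu lq (-1/2)).continuousAt
    have t := (((contl1 cp).mul (fA_lim1.mul fB_lim1)).add ((contl1 cq).mul (pBfA_lim1.add (pA_lim1.mul fB_lim1)))).add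
      ((contl1 cr).mul (pA_lim1.mul pB_lim1))
    refine (cl t ?_).congr' ?_
    · simp only [lq, pe]; norm_num
    · filter_upwards [nhJ1] with c hc
      rw [Z_eq2 (JJ_facts hc).2.2.2.2.2.1.ne]; ring
def Lg:ℕ → ℝ → ℝ
  | 0, _ => 1
  | 1, y => y
  | n+2, y => ((2*(n:ℝ)+3)*y*Lg (n+1) y-((n:ℝ)+1)*Lg n y)/((n:ℝ)+2)
def dL:ℕ → ℝ → ℝ
  | 0, _ => 0
  | 1, _ => 1
  | n+2, y => ((2*(n:ℝ)+3)*(Lg (n+1) y+y*dL (n+1) y)-((n:ℝ)+1)*dL n y)/((n:ℝ)+2)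
lemma Lg_rec (n:ℕ) (y:ℝ) : ((n:ℝ)+2)*Lg (n+2) y = (2*(n:ℝ)+3)*y*Lg (n+1) y-((n:ℝ)+1)*Lg n y := by
  have : (n:ℝ)+2≠0 := by positivity
  rw [Lg]; field_simp
lemma dL_rec (n:ℕ) (y:ℝ) : ((n:ℝ)+2)*dL (n+2) y
    = (2*(n:ℝ)+3)*(Lg (n+1) y+y*dL (n+1) y)-((n:ℝ)+1)*dL n y := by
  have : (n:ℝ)+2≠0 := by positivity
  rw [dL]; field_simp
lemma Lg_deriv2 (y:ℝ) (n:ℕ) : HasDerivAt (Lg n) (dL n y) y ∧ HasDerivAt (Lg (n+1)) (dL (n+1) y) y := by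
  induction n with
  | zero =>
    constructor
    · rw [show Lg 0 = fun _ => 1 from funext fun x => by rw [Lg], dL]; exact hasDerivAt_const _ _
    · rw [show Lg (0+1) = fun x => x from funext fun x => by rw [zero_add, Lg], zero_add, dL]; exact hasDerivAt_id _
  | succ n ih =>
    refine ⟨ih.2, ?_⟩
    rw [show Lg (n+1+1) = fun y => ((2*(n:ℝ)+3)*(y*Lg (n+1) y)-((n:ℝ)+1)*Lg n y)/((n:ℝ)+2) from
      funext fun x => by rw [Lg]; ring, show dL (n+1+1) y = _ from by rw [dL]]
    refine (((((hasDerivAt_id y).mul ih.2).const_mul _).sub (ih.1.const_mul _)).div_const _).congr_deriv ?_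
    simp
lemma Lg_deriv (n:ℕ) (y:ℝ) : HasDerivAt (Lg n) (dL n y) y := (Lg_deriv2 y n).1
lemma Lg_ab (y:ℝ) (n:ℕ) : y*dL (n+1) y-dL n y = ((n:ℝ)+1)*Lg (n+1) y ∧
    dL (n+1) y-y*dL n y = ((n:ℝ)+1)*Lg n y := by
  induction n with
  | zero => simp [Lg, dL]
  | succ n ih =>
    obtain ⟨a, b⟩ := ih
    have r := Lg_rec n y
    have d := dL_rec n y
    have p : (n:ℝ)+2≠0 := by positivity
    have b' : dL (n+1+1) y-y*dL (n+1) y = ((n:ℝ)+2)*Lg (n+1) y := by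
      apply mul_left_cancel₀ p
      linear_combination d+((n:ℝ)+1)*a
    push_cast
    refine ⟨?_, by linear_combination b'⟩
    linear_combination y*b'+y*a-b-r
lemma Lg_c (n:ℕ) (y:ℝ) : (1-y^2)*dL (n+1) y = ((n:ℝ)+1)*(Lg n y-y*Lg (n+1) y) := by
  obtain ⟨a, b⟩ := Lg_ab y n
  linear_combination b-y*a
lemma Lg_d (n:ℕ) (y:ℝ) : dL (n+2) y-dL n y = (2*(n:ℝ)+3)*Lg (n+1) y := by
  have a := (Lg_ab y n).1
  have b := (Lg_ab y (n+1)).2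
  push_cast at b
  linear_combination a+b
lemma Lg_e (n:ℕ) (y:ℝ) : (2*(n:ℝ)+3)*((1-y^2)*dL (n+1) y) = ((n:ℝ)+1)*((n:ℝ)+2)*(Lg n y-Lg (n+2) y) := by
  rw [Lg_c]; linear_combination ((n:ℝ)+1)*Lg_rec n y
lemma Lg_f (n:ℕ) (y:ℝ) : HasDerivAt (fun y => (1-y^2)*dL n y) (-((n:ℝ)*((n:ℝ)+1)*Lg n y)) y := by
  cases n with
  | zero =>
    rw [show (fun y:ℝ => (1-y^2)*dL 0 y) = fun _ => 0 from funext fun y => by rw [dL]; ring]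
    exact (hasDerivAt_const _ _).congr_deriv (by simp)
  | succ n =>
    have p :2*(n:ℝ)+3≠0 := by positivity
    rw [show (fun y:ℝ => (1-y^2)*dL (n+1) y) = fun y => ((n:ℝ)+1)*((n:ℝ)+2)*(Lg n y-Lg (n+2) y)/(2*(n:ℝ)+3) from
      funext fun y => by rw [← Lg_e]; field_simp]
    refine ((((Lg_deriv n y).sub (Lg_deriv (n+2) y)).const_mul _).div_const _).congr_deriv ?_
    rw [show dL n y-dL (n+2) y = -((2*(n:ℝ)+3)*Lg (n+1) y) by rw [← Lg_d]; ring]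
    push_cast; field_simp; ring
lemma Lg_one2 (n:ℕ) : Lg n 1=1 ∧ Lg (n+1) 1=1 := by
  induction n with
  | zero => simp [Lg]
  | succ n ih =>
    refine ⟨ih.2, ?_⟩
    have p : (n:ℝ)+2≠0 := by positivity
    apply mul_left_cancel₀ p
    rw [Lg_rec, ih.1, ih.2]; ring
lemma Lg_one (n:ℕ) : Lg n 1=1 := (Lg_one2 n).1
lemma Lg_neg2 (n:ℕ) : Lg n (-1) = (-1)^n ∧ Lg (n+1) (-1) = (-1)^(n+1) := by
  induction n with
  | zero => simp [Lg]
  | succ n ih =>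
    refine ⟨ih.2, ?_⟩
    have p : (n:ℝ)+2≠0 := by positivity
    apply mul_left_cancel₀ p
    rw [Lg_rec, ih.1, ih.2]; ring
lemma Lg_neg (n:ℕ) : Lg n (-1) = (-1)^n := (Lg_neg2 n).1
lemma Lg_cont (n:ℕ) : Continuous (Lg n) :=
  continuous_iff_continuousAt.2 fun y => (Lg_deriv n y).continuousAt
lemma dL_cont2 (n:ℕ) : Continuous (dL n) ∧ Continuous (dL (n+1)) := by
  induction n with
  | zero =>
    rw [show dL 0 = fun _ => 0 from funext fun x => by rw [dL],
      show dL (0+1) = fun _ => 1 from funext fun x => by rw [zero_add, dL]]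
    exact ⟨continuous_const, continuous_const⟩
  | succ n ih =>
    refine ⟨ih.2, ?_⟩
    rw [show dL (n+1+1) = fun y => _ from funext fun x => by rw [dL]]
    have := Lg_cont (n+1)
    obtain ⟨h1, h2⟩ := ih
    fun_prop
lemma dL_cont (n:ℕ) : Continuous (dL n) := (dL_cont2 n).1
def En (n:ℕ) (y:ℝ) : ℝ := (n:ℝ)*((n:ℝ)+1)*Lg n y^2+(1-y^2)*dL n y*dL n y
lemma En_cont (n:ℕ) : Continuous (En n) := by
  have := Lg_cont n
  have := dL_cont n
  unfold En; fun_prop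
lemma En_deriv (n:ℕ) {y:ℝ} (h : y^2<1) : HasDerivAt (En n) (2*y*dL n y^2) y := by
  have p : ∀ y:ℝ, y^2<1 → 1-y^2≠0 := fun y h => by linarith
  have d : HasDerivAt (fun y => ((1-y^2)*dL n y)^2/(1-y^2)) _ y :=
    ((Lg_f n y).pow 2).div ((hasDerivAt_pow 2 y).const_sub 1) (p y h)
  have e := (((Lg_deriv n y).pow 2).const_mul ((n:ℝ)*((n:ℝ)+1))).add d
  have e2 := e.congr_of_eventuallyEq (f₁ := En n) ?_
  · refine e2.congr_deriv ?_
    have := p y h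
    simp; field_simp; ring
  · have : ∀ᶠ z in 𝓝 y, z^2<1 := (isOpen_lt (by fun_prop) (by fun_prop)).mem_nhds h
    filter_upwards [this] with z hz
    have := p z hz
    simp only [En, Pi.add_apply, Pi.pow_apply]; field_simp
lemma Lg_le {n:ℕ} {y:ℝ} (h : y ∈ Icc (-1:ℝ) 1) : |Lg n y| ≤1 := by
  rcases Nat.eq_zero_or_pos n with h0 | h0
  · subst h0; simp [Lg]
  have m : En n y ≤ (n:ℝ)*((n:ℝ)+1) := by
    rcases le_total 0 y with hy | hy
    · have : MonotoneOn (En n) (Icc 0 1) := by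
        refine monotoneOn_of_hasDerivWithinAt_nonneg (f' := fun y => 2*y*dL n y^2) (convex_Icc 0 1)
          (En_cont n).continuousOn (fun x hx => ?_) fun x hx => ?_
        · rw [interior_Icc] at hx
          exact (En_deriv n (by nlinarith [hx.1, hx.2])).hasDerivWithinAt
        · rw [interior_Icc] at hx
          have := hx.1; positivity
      refine (this ⟨hy, h.2⟩ ⟨zero_le_one, le_rfl⟩ h.2).trans (le_of_eq ?_)
      rw [En, Lg_one]; ring
    · have : AntitoneOn (En n) (Icc (-1) 0) := by
        refine antitoneOn_of_hasDerivWithinAt_nonpos (f' := fun y => 2*y*dL n y^2) (convex_Icc (-1) 0)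
          (En_cont n).continuousOn (fun x hx => ?_) fun x hx => ?_
        · rw [interior_Icc] at hx
          exact (En_deriv n (by nlinarith [hx.1, hx.2])).hasDerivWithinAt
        · rw [interior_Icc] at hx
          have := hx.2
          exact mul_nonpos_of_nonpos_of_nonneg (by linarith) (sq_nonneg _)
      refine (this ⟨le_rfl, by norm_num⟩ ⟨h.1, hy⟩ h.1).trans (le_of_eq ?_)
      rw [En, Lg_neg, ← pow_mul, mul_comm n 2, pow_mul]; norm_num
  have p :0 < (n:ℝ)*((n:ℝ)+1) := by positivity
  have q :0 ≤ (1-y^2)*dL n y*dL n y := by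
    rw [mul_assoc]; exact mul_nonneg (by nlinarith [h.1, h.2]) (mul_self_nonneg _)
  rw [← sq_le_one_iff_abs_le_one]
  rw [En] at m
  by_contra! hh
  nlinarith
lemma T3_l : T3 (-1) = -1 := by rw [T3]; norm_num
lemma T3_r : T3 (-1/2)=1 := by rw [T3]; norm_num
lemma Pc_deriv (l:ℕ) (c:ℝ) : HasDerivAt (fun c => Lg l (T3 c)) (dL l (T3 c)*(3*(4*c^2-1))) c :=
  (Lg_deriv l (T3 c)).comp c (T3_deriv c)
lemma Wc_deriv (l:ℕ) (c:ℝ) : HasDerivAt (fun c => (1-T3 c^2)*dL l (T3 c))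
    (-((l:ℝ)*((l:ℝ)+1)*Lg l (T3 c))*(3*(4*c^2-1))) c :=
  (Lg_f l (T3 c)).comp c (T3_deriv c)
lemma Pc_cont (l:ℕ) : Continuous (fun c => Lg l (T3 c)) := (Lg_cont l).comp T3_cont
lemma dPc_cont (l:ℕ) : Continuous (fun c => dL l (T3 c)) := (dL_cont l).comp T3_cont
lemma ftcC {f f':ℝ → ℝ} (hd : ∀ c, HasDerivAt f (f' c) c) (hc : Continuous f') :
    ∫ c in (-1:ℝ)..(-1/2), f' c = f (-1/2)-f (-1) :=
  intervalIntegral.integral_eq_sub_of_hasDerivAt (fun c _ => hd c) (hc.intervalIntegrable _ _)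
def ip (l m:ℕ) : ℝ := ∫ c in (-1:ℝ)..(-1/2), (4*c^2-1)*(Lg l (T3 c)*Lg m (T3 c))
lemma orth {l m:ℕ} (h : l ≠ m) : ip l m=0 := by
  have c1 := Pc_cont l
  have c2 := Pc_cont m
  have key := ftcC (f := fun c => Lg m (T3 c)*((1-T3 c^2)*dL l (T3 c))-Lg l (T3 c)*((1-T3 c^2)*dL m (T3 c)))
    (f' := fun c => (3*((m:ℝ)*((m:ℝ)+1)-(l:ℝ)*((l:ℝ)+1)))*((4*c^2-1)*(Lg l (T3 c)*Lg m (T3 c)))) ?_ ?_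
  · rw [intervalIntegral.integral_const_mul] at key
    simp only [T3_l, T3_r] at key
    norm_num at key
    rcases key with key | key
    · exfalso
      apply h
      have : ((m:ℝ)-l)*((m:ℝ)+l+1)=0 := by linear_combination key
      rcases mul_eq_zero.1 this with e | e
      · have : (m:ℝ) = l := by linarith
        exact_mod_cast this.symm
      · have : (0:ℝ) < (m:ℝ)+l+1 := by positivity
        linarith
    · rw [ip]; norm_num; exact key
  · intro c
    refine (((Pc_deriv m c).mul (Wc_deriv l c)).sub ((Pc_deriv l c).mul (Wc_deriv m c))).congr_deriv ?_
    ring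
  · fun_prop
lemma ip_zero : ip 0 0=2/3 := by
  have key := ftcC (f := T3) (f' := fun c => 3*((4*c^2-1)*(Lg 0 (T3 c)*Lg 0 (T3 c)))) ?_ ?_
  · rw [intervalIntegral.integral_const_mul, T3_l, T3_r] at key
    rw [ip]; linarith
  · intro c
    refine (T3_deriv c).congr_deriv ?_
    simp [Lg]
  · have := Pc_cont 0; fun_prop
lemma ipint (l m:ℕ) : IntervalIntegrable (fun c:ℝ => (4*c^2-1)*(Lg l (T3 c)*Lg m (T3 c))) volume (-1) (-1/2) := by
  have c1 := Pc_cont l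
  have c2 := Pc_cont m
  exact Continuous.intervalIntegrable (by fun_prop) _ _
def yp (l m:ℕ) : ℝ := ∫ c in (-1:ℝ)..(-1/2), (4*c^2-1)*(T3 c*Lg l (T3 c)*Lg m (T3 c))
lemma yp_eq (n m:ℕ) : (2*(n:ℝ)+3)*yp (n+1) m = ((n:ℝ)+2)*ip (n+2) m+((n:ℝ)+1)*ip n m := by
  rw [ip, ip, yp, ← intervalIntegral.integral_const_mul, ← intervalIntegral.integral_const_mul,
    ← intervalIntegral.integral_const_mul,
    ← intervalIntegral.integral_add ((ipint _ _).const_mul _) ((ipint _ _).const_mul _)]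
  refine intervalIntegral.integral_congr fun c _ => ?_
  linear_combination -((4*c^2-1)*Lg m (T3 c))*Lg_rec n (T3 c)
lemma yp_comm (l m:ℕ) : yp l m = yp m l := by
  refine intervalIntegral.integral_congr fun c _ => ?_
  ring
lemma ip_succ (n:ℕ) : (2*(n:ℝ)+3)*ip (n+1) (n+1) = (2*(n:ℝ)+1)*ip n n := by
  have a := yp_eq n n
  rw [orth (show n+2 ≠ n by omega), yp_comm] at a
  cases n with
  | zero =>
    have e : yp 0 1 = ip 1 1 := by
      refine intervalIntegral.integral_congr fun c _ => ?_
      simp [Lg]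
    rw [zero_add, e] at a
    rw [zero_add]; push_cast at *; linarith
  | succ n =>
    have b := yp_eq n (n+2)
    rw [orth (show n ≠ n+2 by omega)] at b
    have p : (n:ℝ)+2≠0 := by positivity
    push_cast at *
    apply mul_left_cancel₀ p
    rw [show n+1+1 = n+2 from rfl] at *
    linear_combination (2*(n:ℝ)+3)*a-(2*(n:ℝ)+5)*b
lemma ip_self (n:ℕ) :3*(2*(n:ℝ)+1)*ip n n=2 := by
  induction n with
  | zero => rw [ip_zero]; norm_num
  | succ n ih =>
    have := ip_succ n
    push_cast; linear_combination ih+3*this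
def Sc (c:ℝ) : ℝ :=16*c^5-20*c^3+5*c
def sl (l:ℕ) : ℝ := ∫ c in (-1:ℝ)..(-1/2),3*(4*c^2-1)*Sc c*Lg l (T3 c)
lemma Sc_deriv (c:ℝ) : HasDerivAt Sc (80*c^4-60*c^2+5) c := by
  have := (((hasDerivAt_pow 5 c).const_mul 16).sub ((hasDerivAt_pow 3 c).const_mul 20)).add ((hasDerivAt_id c).const_mul 5)
  exact this.congr_deriv (by norm_num; ring)
lemma slint (l:ℕ) : IntervalIntegrable (fun c:ℝ => 3*(4*c^2-1)*Sc c*Lg l (T3 c)) volume (-1) (-1/2) := by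
  have c1 := Pc_cont l
  unfold Sc
  exact Continuous.intervalIntegrable (by fun_prop) _ _
lemma rs_deriv (c:ℝ) : HasDerivAt (fun c:ℝ => (1-c^2)*(4*c^2-1)*(80*c^4-60*c^2+5)) (sg c) c := by
  have := ((((hasDerivAt_pow 8 c).const_mul (-320)).add ((hasDerivAt_pow 6 c).const_mul (640))).add
    ((hasDerivAt_pow 4 c).const_mul (-400))).add (((hasDerivAt_pow 2 c).const_mul (85)).sub_const 5)
  have h2 := this.congr_of_eventuallyEq (f₁ := fun c:ℝ => (1-c^2)*(4*c^2-1)*(80*c^4-60*c^2+5))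
    (Eventually.of_forall fun c => by simp; ring)
  exact h2.congr_deriv (by rw [sg]; norm_num; ring)
lemma sig_eq (l:ℕ) : ∫ c in (-1:ℝ)..(-1/2), sg c*Lg l (T3 c) = -(3*(l:ℝ)*((l:ℝ)+1))*sl l := by
  have c1 := Pc_cont l
  have key := ftcC (f := fun c => Lg l (T3 c)*((1-c^2)*(4*c^2-1)*(80*c^4-60*c^2+5))-3*(((1-T3 c^2)*dL l (T3 c))*Sc c))
    (f' := fun c => sg c*Lg l (T3 c)+(3*(l:ℝ)*((l:ℝ)+1))*(3*(4*c^2-1)*Sc c*Lg l (T3 c))) ?_ ?_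
  · rw [intervalIntegral.integral_add _ ((slint l).const_mul _), intervalIntegral.integral_const_mul] at key
    · simp only [T3_l, T3_r] at key
      norm_num at key
      rw [sl]; linarith
    · unfold sg
      exact Continuous.intervalIntegrable (by fun_prop) _ _
  · intro c
    refine (((Pc_deriv l c).mul (rs_deriv c)).sub (((Wc_deriv l c).mul (Sc_deriv c)).const_mul 3)).congr_deriv ?_
    linear_combination -3*dL l (T3 c)*(80*c^4-60*c^2+5)*rho_eq c
  · unfold sg Sc; fun_prop
lemma s_rec (n:ℕ) : (((n:ℝ)+3)^2-25/9)*sl (n+2) = ((n:ℝ)^2-25/9)*sl n := by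
  have c1 := Pc_cont n
  have c2 := Pc_cont (n+2)
  have key := ftcC (f := fun c => ((1-c^2)*(4*c^2-1)*(80*c^4-60*c^2+5))/3*(Lg (n+2) (T3 c)-Lg n (T3 c))
      + Sc c*(T3 c*(Lg (n+2) (T3 c)-Lg n (T3 c))-(2*(n:ℝ)+3)*((1-T3 c^2)*Lg (n+1) (T3 c))))
    (f' := fun c => (((n:ℝ)+3)^2-25/9)*(3*(4*c^2-1)*Sc c*Lg (n+2) (T3 c))
      - ((n:ℝ)^2-25/9)*(3*(4*c^2-1)*Sc c*Lg n (T3 c))) ?_ ?_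
  · rw [intervalIntegral.integral_sub ((slint _).const_mul _) ((slint _).const_mul _),
      intervalIntegral.integral_const_mul, intervalIntegral.integral_const_mul] at key
    simp only [T3_l, T3_r, Lg_one, Lg_neg] at key
    rw [sl, sl]
    rw [← sub_eq_zero, key, pow_add]; ring
  · intro c
    have dT := T3_deriv c
    have dp := (Pc_deriv (n+2) c).sub (Pc_deriv n c)
    refine ((((rs_deriv c).div_const 3).mul dp).add ((Sc_deriv c).mul ((dT.mul dp).sub
      ((((dT.pow 2).const_sub 1).mul (Pc_deriv (n+1) c)).const_mul _)))).congr_deriv ?_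
    have e := Lg_e n (T3 c)
    have d := Lg_d n (T3 c)
    have r := Lg_rec n (T3 c)
    have rr := rho_eq c
    simp only [Pi.sub_apply, Pi.mul_apply, Pi.pow_apply]
    have po : sg c/3+(80*c^4-60*c^2+5)*T3 c = -25/3*(4*c^2-1)*Sc c := by rw [sg, T3, Sc]; ring
    linear_combination ((1-c^2)*(4*c^2-1)*(80*c^4-60*c^2+5)*(4*c^2-1)+Sc c*(3*(4*c^2-1))*T3 c)*d
      - (80*c^4-60*c^2+5)*(2*(n:ℝ)+3)*Lg (n+1) (T3 c)*rr-Sc c*(3*(4*c^2-1))*e-3*Sc c*(3*(4*c^2-1))*r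
      + (Lg (n+2) (T3 c)-Lg n (T3 c))*po
  · unfold Sc; fun_prop
lemma s_one : sl 1=9/22 := by
  have key := ftcC (f := fun c => (15)*c^3+(-84)*c^5+(192)*c^7+(-192)*c^9+(768/11)*c^11) (f' := fun c => 3*(4*c^2-1)*Sc c*Lg 1 (T3 c)) ?_ ?_
  · rw [sl, key]; norm_num
  · intro c
    refine (((((((hasDerivAt_pow 3 c).const_mul (15:ℝ)).add ((hasDerivAt_pow 5 c).const_mul (-84:ℝ))).add ((hasDerivAt_pow 7 c).const_mul (192:ℝ))).add ((hasDerivAt_pow 9 c).const_mul (-192:ℝ))).add ((hasDerivAt_pow 11 c).const_mul (768/11:ℝ)))).congr_deriv ?_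
    rw [Sc, Lg, T3]; norm_num; ring
  · have := Pc_cont 1
    unfold Sc; fun_prop
def DD (c:ℝ) : ℝ := fA c*pB c+pA c*fB c
def nl (l:ℕ) : ℝ := ∫ c in (-1:ℝ)..(-1/2),3*(4*c^2-1)*Lg l (T3 c)*(fA c*fB c)
def dl (l:ℕ) : ℝ := ∫ c in (-1:ℝ)..(-1/2), (4*c^2-1)*Lg l (T3 c)*DD c
lemma AB_int' {g:ℝ → ℝ} (h : Continuous g) : IntervalIntegrable (fun c => g c*(fA c*fB c)) volume (-1) (-1/2) :=
  AB_int.continuousOn_mul h.continuousOn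
lemma DD_int0 : IntervalIntegrable DD volume (-1) (-1/2) := by
  have ca : ContinuousOn pB (uIcc (-1) (-1/2)) := by rw [uI]; exact pB_cont
  have cb : ContinuousOn pA (uIcc (-1) (-1/2)) := by rw [uI]; exact pA_cont
  exact (fA_int.mul_continuousOn ca).add (fB_int.continuousOn_mul cb)
lemma DD_int {g:ℝ → ℝ} (h : Continuous g) : IntervalIntegrable (fun c => g c*DD c) volume (-1) (-1/2) :=
  DD_int0.continuousOn_mul h.continuousOn
lemma AB_deriv {c:ℝ} (h : c ∈ JJ) : HasDerivAt (fun c => fA c*fB c) (DD c/((1-c^2)*(4*c^2-1))) c := by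
  refine ((fA_deriv h).mul (fB_deriv h)).congr_deriv ?_
  rw [DD]; ring
lemma ppc_deriv {c:ℝ} (h : c ∈ JJ) : HasDerivAt (fun c => pA c*pB c) (2*(4*c^2-1)*DD c) c := by
  refine ((pA_deriv h).mul (pB_deriv h)).congr_deriv ?_
  rw [DD]; ring
lemma pp_eq (c:ℝ) : pA c*pB c = -9*(1-c^2)*(4*c^2-1)^2*(gA c*gB' c) := by
  rw [pA_eq, pB_eq]; ring
lemma DD_deriv {c:ℝ} (h : c ∈ JJ) : HasDerivAt DD ((4*c^2-1)*(-18*(gA c*gB' c)+4*(fA c*fB c))) c := by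
  obtain ⟨h1, h2, h3, h4, h5, h6, h7⟩ := JJ_facts h
  have f1 : (1-c^2)*(4*c^2-1)≠0 := by positivity
  refine (((fA_deriv h).mul (pB_deriv h)).add ((pA_deriv h).mul (fB_deriv h))).congr_deriv ?_
  have e : pA c*pB c/((1-c^2)*(4*c^2-1)) = -9*(4*c^2-1)*(gA c*gB' c) := by
    rw [div_eq_iff f1, pp_eq]; ring
  linear_combination 2*e
lemma DD_lim0 : Tendsto DD (𝓝[>] (-1)) (𝓝 (-(3*√3/π))) :=
  cl ((fA_lim0.mul pB_lim0).add pAfB_lim0) (by ring)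
lemma DD_lim1 : Tendsto DD (𝓝[<] (-1/2)) (𝓝 (3*√3/π)) :=
  cl ((pBfA_lim1.add (pA_lim1.mul fB_lim1)).congr fun c => by rw [DD]; ring) (by ring)
lemma yy_fac (c:ℝ) :1-T3 c^2 = (1+c)*(2*c+1)*((2*c-1)^2*(1-c)*(2*c+1)) := by rw [T3]; ring
lemma n1 (l:ℕ) : ∫ c in (-1:ℝ)..(-1/2), (4*c^2-1)*dL l (T3 c)*DD c = (l:ℝ)*((l:ℝ)+1)*nl l := by
  have c1 := Pc_cont l
  have c2 := dPc_cont l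
  have i1 := DD_int (g := fun c => (4*c^2-1)*dL l (T3 c)) (by fun_prop)
  have i2 := AB_int' (g := fun c => 3*(4*c^2-1)*Lg l (T3 c)) (by fun_prop)
  have key := ftcJ (f := fun c => (fA c*fB c)*((1-T3 c^2)*dL l (T3 c)))
    (f' := fun c => (4*c^2-1)*dL l (T3 c)*DD c-((l:ℝ)*((l:ℝ)+1))*(3*(4*c^2-1)*Lg l (T3 c)*(fA c*fB c)))
    (a :=0) (b :=0) ?_ (i1.sub (i2.const_mul _)) ?_ ?_
  · rw [intervalIntegral.integral_sub i1 (i2.const_mul _), intervalIntegral.integral_const_mul] at key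
    rw [nl]; linarith
  · intro c h
    obtain ⟨h1, h2, h3, h4, h5, h6, h7⟩ := JJ_facts h
    have f1 : (1-c^2)*(4*c^2-1)≠0 := by positivity
    refine ((AB_deriv h).mul (Wc_deriv l c)).congr_deriv ?_
    have e : DD c/((1-c^2)*(4*c^2-1))*(1-T3 c^2) = (4*c^2-1)*DD c := by
      rw [rho_eq, div_mul_eq_mul_div, div_eq_iff f1]; ring
    linear_combination dL l (T3 c)*e
  · have t := (fB_lim0.mul fA_lim0).mul (contl0 (f := fun c => (2*c+1)*((2*c-1)^2*(1-c)*(2*c+1))*dL l (T3 c)) (by fun_prop))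
    refine cl (t.congr fun c => ?_) (by ring)
    rw [yy_fac]; ring
  · have t := (fA_lim1.mul fB_lim1).mul (contl1 (f := fun c => (1+c)*((2*c-1)^2*(1-c)*(2*c+1))*dL l (T3 c)) (by fun_prop))
    refine cl (t.congr fun c => ?_) (by ring)
    rw [yy_fac]; ring
lemma d_nl (n:ℕ) : (2*(n:ℝ)+3)*dl (n+1) = ((n:ℝ)+2)*((n:ℝ)+3)*nl (n+2)-(n:ℝ)*((n:ℝ)+1)*nl n := by
  have c1 := dPc_cont n
  have c2 := dPc_cont (n+2)
  have a := n1 n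
  have b := n1 (n+2)
  have i1 := DD_int (g := fun c => (4*c^2-1)*dL n (T3 c)) (by fun_prop)
  have i2 := DD_int (g := fun c => (4*c^2-1)*dL (n+2) (T3 c)) (by fun_prop)
  push_cast at b
  rw [show ((n:ℝ)+2)*((n:ℝ)+3) = ((n:ℝ)+2)*((n:ℝ)+2+1) by ring, ← a, ← b, ← intervalIntegral.integral_sub i2 i1, dl,
    ← intervalIntegral.integral_const_mul]
  refine intervalIntegral.integral_congr fun c _ => ?_
  linear_combination -(4*c^2-1)*DD c*Lg_d n (T3 c)
lemma d_zero' : dl 0=2*nl 1 := by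
  have a := n1 1
  norm_num [dL] at a
  rw [dl]
  norm_num [Lg]
  linarith
lemma n2 (l:ℕ) : (3*(l:ℝ)*((l:ℝ)+1)+4/3)*dl l=4/3 * ∫ c in (-1:ℝ)..(-1/2),3*(4*c^2-1)*((1-T3 c^2)*dL l (T3 c))*(fA c*fB c) := by
  have c1 := Pc_cont l
  have c2 := dPc_cont l
  have c3 := T3_cont
  have i1 := DD_int (g := fun c => (4*c^2-1)*Lg l (T3 c)) (by fun_prop)
  have i2 := AB_int' (g := fun c => 3*(4*c^2-1)*((1-T3 c^2)*dL l (T3 c))) (by fun_prop)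
  have key := ftcJ (f := fun c => DD c*((1-T3 c^2)*dL l (T3 c))-2/3*((pA c*pB c)*Lg l (T3 c)))
    (f' := fun c => 4/3*(3*(4*c^2-1)*((1-T3 c^2)*dL l (T3 c))*(fA c*fB c))-(3*(l:ℝ)*((l:ℝ)+1)+4/3)*((4*c^2-1)*Lg l (T3 c)*DD c))
    (a :=0) (b :=0) ?_ ((i2.const_mul _).sub (i1.const_mul _)) ?_ ?_
  · rw [intervalIntegral.integral_sub (i2.const_mul _) (i1.const_mul _), intervalIntegral.integral_const_mul,
      intervalIntegral.integral_const_mul] at key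
    rw [dl]; linarith
  · intro c h
    refine (((DD_deriv h).mul (Wc_deriv l c)).sub (((ppc_deriv h).mul (Pc_deriv l c)).const_mul (2/3))).congr_deriv ?_
    have e := pp_eq c
    have r := rho_eq c
    linear_combination -2*(4*c^2-1)*dL l (T3 c)*e-18*(gA c*gB' c)*(4*c^2-1)*dL l (T3 c)*r
  · have t := (DD_lim0.mul (contl0 (f := fun c => (1-T3 c^2)*dL l (T3 c)) (by fun_prop))).sub
      (((pA_lim0.mul pB_lim0).mul (contl0 (f := fun c => Lg l (T3 c)) c1.continuousAt)).const_mul (2/3))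
    exact cl t (by rw [T3_l]; ring)
  · have t := (DD_lim1.mul (contl1 (f := fun c => (1-T3 c^2)*dL l (T3 c)) (by fun_prop))).sub
      (((pA_lim1.mul pB_lim1).mul (contl1 (f := fun c => Lg l (T3 c)) c1.continuousAt)).const_mul (2/3))
    exact cl t (by rw [T3_r]; ring)
lemma d_zero : dl 0=0 := by
  have := n2 0
  norm_num [dL] at this
  exact this
lemma d_nl2 (n:ℕ) : (2*(n:ℝ)+3)*((3*((n:ℝ)+1)*((n:ℝ)+2)+4/3)*dl (n+1))=4/3*(((n:ℝ)+1)*((n:ℝ)+2))*(nl n-nl (n+2)) := by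
  have a := n2 (n+1)
  push_cast at a
  rw [show ((n:ℝ)+2) = ((n:ℝ)+1+1) by ring, a]
  have c1 := Pc_cont n
  have c2 := Pc_cont (n+2)
  have i1 := AB_int' (g := fun c => 3*(4*c^2-1)*Lg n (T3 c)) (by fun_prop)
  have i2 := AB_int' (g := fun c => 3*(4*c^2-1)*Lg (n+2) (T3 c)) (by fun_prop)
  rw [nl, nl, ← intervalIntegral.integral_sub i1 i2, ← intervalIntegral.integral_const_mul,
    ← intervalIntegral.integral_const_mul, ← intervalIntegral.integral_const_mul]
  refine intervalIntegral.integral_congr fun c _ => ?_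
  linear_combination 4/3*(3*(4*c^2-1))*(fA c*fB c)*Lg_e n (T3 c)
lemma n_rec (n:ℕ) : ((n:ℝ)+2)^2*(((n:ℝ)+2)^2-1/9)*nl (n+2) = ((n:ℝ)+1)^2*(((n:ℝ)+1)^2-1/9)*nl n := by
  have a := d_nl n
  have b := d_nl2 n
  linear_combination -(((n:ℝ)+1)*((n:ℝ)+2)+4/9)*a+1/3*b
lemma d_eq (n:ℕ) : dl (n+1)*(((n:ℝ)+2)*(((n:ℝ)+2)^2-1/9))=8/9*((n:ℝ)+1)*nl n := by
  have r := n_rec n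
  have b := d_nl2 n
  have p : (2*(n:ℝ)+3)*(3*((n:ℝ)+1)*((n:ℝ)+2)+4/3)*((n:ℝ)+2)≠0 := by positivity
  apply mul_left_cancel₀ p
  linear_combination ((n:ℝ)+2)^2*(((n:ℝ)+2)^2-1/9)*b-4/3*(((n:ℝ)+1)*((n:ℝ)+2))*r
lemma n_odd (k:ℕ) : nl (2*k+1)=0 := by
  induction k with
  | zero => have := d_zero'; rw [d_zero] at this; rw [mul_zero, zero_add]; linarith
  | succ k ih =>
    have r := n_rec (2*k+1)
    rw [ih, mul_zero] at r
    rcases mul_eq_zero.1 r with h | h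
    · exfalso
      push_cast at h
      have :0 < (2*(k:ℝ)+1+2)^2*((2*(k:ℝ)+1+2)^2-1/9) := by
        apply mul_pos (by positivity)
        nlinarith [(Nat.cast_nonneg k : (0:ℝ) ≤ k)]
      linarith
    · exact h
lemma den_pos (n:ℕ) :0 < ((n:ℝ)+2)*(((n:ℝ)+2)^2-1/9) :=
  mul_pos (by positivity) (by nlinarith [(Nat.cast_nonneg n : (0:ℝ) ≤ n)])
lemma d_even (k:ℕ) : dl (2*k)=0 := by
  cases k with
  | zero => exact d_zero
  | succ k =>
    have := d_eq (2*k+1)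
    rw [n_odd, mul_zero] at this
    exact (mul_eq_zero.1 this).resolve_right (den_pos _).ne'
def hh (c:ℝ) : ℝ := -18*(gA c*gB' c)+4*(fA c*fB c)
lemma gg_contu : ContinuousOn (fun c => gA c*gB' c) (uIcc (-1) (-1/2)) := by
  rw [uI]; exact gA_cont.mul gB'_cont
lemma hh_int : IntervalIntegrable hh volume (-1) (-1/2) :=
  ((gg_contu.intervalIntegrable).const_mul _).add (AB_int.const_mul _)
lemma AB2 {c:ℝ} (h : c ∈ JJ) : (fA c*fB c)^2≤162*(fA c^2+fB c^2) := by
  have key : ∀ x a:ℝ,1/4 ≤ x → 1 ≤ a → a≤9*x^(-(1/4):ℝ) → a^2≤162 := by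
    intro x a hx h1 h2
    have e : x^(-(1/4):ℝ) ≤ (1/4:ℝ)^(-(1/4):ℝ) :=
      Real.rpow_le_rpow_of_nonpos (by norm_num) hx (by norm_num)
    have e2 : ((1/4:ℝ)^(-(1/4):ℝ))^2=2 := by
      rw [← Real.rpow_natCast, ← Real.rpow_mul (by norm_num), show (1/4:ℝ) = (2:ℝ)^(-2:ℝ) by
        rw [Real.rpow_neg (by norm_num)]; norm_num, ← Real.rpow_mul (by norm_num)]
      norm_num
    have e3 : a≤9*(1/4:ℝ)^(-(1/4):ℝ) := by linarith
    calc a^2 ≤ (9*(1/4:ℝ)^(-(1/4):ℝ))^2 := pow_le_pow_left₀ (by linarith) e3 2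
      _=162 := by rw [mul_pow, e2]; norm_num
  rw [mul_pow]
  rcases le_total c (-3/4) with hc | hc
  · have := key _ _ (by linarith) (fA_bd h).1 (fA_bd h).2
    nlinarith [sq_nonneg (fA c), sq_nonneg (fB c)]
  · have := key _ _ (by linarith) (fB_bd h).1 (fB_bd h).2
    nlinarith [sq_nonneg (fA c), sq_nonneg (fB c)]
lemma hh2_int : IntervalIntegrable (fun c => (4*c^2-1)*hh c^2) volume (-1) (-1/2) := by
  refine intJ (C :=15552) ?_ (fun c h => ?_) (by norm_num)
  · have := gA_contJ
    have := gB'_contJ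
    have := fA_contJ
    have := fB_contJ
    unfold hh; fun_prop
  · obtain ⟨h1, h2, h3, h4, h5, h6, h7⟩ := JJ_facts h
    obtain ⟨g1, g2, g3, g4⟩ := g_bd (Ioo_subset_Icc_self h)
    have a := AB2 h
    rw [abs_of_nonneg (by positivity)]
    have g5 :0 ≤ gA c*gB' c := by positivity
    have g6 : gA c*gB' c≤1 := by nlinarith
    have b : hh c^2≤648+32*(fA c*fB c)^2 := by
      rw [hh]
      nlinarith [sq_nonneg (-18*(gA c*gB' c)-4*(fA c*fB c))]
    have w :4*c^2-1≤3 := by nlinarith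
    calc (4*c^2-1)*hh c^2≤3*hh c^2 := by gcongr
      _ ≤ _ := by nlinarith [sq_nonneg (fA c), sq_nonneg (fB c)]
def bl (l:ℕ) : ℝ := ∫ c in (-1:ℝ)..(-1/2), (4*c^2-1)*Lg l (T3 c)*hh c
lemma bl_int (l:ℕ) : IntervalIntegrable (fun c => (4*c^2-1)*Lg l (T3 c)*hh c) volume (-1) (-1/2) := by
  have := Pc_cont l
  exact hh_int.continuousOn_mul (g := fun c => (4*c^2-1)*Lg l (T3 c)) (Continuous.continuousOn (by fun_prop))
lemma bl_le (l:ℕ) : bl l^2 ≤ (∫ c in (-1:ℝ)..(-1/2), (4*c^2-1)*hh c^2)*ip l l := by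
  have q : ∀ t:ℝ,0 ≤ (∫ c in (-1:ℝ)..(-1/2), (4*c^2-1)*hh c^2)-2*t*bl l+t^2*ip l l := by
    intro t
    have e : (∫ c in (-1:ℝ)..(-1/2), (4*c^2-1)*hh c^2)-2*t*bl l+t^2*ip l l
        = ∫ c in (-1:ℝ)..(-1/2), (4*c^2-1)*(hh c-t*Lg l (T3 c))^2 := by
      rw [bl, ip, ← intervalIntegral.integral_const_mul, ← intervalIntegral.integral_const_mul,
        ← intervalIntegral.integral_sub hh2_int ((bl_int l).const_mul _),
        ← intervalIntegral.integral_add (hh2_int.sub ((bl_int l).const_mul _)) ((ipint l l).const_mul _)]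
      refine intervalIntegral.integral_congr fun c _ => ?_
      ring
    rw [e]
    refine intervalIntegral.integral_nonneg (by norm_num) fun c hc => ?_
    have :0≤4*c^2-1 := by nlinarith [hc.1, hc.2]
    positivity
  have p :0 < ip l l := by
    have := ip_self l
    by_contra! hn
    have : (3*(2*(l:ℝ)+1))*ip l l≤0 := mul_nonpos_of_nonneg_of_nonpos (by positivity) hn
    linarith
  have := q (bl l/ip l l)
  have e : (bl l/ip l l)^2*ip l l = bl l^2/ip l l := by field_simp
  rw [e, show 2*(bl l/ip l l)*bl l=2*(bl l^2/ip l l) by ring] at this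
  have h2 : bl l^2/ip l l ≤ ∫ c in (-1:ℝ)..(-1/2), (4*c^2-1)*hh c^2 := by linarith
  rwa [div_le_iff₀ p] at h2
lemma bl_lim : Tendsto bl atTop (𝓝 0) := by
  have b := bl_le
  generalize (∫ c in (-1:ℝ)..(-1/2), (4*c^2-1)*hh c^2) = H at b
  have t : Tendsto (fun l:ℕ => H*(2/3)*(2*(l:ℝ)+1)⁻¹) atTop (𝓝 0) := by
    refine cl (Tendsto.const_mul _ (tendsto_inv_atTop_zero.comp (tendsto_atTop_add_const_right _ 1
      ((tendsto_natCast_atTop_atTop (R := ℝ)).const_mul_atTop (by norm_num : (0:ℝ)<2))))) (by ring)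
  have t2 : Tendsto (fun l => bl l^2) atTop (𝓝 0) := by
    refine squeeze_zero (fun l => sq_nonneg _) (fun l => (b l).trans (le_of_eq ?_)) t
    have := ip_self l
    have e : ip l l=2/(3*(2*(l:ℝ)+1)) := by rw [eq_div_iff (by positivity)]; linarith
    rw [e]; field_simp
  have t3 := t2.sqrt
  rw [Real.sqrt_zero] at t3
  simp only [Real.sqrt_sq_eq_abs] at t3
  exact (tendsto_zero_iff_abs_tendsto_zero _).2 t3
lemma n_bl (l:ℕ) :3*((l:ℝ)*((l:ℝ)+1)*nl l)=3*√3/π*(1+(-1)^l)-bl l := by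
  have c1 := Pc_cont l
  have c2 := dPc_cont l
  have i1 := DD_int (g := fun c => (4*c^2-1)*dL l (T3 c)) (by fun_prop)
  have key := ftcJ (f := fun c => DD c*Lg l (T3 c))
    (f' := fun c => (4*c^2-1)*Lg l (T3 c)*hh c+3*((4*c^2-1)*dL l (T3 c)*DD c)) ?_ ((bl_int l).add (i1.const_mul _))
    (DD_lim0.mul (contl0 c1.continuousAt)) (DD_lim1.mul (contl1 c1.continuousAt))
  · rw [intervalIntegral.integral_add (bl_int l) (i1.const_mul _), intervalIntegral.integral_const_mul, n1,
      T3_l, T3_r, Lg_one, Lg_neg] at key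
    rw [bl]; linarith
  · intro c h
    refine ((DD_deriv h).mul (Pc_deriv l c)).congr_deriv ?_
    rw [hh]; ring
def ew (n:ℕ) : ℝ := ris (1/2) n*ris (1-1/2) n/(n.factorial:ℝ)^2
def es (n:ℕ) : ℝ := ris (1/6) n*ris (1-1/6) n/(n.factorial:ℝ)^2
def xk (n:ℕ) : ℝ := eh n*ew n/((6*(n:ℝ)+1)*es n)
lemma ew_succ (n:ℕ) : ((n:ℝ)+1)^2*ew (n+1) = ((n:ℝ)^2+n+1/4)*ew n := by
  rw [ew, ew, ris_succ, ris_succ, Nat.factorial_succ]; push_cast; field_simp; ring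
lemma es_succ (n:ℕ) : ((n:ℝ)+1)^2*es (n+1) = ((n:ℝ)^2+n+5/36)*es n := by
  rw [es, es, ris_succ, ris_succ, Nat.factorial_succ]; push_cast; field_simp; ring
lemma es_pos (n:ℕ) :0 < es n := by
  have := ris_pos (a :=1/6) (by norm_num) n
  have := ris_pos (a :=1-1/6) (by norm_num) n
  unfold es; positivity
lemma n_xk (k:ℕ) : nl (2*k) = nl 0*xk k := by
  induction k with
  | zero => simp [xk, eh, ew, es, ris_zero]
  | succ k ih =>
    have r := n_rec (2*k)
    rw [ih] at r
    push_cast at r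
    have h1 : eh (k+1) = ((k:ℝ)^2+k+2/9)*eh k/((k:ℝ)+1)^2 := by
      rw [eq_div_iff (by positivity)]; linarith [eh_succ k]
    have h2 : ew (k+1) = ((k:ℝ)^2+k+1/4)*ew k/((k:ℝ)+1)^2 := by
      rw [eq_div_iff (by positivity)]; linarith [ew_succ k]
    have h3 : es (k+1) = ((k:ℝ)^2+k+5/36)*es k/((k:ℝ)+1)^2 := by
      rw [eq_div_iff (by positivity)]; linarith [es_succ k]
    have p := es_pos k
    have q : (2*(k:ℝ)+2)^2*((2*(k:ℝ)+2)^2-1/9)≠0 := by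
      have :0 < (2*(k:ℝ)+2)^2-1/9 := by nlinarith [(Nat.cast_nonneg k : (0:ℝ) ≤ k)]
      positivity
    apply mul_left_cancel₀ q
    rw [show 2*(k+1)=2*k+2 by ring, r, xk, xk, h1, h2, h3]
    push_cast
    field_simp
    ring
lemma xk_lim : Tendsto (fun k:ℕ => (k:ℝ)^2*xk k) atTop (𝓝 (√3/(6*π))) := by
  have a := eh_lim
  have b : Tendsto (fun n:ℕ => n*ew n) atTop (𝓝 (1/π)) := by
    refine cl (ris_lim (a :=1/2) (by norm_num) (by norm_num)) ?_
    rw [show π*(1/2) = π/2 by ring, Real.sin_pi_div_two]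
  have c : Tendsto (fun n:ℕ => n*es n) atTop (𝓝 (1/(2*π))) := by
    refine cl (ris_lim (a :=1/6) (by norm_num) (by norm_num)) ?_
    rw [show π*(1/6) = π/6 by ring, Real.sin_pi_div_six]; ring
  have d : Tendsto (fun n:ℕ => 6+1/(n:ℝ)) atTop (𝓝 6) :=
    cl (tendsto_const_nhds.add tendsto_one_div_atTop_nhds_zero_nat) (by ring)
  refine (cl ((a.mul b).div (d.mul c) (by positivity)) ?_).congr' ?_
  · field_simp
  · filter_upwards [eventually_gt_atTop 0] with n hn
    have : (0:ℝ) < n := by exact_mod_cast hn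
    have := es_pos n
    simp only [Pi.div_apply, xk]; field_simp
lemma n_zero : nl 0=3 := by
  have t : Tendsto (fun k:ℕ => 3*(((2*k:ℕ):ℝ)*(((2*k:ℕ):ℝ)+1)*nl (2*k))) atTop (𝓝 (6*√3/π)) := by
    have : Tendsto (fun k:ℕ => 2*k) atTop atTop := tendsto_id.const_mul_atTop' (by norm_num)
    refine cl ((tendsto_const_nhds (x :=6*√3/π)).sub (bl_lim.comp this) |>.congr fun k => ?_) (by ring)
    rw [n_bl, pow_mul]; norm_num; ring
  have t2 : Tendsto (fun k:ℕ => 3*(((2*k:ℕ):ℝ)*(((2*k:ℕ):ℝ)+1)*nl (2*k))) atTop (𝓝 (nl 0*(2*√3/π))) := by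
    have d : Tendsto (fun n:ℕ => 12+6*(1/(n:ℝ))) atTop (𝓝 12) :=
      cl (tendsto_const_nhds.add (tendsto_one_div_atTop_nhds_zero_nat.const_mul 6)) (by ring)
    refine (cl ((d.mul xk_lim).const_mul (nl 0)) (by ring)).congr' ?_
    filter_upwards [eventually_gt_atTop 0] with n hn
    have : (0:ℝ) < n := by exact_mod_cast hn
    rw [n_xk]; push_cast; field_simp; ring
  have e := tendsto_nhds_unique t t2
  field_simp at e
  have p : (0:ℝ) < √3 := by positivity
  nlinarith
def cf (l:ℕ) : ℝ :=3*(2*(l:ℝ)+1)/2*dl l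
lemma n_bdd : ∃ C:ℝ, ∀ l:ℕ, ((l:ℝ)+1)*|nl l| ≤ C := by
  obtain ⟨B, hB⟩ := bl_lim.abs.bddAbove_range
  have hB' : ∀ l, |bl l| ≤ B := fun l => hB ⟨l, rfl⟩
  refine ⟨3+6*√3/π+B, fun l => ?_⟩
  have B0 :0 ≤ B := (abs_nonneg _).trans (hB' 0)
  rcases Nat.eq_zero_or_pos l with h | h
  · subst h
    rw [n_zero]
    have :0≤6*√3/π := by positivity
    norm_num; linarith
  · have e := n_bl l
    have a : |3*((l:ℝ)*((l:ℝ)+1)*nl l)| ≤3*√3/π*2+B := by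
      rw [e]
      refine (abs_sub _ _).trans (add_le_add ?_ (hB' l))
      rw [abs_mul, abs_of_nonneg (by positivity :0≤3*√3/π)]
      refine mul_le_mul_of_nonneg_left ?_ (by positivity)
      refine (abs_add_le _ _).trans ?_
      rw [abs_pow]; norm_num
    have l1 : (1:ℝ) ≤ l := by exact_mod_cast h
    rw [abs_mul, abs_mul, abs_of_nonneg (by positivity :0 ≤ (l:ℝ)*((l:ℝ)+1)), abs_of_pos (by norm_num : (0:ℝ)<3)] at a
    have b :0 ≤ ((l:ℝ)+1)*|nl l| := by positivity
    have :3*√3/π*2=6*√3/π := by ring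
    nlinarith
lemma cf_sum : Summable (fun l => |cf l|) := by
  obtain ⟨C, hC⟩ := n_bdd
  rw [← summable_nat_add_iff 1]
  have s : Summable (fun l:ℕ => (8/3*C)*(1/((l:ℝ)+1)^2)) := by
    refine Summable.mul_left _ ?_
    have := (summable_nat_add_iff 1).2 (Real.summable_one_div_nat_pow (p :=2).2 (by norm_num))
    refine this.congr fun l => ?_
    push_cast; rfl
  refine Summable.of_nonneg_of_le (fun _ => abs_nonneg _) (fun l => ?_) s
  have e : dl (l+1)=8/9*((l:ℝ)+1)*nl l/(((l:ℝ)+2)*(((l:ℝ)+2)^2-1/9)) := by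
    rw [eq_div_iff (den_pos l).ne']; exact d_eq l
  have q : ((l:ℝ)+1)^2 ≤ ((l:ℝ)+2)^2-1/9 := by nlinarith [(Nat.cast_nonneg l : (0:ℝ) ≤ l)]
  have q0 :0 < ((l:ℝ)+2)^2-1/9 := by nlinarith [(Nat.cast_nonneg l : (0:ℝ) ≤ l)]
  have h := hC l
  have C0 :0 ≤ C := le_trans (by positivity) h
  rw [cf, e, abs_mul, abs_div (8/9*((l:ℝ)+1)*nl l), abs_of_pos (den_pos l), abs_mul (8/9*((l:ℝ)+1)), abs_of_nonneg (by positivity : (0:ℝ)≤3*(2*((l+1:ℕ):ℝ)+1)/2),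
    abs_of_nonneg (by positivity : (0:ℝ)≤8/9*((l:ℝ)+1))]
  push_cast
  calc 3*(2*((l:ℝ)+1)+1)/2*(8/9*((l:ℝ)+1)*|nl l|/(((l:ℝ)+2)*(((l:ℝ)+2)^2-1/9)))
      = (8/3*((2*(l:ℝ)+3)/(2*((l:ℝ)+2))))*(((l:ℝ)+1)*|nl l|)/(((l:ℝ)+2)^2-1/9) := by field_simp; ring
    _ ≤ (8/3*1)*C/((l:ℝ)+1)^2 := by
      gcongr
      rw [div_le_one (by positivity)]; linarith
    _ = _ := by ring
def Sf (c:ℝ) : ℝ := ∑' l, cf l*Lg l (T3 c)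
lemma cf_bd {c:ℝ} (h : c ∈ Icc (-1:ℝ) (-1/2)) (l:ℕ) : ‖cf l*Lg l (T3 c)‖ ≤ |cf l| := by
  rw [norm_mul, Real.norm_eq_abs, Real.norm_eq_abs]
  exact mul_le_of_le_one_right (abs_nonneg _) (Lg_le (T3_memc h))
lemma Sf_has {c:ℝ} (h : c ∈ Icc (-1:ℝ) (-1/2)) : HasSum (fun l => cf l*Lg l (T3 c)) (Sf c) :=
  (Summable.of_norm_bounded cf_sum (cf_bd h)).hasSum
lemma Sf_cont : ContinuousOn Sf (Icc (-1) (-1/2)) :=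
  continuousOn_tsum (fun l => ((Pc_cont l).const_mul _ |>.continuousOn)) cf_sum fun l _ h => cf_bd h l
lemma uo {c:ℝ} (h : c ∈ uIoc (-1:ℝ) (-1/2)) : c ∈ Icc (-1:ℝ) (-1/2) := by
  rw [uIoc_of_le (by norm_num)] at h; exact Ioc_subset_Icc_self h
lemma Sf_int {g:ℝ → ℝ} (hg : Continuous g) : HasSum (fun l => cf l * ∫ c in (-1:ℝ)..(-1/2), g c*Lg l (T3 c))
    (∫ c in (-1:ℝ)..(-1/2), g c*Sf c) := by
  have := intervalIntegral.hasSum_integral_of_dominated_convergence (μ := volume) (a := -1) (b := -1/2)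
    (F := fun l c => cf l*(g c*Lg l (T3 c))) (f := fun c => g c*Sf c) (fun l c => |cf l| * |g c|) ?_ ?_ ?_ ?_ ?_
  · simpa only [intervalIntegral.integral_const_mul] using this
  · intro l
    have := Pc_cont l
    exact Continuous.aestronglyMeasurable (by fun_prop)
  · intro l
    refine Eventually.of_forall fun c hc => ?_
    have := cf_bd (uo hc) l
    calc ‖cf l*(g c*Lg l (T3 c))‖ = ‖cf l*Lg l (T3 c)‖ * |g c| := by
          rw [← Real.norm_eq_abs, ← norm_mul]; ring_nf
      _ ≤ _ := by gcongr
  · exact Eventually.of_forall fun c hc => cf_sum.mul_right _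
  · simp only [tsum_mul_right]
    exact Continuous.intervalIntegrable (by fun_prop) _ _
  · refine Eventually.of_forall fun c hc => ?_
    refine ((Sf_has (uo hc)).mul_left (g c)).congr_fun fun l => ?_
    ring
lemma DD_contJ : ContinuousOn DD JJ := fun c hc => (DD_deriv hc).continuousAt.continuousWithinAt
def De:ℝ → ℝ := extendFrom JJ DD
lemma De_cont : ContinuousOn De (Icc (-1) (-1/2)) :=
  continuousOn_Icc_extendFrom_Ioo DD_contJ DD_lim0 DD_lim1
lemma De_eq {c:ℝ} (h : c ∈ JJ) : De c = DD c :=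
  extendFrom_eq (subset_closure h) (DD_contJ c h)
def eE (c:ℝ) : ℝ := De c-Sf c
lemma eE_cont : ContinuousOn eE (Icc (-1) (-1/2)) := De_cont.sub Sf_cont
lemma eE_int {g:ℝ → ℝ} (hg : Continuous g) : IntervalIntegrable (fun c => g c*eE c) volume (-1) (-1/2) := by
  refine ContinuousOn.intervalIntegrable ?_
  rw [uI]; exact hg.continuousOn.mul eE_cont
lemma e_mom (m:ℕ) : ∫ c in (-1:ℝ)..(-1/2), (4*c^2-1)*Lg m (T3 c)*eE c=0 := by
  have c1 := Pc_cont m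
  have g1 : Continuous fun c:ℝ => (4*c^2-1)*Lg m (T3 c) := by fun_prop
  have i1 : IntervalIntegrable (fun c => (4*c^2-1)*Lg m (T3 c)*De c) volume (-1) (-1/2) := by
    refine ContinuousOn.intervalIntegrable ?_
    rw [uI]; exact g1.continuousOn.mul De_cont
  have i2 : IntervalIntegrable (fun c => (4*c^2-1)*Lg m (T3 c)*Sf c) volume (-1) (-1/2) := by
    refine ContinuousOn.intervalIntegrable ?_
    rw [uI]; exact g1.continuousOn.mul Sf_cont
  have a : ∫ c in (-1:ℝ)..(-1/2), (4*c^2-1)*Lg m (T3 c)*De c = dl m :=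
    congJ fun c hc => by rw [De_eq hc]
  have b : ∫ c in (-1:ℝ)..(-1/2), (4*c^2-1)*Lg m (T3 c)*Sf c = dl m := by
    refine (Sf_int g1).unique ?_
    have e : ∀ l, ∫ c in (-1:ℝ)..(-1/2), (4*c^2-1)*Lg m (T3 c)*Lg l (T3 c) = ip m l := fun l => by
      rw [ip]; exact intervalIntegral.integral_congr fun c _ => by ring
    simp only [e]
    have s := hasSum_single (f := fun l => cf l*ip m l) m fun l hl => by
      simp only [orth (Ne.symm hl), mul_zero]
    have e2 : cf m*ip m m = dl m := by
      rw [cf]; linear_combination dl m/2*ip_self m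
    rwa [e2] at s
  have : (fun c => (4*c^2-1)*Lg m (T3 c)*eE c) = fun c => (4*c^2-1)*Lg m (T3 c)*De c-(4*c^2-1)*Lg m (T3 c)*Sf c :=
    funext fun c => by rw [eE]; ring
  rw [this, intervalIntegral.integral_sub i1 i2, a, b, sub_self]
lemma e_momk (k:ℕ) : ∀ m, ∫ c in (-1:ℝ)..(-1/2), ((4*c^2-1)*(T3 c^k*Lg m (T3 c)))*eE c=0 := by
  have c3 := T3_cont
  induction k with
  | zero => intro m; simpa using e_mom m
  | succ k ih =>
    intro m
    cases m with
    | zero =>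
      rw [← ih 1]
      refine intervalIntegral.integral_congr fun c _ => ?_
      simp only [Lg]; ring
    | succ n =>
      have c1 := Pc_cont n
      have c2 := Pc_cont (n+2)
      have i1 := eE_int (g := fun c => (4*c^2-1)*(T3 c^k*Lg n (T3 c))) (by fun_prop)
      have i2 := eE_int (g := fun c => (4*c^2-1)*(T3 c^k*Lg (n+2) (T3 c))) (by fun_prop)
      have p : (2*(n:ℝ)+3)≠0 := by positivity
      apply mul_left_cancel₀ p
      calc _ = ((n:ℝ)+2)*(∫ c in (-1:ℝ)..(-1/2), ((4*c^2-1)*(T3 c^k*Lg (n+2) (T3 c)))*eE c)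
            + ((n:ℝ)+1)*(∫ c in (-1:ℝ)..(-1/2), ((4*c^2-1)*(T3 c^k*Lg n (T3 c)))*eE c) := by
            rw [← intervalIntegral.integral_const_mul, ← intervalIntegral.integral_const_mul,
              ← intervalIntegral.integral_const_mul, ← intervalIntegral.integral_add (i2.const_mul _) (i1.const_mul _)]
            refine intervalIntegral.integral_congr fun c _ => ?_
            linear_combination -(4*c^2-1)*T3 c^k*eE c*Lg_rec n (T3 c)
        _ = _ := by rw [ih, ih]; ring
lemma e_poly (p : Polynomial ℝ) : ∫ c in (-1:ℝ)..(-1/2), ((4*c^2-1)*p.eval (T3 c))*eE c=0 := by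
  have c3 := T3_cont
  induction p using Polynomial.induction_on' with
  | add p q hp hq =>
    have i1 := eE_int (g := fun c => (4*c^2-1)*p.eval (T3 c)) (by fun_prop)
    have i2 := eE_int (g := fun c => (4*c^2-1)*q.eval (T3 c)) (by fun_prop)
    rw [← add_zero (0:ℝ)]
    nth_rw 1 [← hp]
    rw [← hq, ← intervalIntegral.integral_add i1 i2]
    refine intervalIntegral.integral_congr fun c _ => ?_
    simp only [Polynomial.eval_add]; ring
  | monomial n a =>
    rw [← mul_zero a, ← e_momk n 0, ← intervalIntegral.integral_const_mul]
    refine intervalIntegral.integral_congr fun c _ => ?_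
    simp only [Polynomial.eval_monomial, Lg]; ring
def cy (y:ℝ) : ℝ := cos ((arccos y+2*π)/3)
lemma cy_cont : Continuous cy := by
  have := Real.continuous_arccos
  unfold cy; fun_prop
lemma cy_T {y:ℝ} (h : y ∈ Icc (-1:ℝ) 1) : T3 (cy y) = y := by
  rw [T3, cy, ← Real.cos_three_mul, show 3*((arccos y+2*π)/3) = arccos y+2*π by ring, Real.cos_add_two_pi,
    Real.cos_arccos h.1 h.2]
lemma cy_mem (y:ℝ) : cy y ∈ Icc (-1:ℝ) (-1/2) := by
  refine ⟨Real.neg_one_le_cos _, ?_⟩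
  have a := Real.arccos_nonneg y
  have b := Real.arccos_le_pi y
  have e : cos (2*π/3) = -1/2 := by
    rw [show 2*π/3 = π-π/3 by ring, Real.cos_pi_sub, Real.cos_pi_div_three]; norm_num
  rw [← e]
  exact Real.cos_le_cos_of_nonneg_of_le_pi (by positivity) (by linarith) (by linarith)
lemma cy_inv {c:ℝ} (h : c ∈ Icc (-1:ℝ) (-1/2)) : cy (T3 c) = c := by
  have e := cy_T (T3_memc h)
  have m := cy_mem (T3 c)
  generalize cy (T3 c) = b at *
  rw [T3, T3] at e
  have f : (b-c)*(4*(b^2+b*c+c^2)-3)=0 := by linear_combination e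
  rcases mul_eq_zero.1 f with g | g
  · linarith
  · have h1 := h.2
    have h2 := m.2
    nlinarith [mul_nonneg (by linarith :0 ≤ -1/2-b) (by linarith :0 ≤ -1/2-c), sq_nonneg (b-c),
      mul_nonneg (by linarith :0 ≤ -1/2-b) (by linarith :0 ≤ -1/2-b), mul_nonneg (by linarith :0 ≤ -1/2-c) (by linarith :0 ≤ -1/2-c)]
lemma e_sq : ∫ c in (-1:ℝ)..(-1/2), (4*c^2-1)*eE c*eE c=0 := by
  have c3 := T3_cont
  have w0 : ∀ c ∈ Icc (-1:ℝ) (-1/2),0≤4*c^2-1 := fun c hc => by nlinarith [hc.1, hc.2]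
  have ci : ContinuousOn (fun c => (4*c^2-1)*eE c*eE c) (Icc (-1) (-1/2)) := by
    have := eE_cont; fun_prop
  have ca : ContinuousOn (fun c => (4*c^2-1) * |eE c|) (Icc (-1) (-1/2)) := by
    have := eE_cont; fun_prop
  have ii : ∀ {f:ℝ → ℝ}, ContinuousOn f (Icc (-1) (-1/2)) → IntervalIntegrable f volume (-1) (-1/2) := fun h => by
    refine ContinuousOn.intervalIntegrable ?_
    rwa [uI]
  set K := ∫ c in (-1:ℝ)..(-1/2), (4*c^2-1) * |eE c| with hK
  have K0 :0 ≤ K := intervalIntegral.integral_nonneg (by norm_num) fun c hc => mul_nonneg (w0 c hc) (abs_nonneg _)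
  apply le_antisymm
  · refine le_of_forall_pos_le_add fun δ hδ => ?_
    obtain ⟨p, hp⟩ := exists_polynomial_near_of_continuousOn (-1) 1 (fun y => eE (cy y))
      (eE_cont.comp cy_cont.continuousOn fun y _ => cy_mem y) (δ/(K+1)) (by positivity)
    have i1 := eE_int (g := fun c => (4*c^2-1)*p.eval (T3 c)) (by fun_prop)
    have : ∫ c in (-1:ℝ)..(-1/2), (4*c^2-1)*eE c*eE c
        ≤ ∫ c in (-1:ℝ)..(-1/2), (((4*c^2-1)*p.eval (T3 c))*eE c+δ/(K+1)*((4*c^2-1) * |eE c|)) := by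
      refine intervalIntegral.integral_mono_on (by norm_num) (ii ci) (i1.add ((ii ca).const_mul _)) fun c hc => ?_
      have h := hp (T3 c) (T3_memc hc)
      simp only [cy_inv hc] at h
      have h2 : (eE c-p.eval (T3 c))*eE c ≤ δ/(K+1) * |eE c| := by
        refine (le_abs_self _).trans ?_
        rw [abs_mul, abs_sub_comm]
        exact mul_le_mul_of_nonneg_right h.le (abs_nonneg _)
      nlinarith [w0 c hc]
    rw [intervalIntegral.integral_add i1 ((ii ca).const_mul _), intervalIntegral.integral_const_mul, e_poly, ← hK] at this
    refine this.trans ?_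
    rw [zero_add, zero_add, div_mul_eq_mul_div, div_le_iff₀ (by positivity)]
    nlinarith
  · exact intervalIntegral.integral_nonneg (by norm_num) fun c hc => by
      rw [mul_assoc]; exact mul_nonneg (w0 c hc) (mul_self_nonneg _)
lemma e_zero {c:ℝ} (h : c ∈ JJ) : eE c=0 := by
  by_contra hne
  have ci : ContinuousOn (fun c => (4*c^2-1)*eE c*eE c) (Icc (-1) (-1/2)) := by
    have := eE_cont; fun_prop
  have := intervalIntegral.integral_pos (by norm_num) ci (fun x hx => ?_) ⟨c, Ioo_subset_Icc_self h, ?_⟩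
  · rw [e_sq] at this; exact lt_irrefl _ this
  · rw [mul_assoc]; exact mul_nonneg (by nlinarith [hx.1, hx.2]) (mul_self_nonneg _)
  · obtain ⟨h1, h2, h3, h4, h5, h6, h7⟩ := JJ_facts h
    rw [mul_assoc]; exact mul_pos h4 (mul_self_pos.2 hne)
lemma R_sum : HasSum (fun l => cf l*(-(3*(l:ℝ)*((l:ℝ)+1))*sl l))
    (∫ c in (-1:ℝ)..(-1/2), sg c*(fA c*pB c+pA c*fB c)) := by
  have s := Sf_int (g := sg) (by unfold sg; fun_prop)
  simp only [sig_eq] at s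
  rwa [congJ (f := fun c => sg c*Sf c) (g := fun c => sg c*(fA c*pB c+pA c*fB c)) fun c hc => ?_] at s
  have e := e_zero hc
  rw [eE, De_eq hc, DD] at e
  rw [← sub_eq_zero.1 e]
lemma ris_sh (a:ℝ) (n:ℕ) : a*ris (a+1) n = ris a n*(a+n) := by
  induction n with
  | zero => simp [ris_zero]
  | succ n ih =>
    rw [ris_succ, ris_succ, ← mul_assoc, ih]; push_cast; ring
lemma ris_fac (n:ℕ) : ris 1 n = n.factorial := by
  induction n with
  | zero => simp [ris_zero]
  | succ n ih => rw [ris_succ, ih, Nat.factorial_succ]; push_cast; ring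
lemma rp {a:ℝ} (h :0 < a) (n:ℕ) : ris a n≠0 := (ris_pos h n).ne'
lemma n_cl (k:ℕ) : nl (2*k)*(ris 1 k^2*ris (5/6) k*ris (7/6) k)=3*(ris (1/2) k^2*ris (1/3) k*ris (2/3) k) := by
  induction k with
  | zero => simp [ris_zero, n_zero]
  | succ k ih =>
    have e := n_rec (2*k)
    rw [show 2*(k+1)=2*k+2 by ring]
    simp only [ris_succ]
    push_cast at e
    linear_combination (ris 1 k^2*ris (5/6) k*ris (7/6) k)/16*e+(2*(k:ℝ)+1)^2*((2*(k:ℝ)+1)^2-1/9)/16*ih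
lemma s_cl (k:ℕ) : sl (2*k+1)*(ris (7/6) k*ris (17/6) k)=9/22*(ris (-1/3) k*ris (4/3) k) := by
  induction k with
  | zero => simp [ris_zero, s_one]
  | succ k ih =>
    have e := s_rec (2*k+1)
    rw [show 2*(k+1)+1=2*k+1+2 by ring]
    simp only [ris_succ]
    push_cast at e
    linear_combination (ris (7/6) k*ris (17/6) k)/4*e+((2*(k:ℝ)+1)^2-25/9)/4*ih
def ht (n:ℕ) : ℝ := (ris (-1/3) n*ris (1/3) n*ris (2/3) n*ris (4/3) n*ris (3/2) n*ris (3/2) n*ris (7/4) n)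
  / (ris (3/4) n*ris 1 n*ris (7/6) n*ris (11/6) n*ris (13/6) n*ris (17/6) n)/(n.factorial:ℝ)
lemma tm_eq (k:ℕ) : cf (2*k+1)*(-(3*((2*k+1:ℕ):ℝ)*(((2*k+1:ℕ):ℝ)+1))*sl (2*k+1)) = -(1458/385)*ht k := by
  have hn := n_cl k
  have hs := s_cl k
  have hd := d_eq (2*k)
  have k0 : (0:ℝ) ≤ k := Nat.cast_nonneg k
  have a1 := ris_sh (1/2) k
  have a2 := ris_sh (3/4) k
  have a3 := ris_sh (5/6) k
  have a4 := ris_sh (7/6) k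
  have p1 := rp (by norm_num : (0:ℝ)<1) k
  have p2 := rp (by norm_num : (0:ℝ)<5/6) k
  have p3 := rp (by norm_num : (0:ℝ)<7/6) k
  have p4 := rp (by norm_num : (0:ℝ)<17/6) k
  have p5 := rp (by norm_num : (0:ℝ)<3/4) k
  norm_num at a1 a2 a3 a4
  have b1 : ris (3/2) k=2*(ris (1/2) k*(1/2+k)) := by linarith
  have b2 : ris (7/4) k=4/3*(ris (3/4) k*(3/4+k)) := by linarith
  have b3 : ris (11/6) k=6/5*(ris (5/6) k*(5/6+k)) := by linarith
  have b4 : ris (13/6) k=6/7*(ris (7/6) k*(7/6+k)) := by linarith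
  have q1 : (5/6+(k:ℝ))≠0 := by positivity
  have q2 : (7/6+(k:ℝ))≠0 := by positivity
  have q3 : (2*(k:ℝ)+2)≠0 := by positivity
  have n' : nl (2*k)=3*(ris (1/2) k^2*ris (1/3) k*ris (2/3) k)/(ris 1 k^2*ris (5/6) k*ris (7/6) k) := by
    rw [eq_div_iff (by positivity)]; exact hn
  have s' : sl (2*k+1)=9/22*(ris (-1/3) k*ris (4/3) k)/(ris (7/6) k*ris (17/6) k) := by
    rw [eq_div_iff (by positivity)]; exact hs
  have d' : dl (2*k+1)=8/9*(2*k+1)*nl (2*k)/((2*k+2)*(4*((5/6+k)*(7/6+k)))) := by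
    rw [eq_div_iff (by positivity)]; push_cast at hd; linear_combination hd
  rw [cf, d', s', n', ht, b1, b2, b3, b4, ← ris_fac]
  push_cast
  generalize ris (-1/3) k = r1, ris (1/3) k = r2, ris (2/3) k = r3, ris (4/3) k = r4, ris (1/2) k = r5 at *
  generalize ris (3/4) k = r6, ris 1 k = r7, ris (7/6) k = r8, ris (5/6) k = r9, ris (17/6) k = r10 at *
  generalize (k:ℝ) = x at *
  field_simp
  ring
lemma h_sum : HasSum (fun k => -(1458/385)*ht k) (∫ c in (-1:ℝ)..(-1/2), sg c*(fA c*pB c+pA c*fB c)) := by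
  have inj : Function.Injective (fun k:ℕ => 2*k+1) := fun a b h => by simpa using h
  have := (inj.hasSum_iff ?_).2 R_sum
  · refine this.congr_fun fun k => ?_
    exact (tm_eq k).symm
  · intro l hl
    rcases Nat.even_or_odd' l with ⟨m, h | h⟩
    · rw [h, cf, d_even]; ring
    · exact absurd ⟨m, h.symm⟩ hl
lemma pFq_ht : pFq [-1/3,1/3,2/3,4/3,3/2,3/2,7/4] [3/4,1,7/6,11/6,13/6,17/6] 1 = ∑' n, ht n := by
  rw [pFq]
  refine tsum_congr fun n => ?_
  simp only [List.map, List.prod_cons, List.prod_nil, one_pow, mul_one, ht, mul_assoc]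
theorem broadhurst_laporta_7F6 :
    (∫ t in Ioi (0:ℝ), I0 t * (K0 t)^5 * t * (1 - 8*t^2))
    = (81 * Real.sqrt 3 * π^3 / 2200) *
        pFq [-1/3, 1/3, 2/3, 4/3, 3/2, 3/2, 7/4]
          [3/4, 1, 7/6, 11/6, 13/6, 17/6] 1 := by
  have h := h_sum.tsum_eq
  rw [tsum_mul_left] at h
  rw [pFq_ht]
  have e := A_eq2
  rw [cid, ← h] at e
  linear_combination e/3
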